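/- Let A be an AW*-algebra and n a positive integer. If M is a maximal abelian subalgebra of the matrix algebra M_n(A), then M contains n pairwise orthogonal projections, pairwise equivalent in M_n(A), whose sum is 1. -/

import Mathlib

universe u

section Defs

variable {R : Type u} [Ring R] [StarRing R]

/-- An element is a projection if it is self-adjoint and idempotent. -/
def IsProjection (p : R) : Prop := star p = p ∧ p * p = p

/-- Order on projections: `e ≤ f` iff `e = ef`. -/
def ProjLE (e f : R) : Prop := e * f = e

/-- Murray–von Neumann equivalence of projections. -/
def ProjEquiv (e f : R) : Prop := ∃ v : R, star v * v = e ∧ v * star v = f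

/-- `e ≼ f` : `e` is equivalent to a subprojection of `f`. -/
def ProjSubEquiv (e f : R) : Prop :=
  ∃ e' : R, IsProjection e' ∧ ProjLE e' f ∧ ProjEquiv e e'

/-- `e ≺ f` : `e ≼ f` but `e` is not equivalent to `f` (with the convention `0 ≺ 0`). -/
def ProjLT (e f : R) : Prop :=
  (ProjSubEquiv e f ∧ ¬ ProjEquiv e f) ∨ (e = 0 ∧ f = 0)

/-- A central projection. -/
def IsCentralProj (z : R) : Prop := IsProjection z ∧ ∀ a : R, z * a = a * z

/-- `c` is the central cover of `e`: the least central projection above `e`. -/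
def IsCentralCover (e c : R) : Prop :=
  IsCentralProj c ∧ ProjLE e c ∧
    ∀ z : R, IsCentralProj z → ProjLE e z → ProjLE c z

/-- A projection `e` is finite if `e ∼ f ≤ e` implies `f = e`. -/
def ProjFinite (e : R) : Prop :=
  ∀ f : R, IsProjection f → ProjEquiv e f → ProjLE f e → f = e

/-- A nonzero projection is properly infinite if `ze` is infinite
for every central projection `z` with `ze ≠ 0`. -/
def ProperlyInfinite (e : R) : Prop :=
  IsProjection e ∧ e ≠ 0 ∧
    ∀ z : R, IsCentralProj z → z * e ≠ 0 → ¬ ProjFinite (z * e)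

/-- A pairwise orthogonal family of elements. -/
def PairwiseOrthogonal {ι : Type*} (p : ι → R) : Prop :=
  ∀ i j, i ≠ j → p i * p j = 0

/-- `s` is the supremum of the family `p` in the projection order. For an
orthogonal family, this is the sum `Σ pᵢ`. -/
def IsSupProj {ι : Type*} (p : ι → R) (s : R) : Prop :=
  IsProjection s ∧ (∀ i, ProjLE (p i) s) ∧
    ∀ t : R, IsProjection t → (∀ i, ProjLE (p i) t) → ProjLE s t

/-- The family `p` belongs to `Γ(e)`: an orthogonal family of projections,
each equivalent to `e`, with sum (supremum) `e`. -/
def InGamma (e : R) {ι : Type u} (p : ι → R) : Prop :=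
  (∀ i, IsProjection (p i)) ∧ PairwiseOrthogonal p ∧
    (∀ i, ProjEquiv (p i) e) ∧ IsSupProj p e

open Classical in
/-- The dimension `d(e)` of a properly infinite projection: the least cardinal
strictly greater than the cardinality of the index set of every family in
`Γ(e)`, with the convention `d(0) = 0`. -/
noncomputable def projDim (e : R) : Cardinal.{u} :=
  if e = 0 then 0
  else sSup {c : Cardinal.{u} |
    ∃ (ι : Type u) (p : ι → R), InGamma e p ∧ c = Order.succ (Cardinal.mk ι)}

/-- A properly infinite projection `e` is equidimensional if `d(ze) = d(e)`
for every central projection `z` with `ze ≠ 0` (equivalently, for every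
nonzero central projection `z ≤ c(e)`). -/
def Equidimensional (e : R) : Prop :=
  ProperlyInfinite e ∧
    ∀ z : R, IsCentralProj z → z * e ≠ 0 → projDim (z * e) = projDim e

/-- An abelian projection: the corner `eRe` is commutative. -/
def IsAbelianProj (e : R) : Prop :=
  IsProjection e ∧ ∀ a b : R, (e * a * e) * (e * b * e) = (e * b * e) * (e * a * e)

/-- `j` is the join `e ∨ f` in the projection lattice. -/
def IsJoinProj (e f j : R) : Prop :=
  IsProjection j ∧ ProjLE e j ∧ ProjLE f j ∧
    ∀ t : R, IsProjection t → ProjLE e t → ProjLE f t → ProjLE j t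

end Defs

/-- The AW*-condition: the right annihilator of any subset is generated by a
projection: `{a | ∀ s ∈ S, s a = 0} = pR`. -/
def IsAWStarRing (R : Type*) [Ring R] [StarRing R] : Prop :=
  ∀ S : Set R, ∃ p : R, IsProjection p ∧
    {a : R | ∀ s ∈ S, s * a = 0} = {a : R | ∃ b : R, a = p * b}

/-- A maximal abelian (*-sub)algebra. -/
def IsMaximalAbelian {A : Type*} [Ring A] [StarRing A] [Algebra ℂ A] [StarModule ℂ A]
    (M : StarSubalgebra ℂ A) : Prop :=
  (∀ x ∈ M, ∀ y ∈ M, x * y = y * x) ∧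
    ∀ N : StarSubalgebra ℂ A, (∀ x ∈ N, ∀ y ∈ N, x * y = y * x) → M ≤ N → M = N

set_option linter.unusedVariables false
set_option linter.unusedSimpArgs false
namespace MM
variable {B : Type*} [CStarAlgebra B]

theorem ra {R : Type*} [Semigroup R] {a b c : R} (h : a * b = c) (x : R) : a * (b * x) = c * x := by
  rw [← mul_assoc, h]

theorem ra3 {R : Type*} [Semigroup R] {a b c d : R} (h : a * (b * c) = d) (x : R) :
    a * (b * (c * x)) = d * x := by
  rw [← h]; simp only [mul_assoc]

theorem z1 {x : B} (h : star x * x = 0) : x = 0 := (CStarRing.star_mul_self_eq_zero_iff x).1 h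
theorem z2 {x : B} (h : x * star x = 0) : x = 0 := (CStarRing.mul_star_self_eq_zero_iff x).1 h

theorem z3 {s x : B} (h : star s * (s * x) = 0) : s * x = 0 := by
  apply z1; rw [star_mul, mul_assoc, h, mul_zero]

theorem pj_zero : IsProjection (0 : B) := ⟨by simp, by simp⟩
theorem pj_one : IsProjection (1 : B) := ⟨by simp, by simp⟩

theorem le_symm {e u : B} (he : IsProjection e) (hu : IsProjection u) (h : e * u = e) : u * e = e := by
  have := congrArg star h
  rwa [star_mul, he.1, hu.1] at this

theorem le_symm' {e u : B} (he : IsProjection e) (hu : IsProjection u) (h : u * e = e) : e * u = e := by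
  have := congrArg star h
  rwa [star_mul, he.1, hu.1] at this

theorem orth_symm {e f : B} (he : IsProjection e) (hf : IsProjection f) (h : e * f = 0) : f * e = 0 := by
  have := congrArg star h
  rwa [star_mul, he.1, hf.1, star_zero] at this

theorem pj_sub {e u : B} (he : IsProjection e) (hu : IsProjection u) (h : e * u = e) :
    IsProjection (u - e) := by
  have h2 := le_symm he hu h
  refine ⟨by rw [star_sub, he.1, hu.1], ?_⟩
  rw [sub_mul, mul_sub, mul_sub, hu.2, h2, h, he.2]; simp

theorem pj_compl {e : B} (he : IsProjection e) : IsProjection (1 - e) :=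
  pj_sub he pj_one (mul_one e)

theorem pj_add {e f : B} (he : IsProjection e) (hf : IsProjection f) (h : e * f = 0) :
    IsProjection (e + f) := by
  have h2 := orth_symm he hf h
  refine ⟨by rw [star_add, he.1, hf.1], ?_⟩
  rw [add_mul, mul_add, mul_add, h, h2, he.2, hf.2]; simp

theorem pj_mul {e f : B} (he : IsProjection e) (hf : IsProjection f) (h : e * f = f * e) :
    IsProjection (e * f) := by
  refine ⟨by rw [star_mul, he.1, hf.1, h], ?_⟩
  calc e * f * (e * f) = e * (f * e) * f := by simp only [mul_assoc]
    _ = (e * e) * (f * f) := by rw [← h]; simp only [mul_assoc]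
    _ = e * f := by rw [he.2, hf.2]

/-- star of a product equation -/
theorem st {a b c : B} (h : a * b = c) : star b * star a = star c := by rw [← h, star_mul]

theorem pi_of_pj {v e : B} (he : IsProjection e) (h : star v * v = e) : v * e = v := by
  have : v * (1 - e) = 0 := by
    apply z1
    rw [star_mul, star_sub, star_one, he.1, mul_assoc, ← mul_assoc (star v), h]
    simp [mul_sub, sub_mul, he.2]
  rw [mul_sub, mul_one, sub_eq_zero] at this
  exact this.symm

theorem pi3 {v e : B} (he : IsProjection e) (h : star v * v = e) : v * (star v * v) = v := by
  rw [h]; exact pi_of_pj he h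

theorem pi_star {w : B} (h : w * (star w * w) = w) : star w * (w * star w) = star w := by
  have := congrArg star h
  simpa [mul_assoc] using this

theorem pi_src {w : B} (h : w * (star w * w) = w) : IsProjection (star w * w) :=
  ⟨by simp, by rw [mul_assoc, h]⟩
theorem pi_rng {w : B} (h : w * (star w * w) = w) : IsProjection (w * star w) :=
  ⟨by simp, by rw [mul_assoc, pi_star h]⟩

def Ann (S : Set B) (E : B) : Prop := IsProjection E ∧ ∀ x, (∀ s ∈ S, s * x = 0) ↔ E * x = 0

def AWC (u : B) : Prop := IsProjection u ∧ ∀ S : Set B, (∀ s ∈ S, s * u = s) → ∃ E, Ann S E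

namespace Ann
variable {S : Set B} {E : B}

theorem mul_self (h : Ann S E) {s : B} (hs : s ∈ S) : s * E = s := by
  have := (h.2 (1 - E)).2 (by rw [mul_sub, h.1.2, mul_one, sub_self]) s hs
  rw [mul_sub, mul_one, sub_eq_zero] at this
  exact this.symm

theorem le (h : Ann S E) {u : B} (hs : ∀ s ∈ S, s * u = s) : E * u = E := by
  have := (h.2 (1 - u)).1 (fun s hs' => by rw [mul_sub, hs s hs', mul_one, sub_self])
  rw [mul_sub, mul_one, sub_eq_zero] at this
  exact this.symm

theorem left (h : Ann S E) (y : B) : (∀ s ∈ S, y * star s = 0) ↔ y * E = 0 := by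
  have h1 := h.2 (star y)
  constructor
  · intro h2
    have := st (h1.1 (fun s hs => by simpa using st (h2 s hs)))
    simpa [h.1.1] using this
  · intro h2 s hs
    have h3 : E * star y = 0 := by simpa [h.1.1] using st h2
    simpa using st (h1.2 h3 s hs)

theorem unique {E' : B} (h : Ann S E) (h' : Ann S E') : E = E' := by
  have a := h.le (fun s hs => h'.mul_self hs)
  have b := h'.le (fun s hs => h.mul_self hs)
  rw [← a]; exact le_symm h'.1 h.1 b

theorem commute (h : Ann S E) {c : B} (h1 : ∀ s ∈ S, s * c = c * s)
    (h2 : ∀ s ∈ S, s * star c = star c * s) : c * E = E * c := by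
  have key : ∀ d : B, (∀ s ∈ S, s * d = d * s) → E * d = E * d * E := by
    intro d hd
    have := (h.2 (d * (1 - E))).1 (fun s hs => by
      rw [← mul_assoc, hd s hs, mul_assoc, mul_sub, h.mul_self hs, mul_one, sub_self, mul_zero])
    rw [mul_sub, mul_one, mul_sub, sub_eq_zero] at this
    rw [mul_assoc, ← this]
  have a := key c h1
  have b := congrArg star (key _ h2)
  simp only [star_mul, star_star, h.1.1] at b
  rw [b, ← mul_assoc, ← a]

end Ann

theorem AWC.sub {u e : B} (h : AWC u) (he : IsProjection e) (hle : e * u = e) : AWC e := by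
  refine ⟨he, fun S hS => h.2 S fun s hs => ?_⟩
  rw [← hS s hs, mul_assoc, hle]

theorem AWC.of_equiv {u v e f : B} (h : AWC u) (he : IsProjection e)
    (h1 : star v * v = e) (h3 : u * v = v) : AWC e := by
  have hve := pi_of_pj he h1
  refine ⟨he, fun S hS => ?_⟩
  have h3' : star v * u = star v := by simpa [h.1.1] using st h3
  obtain ⟨E, hE⟩ := h.2 ((fun s => s * star v) '' S) (by
    rintro _ ⟨s, hs, rfl⟩
    rw [mul_assoc, h3'])
  have hEf : E * (v * star v) = E := hE.le (by
    rintro _ ⟨s, hs, rfl⟩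
    have : star v * (v * star v) = star v := pi_star (pi3 he h1)
    simp only [mul_assoc, this])
  have hEf' : v * star v * E = E := le_symm hE.1 (pi_rng (pi3 he h1)) hEf
  refine ⟨star v * E * v, ⟨⟨by simp [hE.1.1, mul_assoc], ?_⟩, fun x => ?_⟩⟩
  · calc star v * E * v * (star v * E * v) = star v * (E * (v * star v)) * E * v := by
          simp only [mul_assoc]
      _ = star v * E * v := by rw [hEf, mul_assoc (star v), hE.1.2]
  · have := hE.2 (v * x)
    constructor
    · intro hx
      have := this.1 (by
        rintro _ ⟨s, hs, rfl⟩
        rw [mul_assoc, ← mul_assoc (star v), h1, ← mul_assoc, hS s hs, hx s hs])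
      rw [mul_assoc, mul_assoc, this, mul_zero]
    · intro hx s hs
      have h5 : E * (v * x) = 0 := by
        have := congrArg (v * ·) hx
        simp only [mul_zero] at this
        rw [← hEf']
        simpa only [mul_assoc] using this
      have := this.2 h5 _ ⟨s, hs, rfl⟩
      simp only at this
      rwa [mul_assoc, ← mul_assoc (star v), h1, ← mul_assoc, hS s hs] at this

theorem AWC_one (h : IsAWStarRing B) : AWC (1 : B) := by
  refine ⟨pj_one, fun S _ => ?_⟩
  obtain ⟨p, hp, hS⟩ := h S
  refine ⟨1 - p, pj_compl hp, fun x => ?_⟩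
  have := Set.ext_iff.1 hS x
  simp only [Set.mem_ofPred_eq] at this
  rw [this]
  constructor
  · rintro ⟨b, rfl⟩
    rw [sub_mul, one_mul, ← mul_assoc, hp.2, sub_self]
  · intro h
    rw [sub_mul, one_mul, sub_eq_zero] at h
    exact ⟨x, h⟩

theorem SL {u x : B} (hu : AWC u) (hx : x * u = x) (h0 : x ≠ 0) :
    ∃ h y : B, IsProjection h ∧ h ≠ 0 ∧ h * u = h ∧ y * h = y ∧ h * y = y ∧ star y = y ∧
      star x * x * (y * y) = h ∧
      ∀ c, (star x * x) * c = c * (star x * x) → c * h = h * c ∧ c * y = y * c := by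
  set a := star x * x with ha
  have sa : IsSelfAdjoint a := IsSelfAdjoint.star_mul_self x
  have a0 : a ≠ 0 := fun h => h0 (z1 h)
  have hpos : ∀ t ∈ spectrum ℝ a, 0 ≤ t := spectrum_star_mul_self_nonneg
  set ε : ℝ := ‖a‖ / 2 with hε
  have hn : 0 < ‖a‖ := norm_pos_iff.2 a0
  have ε0 : 0 < ε := by positivity
  have au : a * u = a := by rw [ha, mul_assoc, hx]
  let gf : ℝ → ℝ := fun t => max (t - ε) 0
  let df : ℝ → ℝ := fun t => max (ε - t) 0
  let mf : ℝ → ℝ := fun t => (Real.sqrt (max t ε))⁻¹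
  have cg : Continuous gf := by fun_prop
  have cd : Continuous df := by fun_prop
  have mpos : ∀ t, 0 < Real.sqrt (max t ε) := fun t => Real.sqrt_pos.2 (lt_max_of_lt_right ε0)
  have cm : Continuous mf := by
    refine Continuous.inv₀ (by fun_prop) (fun t => (mpos t).ne')
  set g := cfc gf a with hg
  set d := cfc df a with hd
  set m := cfc mf a with hm
  have gu : g * u = g := by
    have : g = cfc (fun t => gf t / max t ε) a * a := by
      conv_rhs => rw [← cfc_id' ℝ a]
      have cq : Continuous (fun t => gf t / max t ε) :=
        cg.div (by fun_prop) (fun t => (lt_max_of_lt_right ε0).ne')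
      rw [cfc_id' ℝ a]
      conv_rhs => rhs; rw [← cfc_id' ℝ a]
      rw [← cfc_mul _ _ a cq.continuousOn (by fun_prop)]
      refine cfc_congr fun t ht => ?_
      simp only [gf]
      rcases le_total t ε with h | h
      · rw [max_eq_right (by linarith)]; simp
      · rw [max_eq_left (by linarith : (0:ℝ) ≤ t - ε), max_eq_left h]
        field_simp [(lt_of_lt_of_le ε0 h).ne']
    rw [this, mul_assoc, au]
  have g0 : g ≠ 0 := by
    intro h
    have h1 : a = g + cfc (fun t => min t ε) a := by
      conv_lhs => rw [← cfc_id' ℝ a]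
      rw [hg, ← cfc_add _ _ _ cg.continuousOn (by fun_prop)]
      refine cfc_congr fun t ht => ?_
      simp only [gf]
      rcases le_total t ε with h | h
      · rw [max_eq_right (by linarith), min_eq_left h]; simp
      · rw [max_eq_left (by linarith), min_eq_right h]; simp
    have : ‖a‖ ≤ ε := by
      rw [h1, h, zero_add]
      refine norm_cfc_le ε0.le fun t ht => ?_
      rw [Real.norm_eq_abs, abs_of_nonneg (le_min (hpos t ht) ε0.le)]
      exact min_le_right _ _
    linarith
  have gd : g * d = 0 := by
    rw [hg, hd, ← cfc_mul _ _ a cg.continuousOn cd.continuousOn]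
    rw [show (0:B) = cfc (fun _ => (0:ℝ)) a by simp]
    refine cfc_congr fun t ht => ?_
    simp only [gf, df]
    rcases le_total t ε with h | h
    · rw [max_eq_right (by linarith)]; simp
    · rw [max_eq_right (by linarith : ε - t ≤ 0)]; simp
  obtain ⟨h, hh⟩ := hu.2 {g} (by simpa using gu)
  have hd0 : h * d = 0 := (hh.2 d).1 (by simpa using gd)
  have hcom : ∀ c, a * c = c * a → c * h = h * c := by
    intro c hc
    have hc' : a * star c = star c * a := by
      have := congrArg star hc; simp only [star_mul c a, star_mul a c, sa.star_eq] at this; exact this.symm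
    refine hh.commute ?_ ?_
    · simp only [Set.mem_singleton_iff, forall_eq]
      exact (Commute.cfc_real (show Commute a c from hc) gf)
    · simp only [Set.mem_singleton_iff, forall_eq]
      exact (Commute.cfc_real (show Commute a (star c) from hc') gf)
  have hmc : ∀ c, a * c = c * a → m * c = c * m := fun c hc =>
    (Commute.cfc_real (show Commute a c from hc) mf)
  have hmh : h * m = m * h := by
    refine (hcom m ?_).symm
    have := (cfc_commute_cfc (R := ℝ) id mf a).eq
    rwa [cfc_id ℝ a] at this
  have ham : (a + d) * (m * m) = 1 := by
    conv_lhs => lhs; lhs; rw [← cfc_id' ℝ a]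
    rw [hd, hm, ← cfc_add _ _ _ (by fun_prop) cd.continuousOn, ← cfc_mul _ _ a cm.continuousOn cm.continuousOn,
      ← cfc_mul (fun t => t + df t) (fun t => mf t * mf t) a (continuous_id.add cd).continuousOn (cm.mul cm).continuousOn, ← cfc_one ℝ a]
    refine cfc_congr fun t ht => ?_
    have h1 : t + df t = max t ε := by
      simp only [df]
      rcases le_total t ε with h | h
      · rw [max_eq_right h, max_eq_left (by linarith)]; ring
      · rw [max_eq_left h, max_eq_right (by linarith)]; ring
    simp only [h1, mf]
    rw [← mul_inv, Real.mul_self_sqrt (lt_max_of_lt_right ε0).le]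
    simp [(lt_max_of_lt_right ε0 : 0 < max t ε).ne']
  have hha : a * h = h * a := hcom a rfl
  refine ⟨h, m * h, hh.1, ?_, hh.le (by simpa using gu), ?_, ?_, ?_, ?_, ?_⟩
  · rintro rfl
    exact g0 (by simpa using (hh.2 1).2 (by simp))
  · rw [mul_assoc, hh.1.2]
  · rw [← mul_assoc, hmh, mul_assoc, hh.1.2]
  · rw [star_mul, hh.1.1, (cfc_predicate mf a : IsSelfAdjoint m).star_eq, hmh]
  · have e1 : m * h * (m * h) = h * (m * m) := by
      rw [mul_assoc, ← mul_assoc h, hmh, mul_assoc m h h, hh.1.2, ← hmh, ← mul_assoc, ← hmh, mul_assoc]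
    have := congrArg (h * ·) ham
    simp only [mul_one, add_mul, mul_add] at this
    rw [e1, ← mul_assoc, hha, mul_assoc]
    rw [← mul_assoc h d, hd0, zero_mul, add_zero] at this
    exact this
  · intro c hc
    refine ⟨hcom c hc, ?_⟩
    rw [← mul_assoc, ← hmc c hc, mul_assoc, hcom c hc, mul_assoc]
end MM

set_option linter.unusedVariables false
set_option linter.unusedSimpArgs false
namespace MM
variable {B : Type*} [CStarAlgebra B]

section dyadic
attribute [local instance] CStarAlgebra.spectralOrder CStarAlgebra.spectralOrderedRing

theorem dy_step {u c : B} (hu : AWC u) (hc : c * u = c) (c0 : 0 ≤ c) (c1 : c ≤ 1) :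
    ∃ p : B, IsProjection p ∧ p * u = p ∧ (∀ x, c * x = x * c → p * x = x * p) ∧
      0 ≤ 2 * c - p ∧ 2 * c - p ≤ 1 := by
  have sa : IsSelfAdjoint c := c0.isSelfAdjoint
  have hpos : ∀ t ∈ spectrum ℝ c, 0 ≤ t := fun t ht => spectrum_nonneg_of_nonneg c0 ht
  have hle : ∀ t ∈ spectrum ℝ c, t ≤ 1 := by
    have := (le_algebraMap_iff_spectrum_le (r := (1:ℝ)) (a := c)).1 (by simpa using c1)
    exact this
  let gf : ℝ → ℝ := fun t => max (t - 1/2) 0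
  let df : ℝ → ℝ := fun t => max (1/2 - t) 0
  have cg : Continuous gf := by fun_prop
  have cd : Continuous df := by fun_prop
  set g := cfc gf c with hg
  set d := cfc df c with hd
  have g0 : 0 ≤ g := cfc_nonneg fun t ht => le_max_right _ _
  have d0 : 0 ≤ d := cfc_nonneg fun t ht => le_max_right _ _
  have sg : star g = g := g0.isSelfAdjoint
  have sd : star d = d := d0.isSelfAdjoint
  have g1 : 2 * g ≤ 1 := by
    have : (2:B) * g = cfc (fun t => 2 * gf t) c := by
      rw [cfc_const_mul _ _ _ cg.continuousOn, ← hg, two_mul, two_smul]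
    rw [this]
    refine cfc_le_one _ _ fun t ht => ?_
    have := hle t ht
    simp only [gf]
    rcases le_total t (1/2) with h | h
    · rw [max_eq_right (by linarith)]; simp
    · rw [max_eq_left (by linarith)]; linarith
  have d1 : 2 * d ≤ 1 := by
    have : (2:B) * d = cfc (fun t => 2 * df t) c := by
      rw [cfc_const_mul _ _ _ cd.continuousOn, ← hd, two_mul, two_smul]
    rw [this]
    refine cfc_le_one _ _ fun t ht => ?_
    have := hpos t ht
    simp only [df]
    rcases le_total t (1/2) with h | h
    · rw [max_eq_left (by linarith)]; linarith
    · rw [max_eq_right (by linarith)]; simp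
  have hsum : 2 * c = 1 + 2 * g - 2 * d := by
    have e1 : c + d = algebraMap ℝ B (1/2) + g := by
      conv_lhs => lhs; rw [← cfc_id' ℝ c]
      rw [← cfc_const (1/2:ℝ) c, hg, hd, ← cfc_add _ _ _ (by fun_prop) cd.continuousOn,
        ← cfc_add _ _ _ (by fun_prop) cg.continuousOn]
      refine cfc_congr fun t ht => ?_
      simp only [gf, df]
      rcases le_total t (1/2) with h | h
      · rw [max_eq_left (by linarith), max_eq_right (by linarith)]; ring
      · rw [max_eq_right (by linarith), max_eq_left (by linarith)]; ring
    have e2 : (2:B) * algebraMap ℝ B (1/2) = 1 := by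
      rw [show (2:B) = algebraMap ℝ B 2 from (map_ofNat _ 2).symm, ← map_mul]; norm_num
    have := congrArg ((2:B) * ·) e1
    simp only [mul_add, e2] at this
    rw [← this]; abel
  have gd : g * d = 0 := by
    rw [hg, hd, ← cfc_mul _ _ c cg.continuousOn cd.continuousOn]
    rw [show (0:B) = cfc (fun _ => (0:ℝ)) c by simp]
    refine cfc_congr fun t ht => ?_
    simp only [gf, df]
    rcases le_total t (1/2) with h | h
    · rw [max_eq_right (by linarith)]; simp
    · rw [max_eq_right (by linarith : 1/2 - t ≤ 0)]; simp
  have gu : g * u = g := by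
    have : g = cfc (fun t => gf t / max t (1/2)) c * c := by
      have cq : Continuous (fun t => gf t / max t (1/2)) :=
        cg.div (by fun_prop) (fun t => (lt_max_of_lt_right (by norm_num)).ne')
      conv_rhs => rhs; rw [← cfc_id' ℝ c]
      rw [← cfc_mul _ _ c cq.continuousOn (by fun_prop)]
      refine cfc_congr fun t ht => ?_
      simp only [gf]
      rcases le_total t (1/2) with h | h
      · rw [max_eq_right (by linarith)]; simp
      · rw [max_eq_left (by linarith : (0:ℝ) ≤ t - 1/2), max_eq_left h]
        have : t ≠ 0 := by intro h'; rw [h'] at h; norm_num at h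
        field_simp
    rw [this, mul_assoc, hc]
  obtain ⟨p, hp⟩ := hu.2 {g} (by simpa using gu)
  have pd : p * d = 0 := (hp.2 d).1 (by simpa using gd)
  have dp : d * p = 0 := by simpa [hp.1.1, sd] using st pd
  have gp : g * p = g := hp.mul_self (by simp)
  have pg : p * g = g := by simpa [hp.1.1, sg] using st gp
  refine ⟨p, hp.1, hp.le (by simpa using gu), ?_, ?_, ?_⟩
  · intro x hx
    have hx' : c * star x = star x * c := by
      have := congrArg star hx; simp only [star_mul, sa.star_eq] at this; exact this.symm
    refine (hp.commute ?_ ?_).symm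
    · simp only [Set.mem_singleton_iff, forall_eq]
      exact (Commute.cfc_real (show Commute c x from hx) gf)
    · simp only [Set.mem_singleton_iff, forall_eq]
      exact (Commute.cfc_real (show Commute c (star x) from hx') gf)
  · have h1 := star_left_conjugate_le_conjugate d1 (1 - p)
    have e1 : star (1 - p) * (2 * d) * (1 - p) = 2 * d := by
      rw [star_sub, star_one, hp.1.1, two_mul]
      simp [mul_sub, sub_mul, mul_add, add_mul, mul_assoc, pd, dp]
    have e2 : star (1 - p) * 1 * (1 - p) = 1 - p := by
      rw [star_sub, star_one, hp.1.1]; simp [mul_sub, sub_mul, hp.1.2]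
    rw [e1, e2] at h1
    have : 2 * c - p = 2 * g + (1 - p - 2 * d) := by rw [hsum]; abel
    rw [this]
    refine add_nonneg ?_ (sub_nonneg.2 h1)
    rw [two_mul]; exact add_nonneg g0 g0
  · have h1 := star_left_conjugate_le_conjugate g1 p
    have e1 : star p * (2 * g) * p = 2 * g := by
      rw [hp.1.1, two_mul]
      simp [mul_sub, sub_mul, mul_add, add_mul, mul_assoc, gp, pg]
    have e2 : star p * 1 * p = p := by rw [hp.1.1, mul_one, hp.1.2]
    rw [e1, e2] at h1
    have : 1 - (2 * c - p) = 2 * d + (p - 2 * g) := by rw [hsum]; abel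
    rw [← sub_nonneg, this]
    refine add_nonneg ?_ (sub_nonneg.2 h1)
    rw [two_mul]; exact add_nonneg d0 d0

theorem dyadic0 {u c : B} (hu : AWC u) (hc : c * u = c) (c0 : 0 ≤ c) (c1 : c ≤ 1) :
    ∃ p : ℕ → B, (∀ k, IsProjection (p k) ∧ p k * u = p k ∧ ∀ x, c * x = x * c → p k * x = x * p k) ∧
      HasSum (fun k => ((1/2:ℝ)^(k+1)) • p k) c := by
  choose! P hP using (fun (d : B) (h : d * u = d ∧ 0 ≤ d ∧ d ≤ 1) => dy_step hu h.1 h.2.1 h.2.2)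
  let d : ℕ → B := fun k => Nat.rec c (fun _ x => 2 * x - P x) k
  have d0 : d 0 = c := rfl
  have ds : ∀ k, d (k+1) = 2 * d k - P (d k) := fun k => rfl
  have hd : ∀ k, (d k * u = d k ∧ 0 ≤ d k ∧ d k ≤ 1) ∧ ∀ x, c * x = x * c → d k * x = x * d k := by
    intro k
    induction k with
    | zero => exact ⟨⟨hc, c0, c1⟩, fun x h => h⟩
    | succ k ih =>
      have := hP _ ih.1
      rw [ds]
      refine ⟨⟨?_, this.2.2.2.1, this.2.2.2.2⟩, fun x hx => ?_⟩
      · rw [sub_mul, mul_assoc, ih.1.1, this.2.1]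
      · rw [sub_mul, mul_sub, this.2.2.1 x (ih.2 x hx), mul_assoc, ih.2 x hx, two_mul, two_mul, mul_add]
  refine ⟨fun k => P (d k), fun k => ⟨(hP _ (hd k).1).1, (hP _ (hd k).1).2.1, fun x hx =>
    (hP _ (hd k).1).2.2.1 x ((hd k).2 x hx)⟩, ?_⟩
  have hn : ∀ k, ‖d k‖ ≤ 1 := fun k => CStarAlgebra.norm_le_one_iff_of_nonneg _ (hd k).1.2.1 |>.2 (hd k).1.2.2
  have hpn : ∀ k, ‖P (d k)‖ ≤ 3 := by
    intro k
    have : P (d k) = d k + d k - d (k+1) := by rw [ds, two_mul]; abel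
    rw [this]
    calc _ ≤ ‖d k + d k‖ + ‖d (k+1)‖ := norm_sub_le _ _
      _ ≤ (‖d k‖ + ‖d k‖) + ‖d (k+1)‖ := by gcongr; exact norm_add_le _ _
      _ ≤ 3 := by linarith [hn k, hn (k+1)]
  have hsm : Summable (fun k => ((1/2:ℝ)^(k+1)) • P (d k)) := by
    refine Summable.of_norm_bounded (g := fun k => 3 * (1/2:ℝ)^(k+1)) ?_ ?_
    · exact ((summable_nat_add_iff 1).2 (summable_geometric_of_lt_one (by norm_num) (by norm_num))).mul_left 3
    · intro k
      rw [norm_smul, Real.norm_of_nonneg (by positivity), mul_comm]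
      gcongr; exact hpn k
  have hpart : ∀ n, ∑ k ∈ Finset.range n, ((1/2:ℝ)^(k+1)) • P (d k) = c - ((1/2:ℝ)^n) • d n := by
    intro n
    induction n with
    | zero => simp [d0]
    | succ n ih =>
      rw [Finset.sum_range_succ, ih, ds, two_mul, smul_sub, smul_add, pow_succ]
      have : ((1/2:ℝ)^n) • d n = ((1/2:ℝ)^n * (1/2)) • d n + ((1/2:ℝ)^n * (1/2)) • d n := by
        rw [← add_smul]; congr 1; ring
      rw [this]; abel
  refine (hsm.hasSum_iff_tendsto_nat).2 ?_
  simp_rw [hpart]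
  have : Filter.Tendsto (fun n => ((1/2:ℝ)^n) • d n) Filter.atTop (nhds 0) := by
    refine squeeze_zero_norm (a := fun n => (1/2:ℝ)^n) ?_ (tendsto_pow_atTop_nhds_zero_of_lt_one (by norm_num) (by norm_num))
    intro n
    rw [norm_smul, Real.norm_of_nonneg (by positivity)]
    calc _ ≤ (1/2:ℝ)^n * 1 := by gcongr; exact hn n
      _ = _ := mul_one _
  simpa using tendsto_const_nhds.sub this

theorem dyadic {u c : B} (hu : AWC u) (hc : c * u = c) (sc : star c = c) (hn : ‖c‖ ≤ 1) :
    ∃ p : ℕ → B, (∀ k, IsProjection (p k) ∧ p k * u = p k ∧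
        ∀ x, c * x = x * c → u * x = x * u → p k * x = x * p k) ∧
      HasSum (fun k => ((1/2:ℝ)^k) • p k) (c + u) := by
  have hb : -1 ≤ c ∧ c ≤ 1 := by
    have sa : IsSelfAdjoint c := sc
    have h1 : algebraMap ℝ B ‖c‖ ≤ 1 := by
      rw [← map_one (algebraMap ℝ B)]; exact algebraMap_mono B hn
    exact ⟨(neg_le_neg h1).trans sa.neg_algebraMap_norm_le_self, sa.le_algebraMap_norm_self.trans h1⟩
  have uc : u * c = c := by simpa [sc, hu.1.1] using st hc
  have hcu : (1/2:ℝ) • (c + u) = (1/2:ℝ) • (star u * (1 + c) * u) := by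
    rw [hu.1.1]; simp [mul_add, add_mul, mul_assoc, hc, uc, hu.1.2]; abel
  have hcu' : 1 - (1/2:ℝ) • (c + u) = (1 - u) + (1/2:ℝ) • (star u * (1 - c) * u) := by
    rw [hu.1.1]; simp only [mul_sub, sub_mul, mul_assoc, hc, uc, hu.1.2, mul_one, smul_sub, smul_add]
    have : u = (1/2:ℝ) • u + (1/2:ℝ) • u := by rw [← add_smul]; norm_num
    generalize (1/2:ℝ) • u = v at this
    rw [this]; abel
  have a1 : (1/2:ℝ) • (c + u) * u = (1/2:ℝ) • (c + u) := by
    rw [smul_mul_assoc, add_mul, hc, hu.1.2]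
  have a2 : 0 ≤ (1/2:ℝ) • (c + u) := by
    rw [hcu]
    refine smul_nonneg (by norm_num) (star_left_conjugate_nonneg ?_ u)
    rw [← neg_le_iff_add_nonneg']; exact hb.1
  have a3 : (1/2:ℝ) • (c + u) ≤ 1 := by
    rw [← sub_nonneg, hcu']
    refine add_nonneg ?_ (smul_nonneg (by norm_num) (star_left_conjugate_nonneg ?_ u))
    · have := pj_compl hu.1
      rw [← this.2]; nth_rw 1 [← this.1]; exact star_mul_self_nonneg _
    · exact sub_nonneg.2 hb.2
  obtain ⟨p, hp, hs⟩ := dyadic0 (c := (1/2:ℝ) • (c + u)) hu a1 a2 a3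
  refine ⟨p, fun k => ⟨(hp k).1, (hp k).2.1, fun x h1 h2 => (hp k).2.2 x ?_⟩, ?_⟩
  · rw [smul_mul_assoc, mul_smul_comm, add_mul, mul_add, h1, h2]
  · have := hs.const_smul (2:ℝ)
    rw [smul_smul] at this
    norm_num at this
    convert this using 2 with k
    rw [smul_smul]; congr 1; rw [pow_succ]; ring
end dyadic
end MM

set_option linter.unusedVariables false
set_option linter.unusedSimpArgs false
namespace MM
variable {B : Type*} [CStarAlgebra B]

theorem comm_proj_sa {u c x : B} (hu : AWC u) (h1 : c * u = c) (sc : star c = c)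
    (hx : u * x = x * u)
    (H : ∀ p, IsProjection p → p * u = p →
      (∀ y, c * y = y * c → u * y = y * u → p * y = y * p) → p * x = x * p) :
    c * x = x * c := by
  set r : ℝ := (‖c‖ + 1)⁻¹ with hr
  have hr0 : 0 < ‖c‖ + 1 := by positivity
  obtain ⟨p, hp, hs⟩ := dyadic (c := r • c) hu (by rw [smul_mul_assoc, h1])
    (by rw [star_smul, sc]; simp) (by
      rw [norm_smul, Real.norm_of_nonneg (by positivity), hr, inv_mul_le_iff₀ hr0]; linarith)
  have hpx : ∀ k, p k * x = x * p k := fun k => H _ (hp k).1 (hp k).2.1 (fun y hy hy' =>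
    (hp k).2.2 y (by rw [smul_mul_assoc, mul_smul_comm, hy]) hy')
  have e1 := hs.mul_right x
  have e2 := hs.mul_left x
  have : (r • c + u) * x = x * (r • c + u) := by
    refine e1.unique ?_
    convert e2 using 2 with k
    rw [smul_mul_assoc, mul_smul_comm, hpx]
  rw [add_mul, mul_add, hx, add_left_inj, smul_mul_assoc, mul_smul_comm] at this
  have hr' : r ≠ 0 := inv_ne_zero hr0.ne'
  exact smul_right_injective B hr' this

theorem comm_proj {u c x : B} (hu : AWC u) (h1 : c * u = c) (h2 : u * c = c)
    (hx : u * x = x * u)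
    (H : ∀ p, IsProjection p → p * u = p →
      (∀ y, c * y = y * c → star c * y = y * star c → u * y = y * u → p * y = y * p) → p * x = x * p) :
    c * x = x * c := by
  have h1' : star c * u = star c := by simpa [hu.1.1] using st h2
  have ka := comm_proj_sa (c := c + star c) hu (by rw [add_mul, h1, h1']) (by simp [add_comm]) hx
    (fun p hp hpu hy => H p hp hpu (fun y a b d => hy y (by rw [add_mul, mul_add, a, b]) d))
  have kb := comm_proj_sa (c := Complex.I • (c - star c)) hu (by rw [smul_mul_assoc, sub_mul, h1, h1'])
    (by rw [star_smul, star_sub, star_star]; simp [smul_sub]; abel) hx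
    (fun p hp hpu hy => H p hp hpu (fun y a b d => hy y
      (by rw [smul_mul_assoc, mul_smul_comm, sub_mul, mul_sub, a, b]) d))
  rw [smul_mul_assoc, mul_smul_comm] at kb
  have kb' := smul_right_injective B Complex.I_ne_zero kb
  have : (2:ℂ) • (c * x) = (2:ℂ) • (x * c) := by
    have e := congrArg₂ (· + ·) ka kb'
    simp only [add_mul, mul_add, sub_mul, mul_sub] at e
    rw [two_smul, two_smul]
    calc _ = c * x + star c * x + (c * x - star c * x) := by abel
      _ = _ := e
      _ = _ := by abel
  exact smul_right_injective B (two_ne_zero) this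

/-! Orthogonal partial isometries -/
def OPI (W : Set B) : Prop := (∀ w ∈ W, w * (star w * w) = w) ∧
  ∀ w ∈ W, ∀ w' ∈ W, w ≠ w' → star w * w' = 0 ∧ w * star w' = 0

structure Glue (W : Set B) (V : B) : Prop where
  pi : V * (star V * V) = V
  res : ∀ w ∈ W, V * (star w * w) = w
  src : ∀ x, (∀ w ∈ W, w * x = 0) ↔ V * x = 0
  rng : ∀ x, (∀ w ∈ W, star w * x = 0) ↔ star V * x = 0

namespace Glue
variable {W : Set B} {V : B}
theorem mul_src (h : Glue W V) {w : B} (hw : w ∈ W) : w * (star V * V) = w := by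
  have := (h.src (1 - star V * V)).2 (by rw [mul_sub, h.pi, mul_one, sub_self]) w hw
  rw [mul_sub, mul_one, sub_eq_zero] at this
  exact this.symm
theorem stm (h : Glue W V) {w : B} (hw : w ∈ W) : star V * w = star w * w := by
  have := h.mul_src hw
  have h2 := st this
  simp only [star_mul, star_star] at h2
  calc star V * w = star V * (V * (star w * w)) := by rw [h.res w hw]
    _ = star V * V * star w * w := by simp only [mul_assoc]
    _ = star w * w := by rw [h2]
theorem mul_star (h : Glue W V) {w : B} (hw : w ∈ W) (hpi : w * (star w * w) = w) :
    V * star w = w * star w := by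
  have h2 : star w * w * star w = star w := by rw [mul_assoc]; exact pi_star hpi
  rw [← h2, ← mul_assoc, h.res w hw, h2]
theorem le_rng (h : Glue W V) {f : B} (hf : star f = f) (H : ∀ w ∈ W, f * w = w) : f * V = V := by
  have := (h.rng (1 - f)).1 (fun w hw => by
    have := st (H w hw)
    rw [hf] at this
    rw [mul_sub, this, mul_one, sub_self])
  rw [mul_sub, mul_one, sub_eq_zero] at this
  simpa [hf] using (st this.symm)
theorem le_src (h : Glue W V) {e : B} (H : ∀ w ∈ W, w * e = w) : V * e = V := by
  have := (h.src (1 - e)).1 (fun w hw => by rw [mul_sub, H w hw, mul_one, sub_self])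
  rw [mul_sub, mul_one, sub_eq_zero] at this
  exact this.symm
end Glue

def AddP (e f : B) : Prop := ∀ W : Set B, OPI W → (∀ w ∈ W, w * e = w ∧ f * w = w) → ∃ V, Glue W V

theorem OPI.star {W : Set B} (h : OPI W) : OPI (star '' W) := by
  constructor
  · rintro _ ⟨w, hw, rfl⟩
    simpa using pi_star (h.1 w hw)
  · rintro _ ⟨w, hw, rfl⟩ _ ⟨w', hw', rfl⟩ hne
    have : w ≠ w' := fun h => hne (by rw [h])
    have := h.2 w hw w' hw' this
    simpa using this.symm

theorem AddP.symm {e f : B} (he : star e = e) (hf : star f = f) (h : AddP e f) : AddP f e := by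
  intro W hW hle
  obtain ⟨V, hV⟩ := h (star '' W) hW.star (by
    rintro _ ⟨w, hw, rfl⟩
    have := hle w hw
    exact ⟨by simpa [he] using st this.2, by simpa [hf] using st this.1⟩)
  refine ⟨star V, by simpa using pi_star hV.pi, fun w hw => ?_, fun x => ?_, fun x => ?_⟩
  · have := hV.stm (w := star w) ⟨w, hw, rfl⟩
    have h2 := hV.mul_star (w := star w) ⟨w, hw, rfl⟩ (by simpa using pi_star (hW.1 w hw))
    simp only [star_star] at this h2
    rw [← mul_assoc, this, mul_assoc, hW.1 w hw]
  · rw [← hV.rng, Set.forall_mem_image]; simp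
  · rw [star_star, ← hV.src, Set.forall_mem_image]

theorem AddP.mono {e f e' f' : B} (h : AddP e f) (he : e' * e = e') (hf : f * f' = f') : AddP e' f' := by
  intro W hW hle
  refine h W hW fun w hw => ⟨?_, ?_⟩
  · rw [← (hle w hw).1, mul_assoc, he]
  · rw [← (hle w hw).2, ← mul_assoc, hf]

theorem AddP.room {e f f' y : B} (h : AddP e f') (hf : IsProjection f) (hy : star y * y = f) (hfy : f' * y = y) :
    AddP e f := by
  intro W hW hle
  have yf := pi_of_pj hf hy
  have yy := pi3 hf hy
  have k1 : ∀ w ∈ W, star y * (y * w) = w := fun w hw => by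
    rw [← mul_assoc, hy, (hle w hw).2]
  have k2 : ∀ w ∈ W, ∀ x : B, star w * (star y * (y * x)) = star w * x := fun w hw x => by
    have := st (hle w hw).2
    rw [hf.1] at this
    rw [← mul_assoc (star y), hy, ← mul_assoc, this]
  obtain ⟨V, hV⟩ := h ((y * ·) '' W) (by
    constructor
    · rintro _ ⟨w, hw, rfl⟩
      simp only [star_mul, mul_assoc, k1 w hw, hW.1 w hw]
    · rintro _ ⟨w, hw, rfl⟩ _ ⟨w', hw', rfl⟩ hne
      have : w ≠ w' := fun h => hne (by rw [h])
      have := hW.2 w hw w' hw' this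
      simp only [star_mul, mul_assoc, k2 w hw, this.1, true_and]
      rw [← mul_assoc w, this.2]; simp) (by
    rintro _ ⟨w, hw, rfl⟩
    simp only [mul_assoc, (hle w hw).1, true_and]
    rw [← mul_assoc, hfy])
  have hyV : (y * star y) * V = V := hV.le_rng (by simp) (by
    rintro _ ⟨w, hw, rfl⟩
    simp only [mul_assoc, k1 w hw])
  have hyV' : y * (star y * V) = V := by rw [← mul_assoc, hyV]
  have hVy : star V * (y * star y) = star V := by simpa using st hyV
  refine ⟨star y * V, ?_, fun w hw => ?_, fun x => ?_, fun x => ?_⟩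
  · simp only [star_mul, star_star, mul_assoc]
    rw [hyV', hV.pi]
  · have := hV.res _ ⟨w, hw, rfl⟩
    simp only [star_mul, mul_assoc, k2 w hw] at this
    rw [mul_assoc, this, k1 w hw]
  · have : star y * V * x = 0 ↔ V * x = 0 := by
      constructor
      · intro h
        rw [← hyV', mul_assoc, h, mul_zero]
      · intro h; rw [mul_assoc, h, mul_zero]
    rw [this, ← hV.src]
    simp only [Set.forall_mem_image]
    refine forall₂_congr fun w hw => ?_
    constructor
    · intro h; rw [mul_assoc, h, mul_zero]
    · intro h; rw [← k1 w hw, mul_assoc, h, mul_zero]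
  · rw [star_mul, star_star, mul_assoc, ← hV.rng]
    simp only [Set.forall_mem_image]
    refine forall₂_congr fun w hw => ?_
    rw [star_mul, mul_assoc, k2 w hw]

theorem orth_add {u e f : B} (hu : AWC u) (he : IsProjection e) (hf : IsProjection f)
    (heu : e * u = e) (hfu : f * u = f) (hef : e * f = 0) : AddP e f := by
  intro W hW hle
  have hfe := orth_symm he hf hef
  let s : B → B := fun w => star w * w + w * star w + w + star w
  have L1 : ∀ w ∈ W, e * star w = star w := fun w hw => by simpa [he.1] using st (hle w hw).1
  have L2 : ∀ w ∈ W, star w * f = star w := fun w hw => by simpa [hf.1] using st (hle w hw).2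
  have L3 : ∀ w ∈ W, f * star w = 0 := fun w hw => by rw [← L1 w hw, ← mul_assoc, hfe, zero_mul]
  have L4 : ∀ w ∈ W, w * f = 0 := fun w hw => by rw [← (hle w hw).1, mul_assoc, hef, mul_zero]
  have L5 : ∀ w ∈ W, star w * e = 0 := fun w hw => by rw [← L2 w hw, mul_assoc, hfe, mul_zero]
  have L6 : ∀ w ∈ W, e * w = 0 := fun w hw => by rw [← (hle w hw).2, ← mul_assoc, hef, zero_mul]
  have Q1 : ∀ w ∈ W, ∀ w' ∈ W, w * w' = 0 := fun w hw w' hw' => by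
    rw [← (hle w hw).1, mul_assoc, L6 w' hw', mul_zero]
  have Q2 : ∀ w ∈ W, ∀ w' ∈ W, star w * star w' = 0 := fun w hw w' hw' => by
    rw [← L2 w hw, mul_assoc, L3 w' hw', mul_zero]
  obtain ⟨P, hP⟩ := hu.2 (s '' W) (by
    rintro _ ⟨w, hw, rfl⟩
    have a : w * u = w := by rw [← (hle w hw).1, mul_assoc, heu]
    have b : star w * u = star w := by rw [← L2 w hw, mul_assoc, hfu]
    simp only [s, add_mul, mul_assoc, a, b])
  have ss : ∀ w ∈ W, star (s w) = s w := fun w hw => by simp [s]; abel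
  have Ps : ∀ w ∈ W, P * s w = s w := fun w hw => by
    have := st (hP.mul_self ⟨w, hw, rfl⟩)
    rwa [ss w hw, hP.1.1] at this
  have Pm : ∀ w ∈ W, P * (star w * w + w * star w - w - star w) = 0 := by
    intro w hw
    refine (hP.2 _).1 ?_
    rintro _ ⟨w', hw', rfl⟩
    have a := hW.1 w hw
    have b := pi_star a
    by_cases h : w' = w
    · subst h
      simp only [s, mul_sub, mul_add, add_mul, mul_assoc, a, b, ra (Q1 _ hw _ hw), ra (Q2 _ hw _ hw), Q1 _ hw _ hw, Q2 _ hw _ hw]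
      simp; abel
    · have c := hW.2 w' hw' w hw h
      simp only [s, mul_sub, mul_add, add_mul, mul_assoc, ra c.1, ra c.2, c.1, c.2, ra (Q1 _ hw' _ hw), ra (Q2 _ hw' _ hw), Q1 _ hw' _ hw, Q2 _ hw' _ hw]
      simp
  have P1 : ∀ w ∈ W, P * (star w * w) + P * (star w * w) = star w * w + w := by
    intro w hw
    have a := hW.1 w hw
    have e1 := congrArg (· * (star w * w)) (Ps w hw)
    have e2 := congrArg (· * (star w * w)) (Pm w hw)
    simp only [s, mul_sub, mul_add, add_mul, sub_mul, mul_assoc, a, ra (Q1 _ hw _ hw), ra (Q2 _ hw _ hw), Q1 _ hw _ hw, Q2 _ hw _ hw, mul_zero, zero_mul, add_zero, sub_zero] at e1 e2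
    calc _ = P * (star w * w) + P * w + (P * (star w * w) - P * w) := by abel
      _ = _ := by rw [e1, e2, add_zero]
  have P2 : ∀ w ∈ W, P * (w * star w) + P * (w * star w) = w * star w + star w := by
    intro w hw
    have a := pi_star (hW.1 w hw)
    have e1 := congrArg (· * (w * star w)) (Ps w hw)
    have e2 := congrArg (· * (w * star w)) (Pm w hw)
    simp only [s, mul_sub, mul_add, add_mul, sub_mul, mul_assoc, a, ra (Q1 _ hw _ hw), ra (Q2 _ hw _ hw), Q1 _ hw _ hw, Q2 _ hw _ hw, mul_zero, zero_mul, add_zero, zero_add, zero_sub, sub_zero] at e1 e2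
    calc _ = P * (w * star w) + P * (star w) + (P * (w * star w) - P * star w) := by abel
      _ = _ := by rw [e1, e2, add_zero]
  set V := 2 * (f * P * e) with hV
  have sV : star V = 2 * (e * P * f) := by
    simp [hV, he.1, hf.1, hP.1.1, two_mul, mul_assoc]
  have R1 : ∀ w ∈ W, V * (star w * w) = w := by
    intro w hw
    calc V * (star w * w) = f * (P * (e * star w * w) + P * (e * star w * w)) := by
          rw [hV, two_mul]; simp only [add_mul, mul_add, mul_assoc]
      _ = w := by rw [L1 w hw, P1 w hw, mul_add, (hle w hw).2, ← mul_assoc, L3 w hw]; simp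
  have R2 : ∀ w ∈ W, star V * (w * star w) = star w := by
    intro w hw
    calc star V * (w * star w) = e * (P * (f * w * star w) + P * (f * w * star w)) := by
          rw [sV, two_mul]; simp only [add_mul, mul_add, mul_assoc]
      _ = star w := by rw [(hle w hw).2, P2 w hw, mul_add, L1 w hw, ← mul_assoc, L6 w hw]; simp
  have R3 : ∀ w ∈ W, w * star w * V = w := fun w hw => by
    have := congrArg star (R2 w hw)
    simpa [mul_assoc] using this
  have R4 : ∀ w ∈ W, star w * w * star V = star w := fun w hw => by
    have := congrArg star (R1 w hw)
    simpa [mul_assoc] using this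
  have src : ∀ x, (∀ w ∈ W, w * x = 0) ↔ V * x = 0 := by
    intro x
    constructor
    · intro h
      have : P * (e * x) = 0 := by
        refine (hP.2 _).1 ?_
        rintro _ ⟨w, hw, rfl⟩
        have h1 : w * (e * x) = 0 := by rw [← mul_assoc, (hle w hw).1, h w hw]
        simp only [s, add_mul, mul_assoc, h1, ra (L5 w hw)]
        simp
      rw [hV]; simp only [mul_assoc, this, mul_zero]
    · intro h w hw
      rw [← R3 w hw, mul_assoc, h, mul_zero]
  have rng : ∀ x, (∀ w ∈ W, star w * x = 0) ↔ star V * x = 0 := by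
    intro x
    constructor
    · intro h
      have : P * (f * x) = 0 := by
        refine (hP.2 _).1 ?_
        rintro _ ⟨w, hw, rfl⟩
        have h1 : star w * (f * x) = 0 := by rw [← mul_assoc, L2 w hw, h w hw]
        simp only [s, add_mul, mul_assoc, h1, ra (L4 w hw)]
        simp
      rw [sV]; simp only [mul_assoc, this, mul_zero]
    · intro h w hw
      rw [← R4 w hw, mul_assoc, h, mul_zero]
  refine ⟨V, ?_, R1, src, rng⟩
  have := (src (star V * V - 1)).1 (fun w hw => by
    rw [mul_sub, mul_one, sub_eq_zero]
    have h1 : w * star V = w * star w := by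
      calc w * star V = w * (star w * w) * star V := by rw [hW.1 w hw]
        _ = w * (star w * w * star V) := by simp only [mul_assoc]
        _ = _ := by rw [R4 w hw]
    rw [← mul_assoc, h1, R3 w hw])
  rwa [mul_sub, mul_one, sub_eq_zero] at this

theorem exists_max_pw {α : Type*} (Φ : α → Prop) (R : α → α → Prop) (W0 : Set α)
    (h0 : ∀ w ∈ W0, Φ w) (hR : ∀ w ∈ W0, ∀ w' ∈ W0, w ≠ w' → R w w') (hs : ∀ w w', R w w' → R w' w) :
    ∃ W : Set α, W0 ⊆ W ∧ (∀ w ∈ W, Φ w) ∧ (∀ w ∈ W, ∀ w' ∈ W, w ≠ w' → R w w') ∧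
      ∀ w, Φ w → (∀ w' ∈ W, R w w') → w ∈ W := by
  obtain ⟨W, hW0, hW⟩ := zorn_subset_nonempty
    {W : Set α | (∀ w ∈ W, Φ w) ∧ (∀ w ∈ W, ∀ w' ∈ W, w ≠ w' → R w w')} (by
      intro c hc hch hne
      refine ⟨⋃₀ c, ⟨?_, ?_⟩, fun s hs => Set.subset_sUnion_of_mem hs⟩
      · rintro w ⟨s, hs, hw⟩
        exact (hc hs).1 w hw
      · rintro w ⟨s, hs, hw⟩ w' ⟨s', hs', hw'⟩ hne
        rcases hch.total hs hs' with h | h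
        · exact (hc hs').2 w (h hw) w' hw' hne
        · exact (hc hs).2 w hw w' (h hw') hne) W0 ⟨h0, hR⟩
  refine ⟨W, hW0, hW.1.1, hW.1.2, fun w hw hw' => ?_⟩
  have : insert w W ⊆ W := hW.2 ⟨?_, ?_⟩ (Set.subset_insert _ _)
  · exact this (Set.mem_insert _ _)
  · rintro x (rfl | hx)
    · exact hw
    · exact hW.1.1 x hx
  · rintro x (rfl | hx) y (rfl | hy) hne
    · exact absurd rfl hne
    · exact hw' y hy
    · exact hs _ _ (hw' x hx)
    · exact hW.1.2 x hx y hy hne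

theorem exists_max_OPI (Φ : B → Prop) : ∃ W : Set B, OPI W ∧ (∀ w ∈ W, w ≠ 0 ∧ Φ w) ∧
    ∀ w, w * (star w * w) = w → Φ w → (∀ w' ∈ W, star w' * w = 0 ∧ w' * star w = 0) → w = 0 := by
  obtain ⟨W, -, h1, h2, h3⟩ := exists_max_pw (fun w : B => w * (star w * w) = w ∧ w ≠ 0 ∧ Φ w)
    (fun w w' => star w * w' = 0 ∧ w * star w' = 0) ∅ (by simp) (by simp)
    (fun w w' h => ⟨by simpa using st h.1, by simpa using st h.2⟩)
  refine ⟨W, ⟨fun w hw => (h1 w hw).1, h2⟩, fun w hw => (h1 w hw).2, fun w hw hw' h => ?_⟩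
  by_contra hne
  have := h3 w ⟨hw, hne, hw'⟩ (fun w' hw' => ⟨by simpa using st (h w' hw').1, by simpa using st (h w' hw').2⟩)
  have h4 := (h w this).1
  exact hne (z1 h4)

end MM

set_option linter.unusedVariables false
set_option linter.unusedSimpArgs false
namespace MM
variable {B : Type*} [CStarAlgebra B]

/-! central covers -/
def CC (e c : B) : Prop := IsCentralProj c ∧ ∀ x, (∀ b, e * b * x = 0) ↔ c * x = 0
def CA (B : Type*) [CStarAlgebra B] : Prop := ∀ e : B, ∃ c, CC e c

theorem cz_one : IsCentralProj (1 : B) := ⟨pj_one, by simp⟩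
theorem cz_zero : IsCentralProj (0 : B) := ⟨pj_zero, by simp⟩
theorem cz_compl {z : B} (hz : IsCentralProj z) : IsCentralProj (1 - z) :=
  ⟨pj_compl hz.1, fun a => by rw [sub_mul, mul_sub, hz.2, one_mul, mul_one]⟩
theorem cz_mul {z z' : B} (hz : IsCentralProj z) (hz' : IsCentralProj z') : IsCentralProj (z * z') :=
  ⟨pj_mul hz.1 hz'.1 (hz.2 _), fun a => by rw [mul_assoc, hz'.2, ← mul_assoc, hz.2, mul_assoc]⟩
theorem cz_pj {z e : B} (hz : IsCentralProj z) (he : IsProjection e) : IsProjection (z * e) :=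
  pj_mul hz.1 he (hz.2 _)
/-- pull z left -/
theorem cz_l {z : B} (hz : IsCentralProj z) (a b : B) : a * (z * b) = z * (a * b) := by
  rw [← mul_assoc, ← hz.2, mul_assoc]
theorem cz_m {z : B} (hz : IsCentralProj z) (a b : B) : (z * a) * (z * b) = z * (a * b) := by
  rw [mul_assoc, cz_l hz, ← mul_assoc, hz.1.2]
theorem cz_s {z : B} (hz : IsCentralProj z) (a : B) : star (z * a) = z * star a := by
  rw [star_mul, hz.1.1, hz.2]
theorem cz_zz {z : B} (hz : IsCentralProj z) (a : B) : z * (z * a) = z * a := by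
  rw [← mul_assoc, hz.1.2]
theorem cz_split {z : B} (hz : IsCentralProj z) (a : B) : a = z * a + (1 - z) * a := by
  rw [sub_mul]; simp

namespace CC
variable {e c : B}
theorem mul (h : CC e c) : e * c = e := by
  have := (h.2 (1 - c)).2 (by rw [mul_sub, h.1.1.2, mul_one, sub_self]) 1
  rw [mul_one, mul_sub, mul_one, sub_eq_zero] at this
  exact this.symm
theorem mul' (h : CC e c) : c * e = e := by rw [h.1.2, h.mul]
theorem le (h : CC e c) {z : B} (hz : IsCentralProj z) (hez : e * z = e) : c * z = c := by
  have := (h.2 (1 - z)).1 (fun b => by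
    rw [mul_sub, mul_one, mul_assoc, ← hz.2, ← mul_assoc, hez, sub_self])
  rw [mul_sub, mul_one, sub_eq_zero] at this
  exact this.symm
theorem zmul (h : CC e c) {z : B} (hz : IsCentralProj z) : CC (z * e) (z * c) := by
  refine ⟨cz_mul hz h.1, fun x => ?_⟩
  have := h.2 (z * x)
  rw [mul_assoc, ← cz_l hz, ← this]
  refine forall_congr' fun b => ?_
  rw [cz_l hz]; simp only [mul_assoc]
theorem ne_zero (h : CC e c) (he : e ≠ 0) : c ≠ 0 := by
  rintro rfl
  exact he (by simpa using h.mul.symm)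
theorem unique {c' : B} (h : CC e c) (h' : CC e c') : c = c' := by
  have a := h.le h'.1 h'.mul
  have b := h'.le h.1 h.mul
  rw [← a, ← h'.1.2, b]
theorem of_star (h : CC e c) : CC (star e) c := by
  refine ⟨h.1, fun x => ⟨fun hx => ?_, fun hx b => ?_⟩⟩
  · refine (h.2 x).1 fun b => ?_
    have k := hx (e * b)
    have k2 := congrArg (fun t => star x * star b * t) k
    apply z1
    rw [← mul_zero (star x * star b), ← k]
    simp only [star_mul, mul_assoc]
  · have : star e * c = star e := by
      have := congrArg star h.mul'
      rwa [star_mul, h.1.1.1] at this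
    rw [← this, mul_assoc (star e), h.1.2, mul_assoc, mul_assoc, hx]; simp
theorem sq (h : CC e c) : CC (star e * e) c := by
  refine ⟨h.1, fun x => ?_⟩
  rw [← h.2 x]
  refine forall_congr' fun b => ?_
  constructor
  · intro k
    rw [mul_assoc]; apply z3; simpa only [mul_assoc] using k
  · intro k
    rw [mul_assoc, mul_assoc, ← mul_assoc e, k, mul_zero]
theorem of_sq (h : CC (star e * e) c) : CC e c := by
  refine ⟨h.1, fun x => ?_⟩
  rw [← h.2 x]
  refine forall_congr' fun b => ?_
  constructor
  · intro k
    rw [mul_assoc, mul_assoc, ← mul_assoc e, k, mul_zero]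
  · intro k
    rw [mul_assoc]; apply z3; simpa only [mul_assoc] using k
theorem equiv (h : CC e c) {f : B} (hef : ProjEquiv e f) : CC f c := by
  obtain ⟨v, rfl, rfl⟩ := hef
  have := h.of_sq.of_star.sq
  simpa using this
/-- elements with a central cover and smaller element -/
theorem of_le {f c' : B} (h : CC e c) (h' : CC f c') (hfe : f * e = f) : c' * c = c' :=
  h'.le h.1 (by rw [← hfe, mul_assoc, h.mul])
end CC

theorem CA_one (h : AWC (1 : B)) : CA B := by
  intro e
  obtain ⟨c, hc⟩ := h.2 (Set.range fun b => e * b) (by simp)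
  have key : ∀ d, c * d = c * d * c := by
    intro d
    have := (hc.2 (d * (1 - c))).1 (by
      rintro _ ⟨b, rfl⟩
      have h1 : e * (b * d) * c = e * (b * d) := hc.mul_self ⟨b * d, rfl⟩
      calc e * b * (d * (1 - c)) = e * (b * d) * (1 - c) := by simp only [mul_assoc]
        _ = 0 := by rw [mul_sub, h1, mul_one, sub_self])
    rw [mul_sub, mul_one, mul_sub, sub_eq_zero] at this
    rw [mul_assoc]; exact this
  refine ⟨c, ⟨hc.1, fun a => ?_⟩, fun x => ?_⟩
  · have k := congrArg star (key (star a))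
    simp only [star_mul, star_star, hc.1.1] at k
    rw [k, ← mul_assoc, ← key]
  · rw [← hc.2]; simp

/-! SubE -/
def SubE (e f : B) : Prop := ∃ w, star w * w = e ∧ f * w = w

theorem SubE.of_le {e f : B} (he : IsProjection e) (h : f * e = e) : SubE e f :=
  ⟨e, by rw [he.1, he.2], h⟩
theorem SubE.trans {e f g : B} (h : SubE e f) (h' : SubE f g) : SubE e g := by
  obtain ⟨w, hw, hw2⟩ := h
  obtain ⟨v, hv, hv2⟩ := h'
  refine ⟨v * w, ?_, by rw [← mul_assoc, hv2]⟩
  rw [star_mul, mul_assoc, ← mul_assoc (star v), hv, hw2, hw]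
theorem SubE.zmul {e f z : B} (hz : IsCentralProj z) (h : SubE e f) : SubE (z * e) (z * f) := by
  obtain ⟨w, hw, hw2⟩ := h
  exact ⟨z * w, by rw [cz_s hz, cz_m hz, hw], by rw [cz_m hz, hw2]⟩
theorem SubE.add {e f e' f' : B} (h : SubE e f) (h' : SubE e' f') (hf : IsProjection f) (hf' : IsProjection f')
    (hff : f * f' = 0) : SubE (e + e') (f + f') := by
  obtain ⟨w, hw, hw2⟩ := h
  obtain ⟨v, hv, hv2⟩ := h'
  have hff' := orth_symm hf hf' hff
  have k1 : f' * w = 0 := by rw [← hw2, ← mul_assoc, hff', zero_mul]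
  have k2 : f * v = 0 := by rw [← hv2, ← mul_assoc, hff, zero_mul]
  have k3 : star w * v = 0 := by
    have := st hw2; rw [hf.1] at this
    rw [← this, mul_assoc, k2, mul_zero]
  have k4 : star v * w = 0 := by simpa using st k3
  exact ⟨w + v, by simp [mul_add, add_mul, hw, hv, k3, k4], by simp [mul_add, add_mul, hw2, hv2, k1, k2]⟩
theorem SubE.of_equiv {e f : B} (he : IsProjection e) (h : ProjEquiv e f) : SubE e f := by
  obtain ⟨v, hv, rfl⟩ := h
  exact ⟨v, hv, by rw [mul_assoc, pi3 he hv]⟩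
/-- the copy -/
theorem SubE.copy {e f : B} (he : IsProjection e) (h : SubE e f) :
    ∃ g, IsProjection g ∧ f * g = g ∧ ProjEquiv e g := by
  obtain ⟨w, hw, hw2⟩ := h
  exact ⟨w * star w, pi_rng (pi3 he hw), by rw [← mul_assoc, hw2], w, hw, rfl⟩

theorem pe_refl {e : B} (he : IsProjection e) : ProjEquiv e e := ⟨e, by rw [he.1, he.2], by rw [he.1, he.2]⟩
theorem pe_symm {e f : B} (h : ProjEquiv e f) : ProjEquiv f e := by
  obtain ⟨v, hv, hv'⟩ := h
  exact ⟨star v, by simpa using hv', by simpa using hv⟩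
theorem pe_pj {e f : B} (he : IsProjection e) (h : ProjEquiv e f) : IsProjection f := by
  obtain ⟨v, hv, rfl⟩ := h
  exact pi_rng (pi3 he hv)
theorem pe_trans {e f g : B} (he : IsProjection e) (h : ProjEquiv e f) (h' : ProjEquiv f g) : ProjEquiv e g := by
  have hf := pe_pj he h
  obtain ⟨v, hv, hv'⟩ := h
  obtain ⟨w, hw, hw'⟩ := h'
  have a := pi_of_pj hf hw
  have b : f * v = v := by rw [← hv', mul_assoc, pi3 he hv]
  refine ⟨w * v, ?_, ?_⟩
  · rw [star_mul, mul_assoc, ← mul_assoc (star w), hw, b, hv]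
  · rw [star_mul, mul_assoc, ← mul_assoc v, hv', ← mul_assoc, a, hw']
theorem pe_zmul {e f z : B} (hz : IsCentralProj z) (h : ProjEquiv e f) : ProjEquiv (z * e) (z * f) := by
  obtain ⟨w, hw, hw2⟩ := h
  exact ⟨z * w, by rw [cz_s hz, cz_m hz, hw], by rw [cz_s hz, cz_m hz, hw2]⟩
theorem pe_add {e f e' f' : B} (he : IsProjection e) (he' : IsProjection e') (hee : e * e' = 0)
    (h : ProjEquiv e f) (h' : ProjEquiv e' f')
    (hff : f * f' = 0) : ProjEquiv (e + e') (f + f') := by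
  have hf := pe_pj he h
  have hf' := pe_pj he' h'
  obtain ⟨w, hw, hw2⟩ := h
  obtain ⟨v, hv, hv2⟩ := h'
  have a1 : star w * f = star w := by rw [← hw2]; exact pi_star (pi3 he hw)
  have a2 : f' * v = v := by rw [← hv2, mul_assoc]; exact (pi3 he' hv)
  have a3 := pi_of_pj he hw
  have a4 : e' * star v = star v := by
    have := st (pi_of_pj he' hv); rwa [he'.1] at this
  have k3 : star w * v = 0 := by
    rw [← a1, ← a2, mul_assoc, ← mul_assoc f, hff]; simp
  have k4 : star v * w = 0 := by simpa using st k3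
  have k5 : w * star v = 0 := by
    rw [← a3, ← a4, mul_assoc, ← mul_assoc e, hee]; simp
  have k6 : v * star w = 0 := by simpa using st k5
  exact ⟨w + v, by simp [mul_add, add_mul, hw, hv, k3, k4], by simp [mul_add, add_mul, hw2, hv2, k5, k6]⟩

/-! gluing families -/
theorem AddP.fam {ι : Type*} {e f : B} (h : AddP e f) (w : ι → B) (h1 : ∀ i, w i * (star (w i) * w i) = w i)
    (h2 : ∀ i j, i ≠ j → star (w i) * w j = 0 ∧ w i * star (w j) = 0)
    (h3 : ∀ i, w i * e = w i ∧ f * w i = w i) : ∃ V, Glue (Set.range w) V := by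
  refine h _ ⟨?_, ?_⟩ ?_
  · rintro _ ⟨i, rfl⟩; exact h1 i
  · rintro _ ⟨i, rfl⟩ _ ⟨j, rfl⟩ hne
    exact h2 i j fun h => hne (by rw [h])
  · rintro _ ⟨i, rfl⟩; exact h3 i

theorem Glue.ann_src {W : Set B} {V : B} (h : Glue W V) : Ann ((fun w => star w * w) '' W) (star V * V) := by
  refine ⟨pi_src h.pi, fun x => ?_⟩
  have : star V * V * x = 0 ↔ V * x = 0 :=
    ⟨fun k => z3 (by rwa [← mul_assoc]), fun k => by rw [mul_assoc, k, mul_zero]⟩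
  rw [this, ← h.src, Set.forall_mem_image]
  refine forall₂_congr fun w hw => ?_
  exact ⟨fun k => z3 (by rwa [← mul_assoc]), fun k => by rw [mul_assoc, k, mul_zero]⟩

theorem Glue.ann_rng {W : Set B} {V : B} (h : Glue W V) : Ann ((fun w => w * star w) '' W) (V * star V) := by
  refine ⟨pi_rng h.pi, fun x => ?_⟩
  have : ∀ v : B, v * star v * x = 0 ↔ star v * x = 0 := fun v =>
    ⟨fun k => z3 (by rw [star_star, ← mul_assoc]; exact k), fun k => by rw [mul_assoc, k, mul_zero]⟩
  rw [this, ← h.rng, Set.forall_mem_image]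
  refine forall₂_congr fun w hw => (this w)

/-- equivalences of orthogonal families into `f` -/
theorem add_fam {ι : Type*} {e f : B} (he : IsProjection e) (hf : IsProjection f) (hA : AddP e f) (e' f' : ι → B)
    (pe : ∀ i, IsProjection (e' i)) (oe : ∀ i j, i ≠ j → e' i * e' j = 0)
    (of : ∀ i j, i ≠ j → f' i * f' j = 0) (hef : ∀ i, ProjEquiv (e' i) (f' i))
    (he' : ∀ i, e' i * e = e' i) (hf' : ∀ i, f * f' i = f' i) :
    ∃ V, V * (star V * V) = V ∧ Ann (Set.range e') (star V * V) ∧ Ann (Set.range f') (V * star V) ∧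
      V * e = V ∧ f * V = V := by
  choose w hw1 hw2 using hef
  have pf := fun i => pe_pj (pe i) ⟨w i, hw1 i, hw2 i⟩
  have a1 : ∀ i, star (w i) * f' i = star (w i) := fun i => by rw [← hw2]; exact pi_star (pi3 (pe i) (hw1 i))
  have a2 : ∀ i, f' i * w i = w i := fun i => by rw [← hw2, mul_assoc]; exact (pi3 (pe i) (hw1 i))
  have a3 := fun i => pi_of_pj (pe i) (hw1 i)
  have a4 : ∀ i, e' i * star (w i) = star (w i) := fun i => by
    have := st (a3 i); rwa [(pe i).1] at this
  have hle : ∀ i, w i * e = w i ∧ f * w i = w i := fun i =>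
    ⟨by rw [← a3 i, mul_assoc, he'], by rw [← a2 i, ← mul_assoc, hf']⟩
  obtain ⟨V, hV⟩ := hA.fam w (fun i => pi3 (pe i) (hw1 i)) (fun i j hij => ⟨by
      rw [← a1, ← a2 j, mul_assoc, ← mul_assoc (f' i), of i j hij]; simp, by
      rw [← a3, ← a4 j, mul_assoc, ← mul_assoc (e' i), oe i j hij]; simp⟩) hle
  refine ⟨V, hV.pi, ?_, ?_, ?_, ?_⟩
  · convert hV.ann_src using 1
    rw [← Set.range_comp]; congr 1; ext i; simp [hw1]
  · convert hV.ann_rng using 1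
    rw [← Set.range_comp]; congr 1; ext i; simp [hw2]
  · exact hV.le_src (by rintro _ ⟨i, rfl⟩; exact (hle i).1)
  · exact hV.le_rng hf.1 (by rintro _ ⟨i, rfl⟩; exact (hle i).2)

theorem add_equiv {ι : Type*} {e f : B} (hA : AddP e f) (e' f' : ι → B)
    (pe : ∀ i, IsProjection (e' i)) (oe : ∀ i j, i ≠ j → e' i * e' j = 0)
    (of : ∀ i j, i ≠ j → f' i * f' j = 0) (hef : ∀ i, ProjEquiv (e' i) (f' i))
    (he : Ann (Set.range e') e) (hf : Ann (Set.range f') f) : ProjEquiv e f := by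
  obtain ⟨V, h1, h2, h3, h4, h5⟩ := add_fam he.1 hf.1 hA e' f' pe oe of hef
    (fun i => he.mul_self ⟨i, rfl⟩) (fun i => le_symm (pe_pj (pe i) (hef i)) hf.1 (hf.mul_self ⟨i, rfl⟩))
  exact ⟨V, h2.unique he, h3.unique hf⟩

theorem add_sub {ι : Type*} {e f : B} (hA : AddP e f) (hf : IsProjection f) (e' f' : ι → B)
    (pe : ∀ i, IsProjection (e' i)) (oe : ∀ i j, i ≠ j → e' i * e' j = 0)
    (of : ∀ i j, i ≠ j → f' i * f' j = 0) (hef : ∀ i, ProjEquiv (e' i) (f' i))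
    (he : Ann (Set.range e') e) (hf' : ∀ i, f * f' i = f' i) : SubE e f := by
  obtain ⟨V, h1, h2, h3, h4, h5⟩ := add_fam he.1 hf hA e' f' pe oe of hef
    (fun i => he.mul_self ⟨i, rfl⟩) hf'
  exact ⟨V, h2.unique he, h5⟩

/-- nonzero partial isometry from nonzero element -/
theorem II1 {e f x : B} (hf : AWC f) (h1 : e * x = x) (h2 : x * f = x) (h0 : x ≠ 0) :
    ∃ w, w ≠ 0 ∧ w * (star w * w) = w ∧ w * f = w ∧ e * w = w ∧ ∃ y, w = x * y := by
  obtain ⟨h, y, hh, hh0, hhf, hyh, hhy, sy, hay, hc⟩ := SL hf h2 h0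
  have hw : star (x * y) * (x * y) = h := by
    rw [star_mul, sy, mul_assoc, ← mul_assoc (star x), ← mul_assoc, ← (hc _ rfl).2, mul_assoc, hay]
  refine ⟨x * y, ?_, pi3 hh hw, ?_, by rw [← mul_assoc, h1], y, rfl⟩
  · intro h; rw [h, mul_zero] at hw; exact hh0 hw.symm
  · rw [mul_assoc, ← hyh, mul_assoc, hhf]

theorem GC {e f : B} (hCA : CA B) (he : IsProjection e) (hf : AWC f) (hA : AddP e f) :
    ∃ z, IsCentralProj z ∧ SubE (z * e) (z * f) ∧ SubE ((1 - z) * f) ((1 - z) * e) := by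
  obtain ⟨W, hW, hW2, hmax⟩ := exists_max_OPI (fun w : B => w * e = w ∧ f * w = w)
  obtain ⟨V, hV⟩ := hA W hW (fun w hw => (hW2 w hw).2)
  have Ve : V * e = V := hV.le_src fun w hw => (hW2 w hw).2.1
  have fV : f * V = V := hV.le_rng hf.1.1 fun w hw => (hW2 w hw).2.2
  have eV : e * star V = star V := by simpa [he.1] using st Ve
  have Vf : star V * f = star V := by simpa [hf.1.1] using st fV
  set e' := e - star V * V with he'
  set f' := f - V * star V with hf'
  have pe' : IsProjection e' := pj_sub (pi_src hV.pi) he (by rw [mul_assoc, Ve])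
  have pf' : IsProjection f' := pj_sub (pi_rng hV.pi) hf.1 (by rw [mul_assoc, Vf])
  have e'e : e' * e = e' := by rw [he', sub_mul, he.2, mul_assoc, Ve]
  have f'f : f' * f = f' := by rw [hf', sub_mul, hf.1.2, mul_assoc, Vf]
  have Ve' : V * e' = 0 := by rw [he', mul_sub, Ve, hV.pi, sub_self]
  have Vf' : star V * f' = 0 := by rw [hf', mul_sub, Vf, pi_star hV.pi, sub_self]
  have key : ∀ b, e' * b * f' = 0 := by
    intro b
    by_contra hne
    obtain ⟨w, w0, wpi, wf, ew, y, hy⟩ := II1 (e := e') (f := f') (hf.sub pf' f'f) (x := e' * b * f')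
      (by rw [← mul_assoc, ← mul_assoc, pe'.2]) (by rw [mul_assoc, pf'.2]) hne
    have := hmax (star w) (by simpa using pi_star wpi) ⟨?_, ?_⟩ ?_
    · exact w0 (by simpa using this)
    · have := st (show e * w = w by rw [← ew, ← mul_assoc, le_symm pe' he e'e])
      rwa [he.1] at this
    · have := st (show w * f = w by rw [← wf, mul_assoc, f'f])
      rwa [hf.1.1] at this
    · intro w' hw'
      constructor
      · have : star V * star w = 0 := by
          have := st wf
          rw [pf'.1] at this
          rw [← this, ← mul_assoc, Vf', zero_mul]
        exact (hV.rng _).2 this w' hw'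
      · have : V * w = 0 := by rw [← ew, ← mul_assoc, Ve', zero_mul]
        simpa using (hV.src _).2 this w' hw'
  obtain ⟨c, hc⟩ := hCA e'
  have cf' : c * f' = 0 := (hc.2 f').1 key
  have cf : c * f = c * (V * star V) := by
    rw [hf', mul_sub, sub_eq_zero] at cf'; exact cf'
  have ce : (1 - c) * e = (1 - c) * (star V * V) := by
    have : (1 - c) * e' = 0 := by rw [sub_mul, one_mul, hc.mul', sub_self]
    rwa [he', mul_sub, sub_eq_zero] at this
  have hz := cz_compl hc.1
  refine ⟨1 - c, hz, ⟨(1 - c) * V, ?_, ?_⟩, ?_⟩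
  · rw [cz_s hz, cz_m hz, ce]
  · rw [cz_m hz, fV]
  · rw [sub_sub_cancel]
    refine ⟨c * star V, ?_, ?_⟩
    · rw [cz_s hc.1, cz_m hc.1, star_star, cf]
    · rw [cz_m hc.1, eV]

theorem EX {p f : B} (hCA : CA B) (hp : AWC p) (hf : AWC f) (f0 : f ≠ 0) (W0 : Set B)
    (h1 : ∀ w ∈ W0, star w * w = f ∧ p * w = w)
    (h2 : ∀ w ∈ W0, ∀ w' ∈ W0, w ≠ w' → star w * w' = 0) :
    ∃ W : Set B, ∃ t : B, W0 ⊆ W ∧ (∀ w ∈ W, star w * w = f ∧ p * w = w) ∧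
      (∀ w ∈ W, ∀ w' ∈ W, w ≠ w' → star w * w' = 0) ∧
      IsProjection t ∧ t * p = t ∧ (∀ w ∈ W, t * w = 0) ∧ Ann ((fun w => w * star w) '' W) (p - t) ∧
      (AddP t f → ∃ z, IsCentralProj z ∧ z * f ≠ 0 ∧ SubE (z * t) (z * f)) := by
  obtain ⟨W, hW0, hW1, hW2, hmax⟩ := exists_max_pw (fun w : B => star w * w = f ∧ p * w = w)
    (fun w w' => star w * w' = 0) W0 h1 h2 (fun w w' h => by simpa using st h)
  have pw : ∀ w ∈ W, star w * p = star w := fun w hw => by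
    have := st (hW1 w hw).2; rwa [hp.1.1] at this
  obtain ⟨E, hE⟩ := hp.2 ((fun w => w * star w) '' W) (by
    rintro _ ⟨w, hw, rfl⟩
    simp only [mul_assoc, pw w hw])
  have Ep : E * p = E := hE.le (by
    rintro _ ⟨w, hw, rfl⟩
    simp only [mul_assoc, pw w hw])
  have pt := pj_sub hE.1 hp.1 Ep
  have tw : ∀ w ∈ W, (p - E) * w = 0 := by
    intro w hw
    have h3 := hE.mul_self ⟨w, hw, rfl⟩
    have h4 := le_symm (pi_rng (pi3 hf.1 (hW1 w hw).1)) hE.1 h3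
    have h5 := pi3 hf.1 (hW1 w hw).1
    have : E * w = w := by rw [← h5, ← mul_assoc w, ← mul_assoc, h4]
    rw [sub_mul, (hW1 w hw).2, this, sub_self]
  refine ⟨W, p - E, hW0, hW1, hW2, pt, ?_, tw, by simpa using hE, fun hA => ?_⟩
  · rw [sub_mul, hp.1.2, Ep]
  · obtain ⟨z, hz, hz1, w, hw, hw'⟩ := GC hCA pt hf hA
    refine ⟨z, hz, fun h => ?_, hz1⟩
    have hf' : (1 - z) * f = f := by rw [sub_mul, h]; simp
    rw [hf'] at hw
    have tw' : (p - E) * w = w := by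
      have h6 : (p - E) * ((1 - z) * (p - E) * w) = (1 - z) * (p - E) * w := by
        have h7 := (cz_compl hz).2 (p - E)
        calc (p - E) * ((1 - z) * (p - E) * w) = ((p - E) * (1 - z)) * (p - E) * w := by simp only [mul_assoc]
          _ = _ := by rw [← h7, mul_assoc (1 - z), pt.2]
      rw [hw'] at h6; exact h6
    have hpt : p * (p - E) = p - E := by rw [mul_sub, hp.1.2, le_symm hE.1 hp.1 Ep]
    have hmem := hmax w ⟨hw, by rw [← tw', ← mul_assoc, hpt]⟩ (fun w' hw' => by
      have := st tw'; rw [pt.1] at this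
      rw [← this, mul_assoc, tw w' hw', mul_zero])
    have := tw w hmem
    rw [tw'] at this
    rw [this] at hw
    exact f0 (by simpa using hw.symm)

theorem PL {u x e F : B} (hu : AWC u) (hx : x * u = x) (he : Ann {x} e) (hF : IsProjection F) (hFx : F * x = x)
    (hA : AddP e F) : ∃ w, star w * w = e ∧ F * w = w ∧ ∀ y, y * x = 0 ↔ y * w = 0 := by
  set a := star x * x with ha
  have sa : star a = a := by simp [ha]
  let Φ : B → Prop := fun h => IsProjection h ∧ h ≠ 0 ∧ h * u = h ∧ a * h = h * a ∧
    ∃ y, y * h = y ∧ h * y = y ∧ star y = y ∧ a * y = y * a ∧ a * (y * y) = h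
  obtain ⟨H, -, h1, h2, hmax⟩ := exists_max_pw Φ (fun h h' => h * h' = 0 ∧ h' * h = 0) ∅ (by simp) (by simp)
    (fun h h' k => ⟨k.2, k.1⟩)
  choose! Y hY using (fun h (hh : h ∈ H) => (h1 h hh).2.2.2.2)
  have wsrc : ∀ h ∈ H, star (x * Y h) * (x * Y h) = h := fun h hh => by
    obtain ⟨k1, k2, k3, k4, k5⟩ := hY h hh
    rw [star_mul, k3, mul_assoc, ← mul_assoc (star x), ← ha, ← mul_assoc, ← k4, mul_assoc, k5]
  have xe : x * e = x := he.mul_self rfl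
  have ae : a * e = a := by rw [ha, mul_assoc, xe]
  have ea : e * a = a := by simpa [sa, he.1.1] using st ae
  have eh : ∀ h ∈ H, e * h = h := fun h hh => by
    obtain ⟨k1, k2, k3, k4, k5⟩ := hY h hh
    rw [← k5, ← mul_assoc, ea]
  have ye : ∀ h ∈ H, Y h * e = Y h := fun h hh => by
    obtain ⟨k1, k2, k3, k4, k5⟩ := hY h hh
    rw [← k1, mul_assoc, le_symm' (h1 h hh).1 he.1 (eh h hh)]
  obtain ⟨V, hV⟩ := hA ((fun h => x * Y h) '' H) ⟨by
      rintro _ ⟨h, hh, rfl⟩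
      exact pi3 (h1 h hh).1 (wsrc h hh), by
      rintro _ ⟨h, hh, rfl⟩ _ ⟨h', hh', rfl⟩ hne
      have o := h2 h hh h' hh' (fun k => hne (by rw [k]))
      obtain ⟨k1, k2, k3, k4, k5⟩ := hY h hh
      obtain ⟨l1, l2, l3, l4, l5⟩ := hY h' hh'
      constructor
      · calc star (x * Y h) * (x * Y h') = Y h * h * a * (h' * Y h') := by
              rw [star_mul, k3, k1, l2, ha]; simp only [mul_assoc]
          _ = Y h * a * (h * h') * Y h' := by
              have := (h1 h hh).2.2.2.1
              rw [mul_assoc (Y h), ← this]; simp only [mul_assoc]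
          _ = 0 := by rw [o.1]; simp
      · calc x * Y h * star (x * Y h') = x * (Y h * h) * (h' * Y h') * star x := by
              rw [star_mul, l3, k1, l2]; simp only [mul_assoc]
          _ = x * Y h * (h * h') * Y h' * star x := by simp only [mul_assoc]
          _ = 0 := by rw [o.1]; simp⟩ (by
      rintro _ ⟨h, hh, rfl⟩
      simp only [mul_assoc, ye h hh, true_and]
      rw [← mul_assoc, hFx])
  obtain ⟨E, hE⟩ := hu.2 H (fun h hh => (h1 h hh).2.2.1)
  have hVE : star V * V = E := by
    refine hV.ann_src.unique ?_
    convert hE using 1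
    rw [Set.image_image]
    ext k
    constructor
    · rintro ⟨h, hh, rfl⟩; simp only [wsrc h hh]; exact hh
    · intro hk; exact ⟨k, hk, wsrc k hk⟩
  have aE : a * E = E * a := hE.commute (fun h hh => (h1 h hh).2.2.2.1.symm) (by
    intro h hh; rw [sa]; exact (h1 h hh).2.2.2.1.symm)
  have Ee : E * e = E := hE.le fun h hh => le_symm' (h1 h hh).1 he.1 (eh h hh)
  have xE : x * (1 - E) = 0 := by
    by_contra hne
    have Eu : E * u = E := hE.le fun h hh => (h1 h hh).2.2.1
    have hu' : AWC (u - E) := hu.sub (pj_sub hE.1 hu.1 Eu) (by rw [sub_mul, hu.1.2, Eu])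
    have xx : x * (u - E) = x * (1 - E) := by rw [mul_sub, hx, mul_sub, mul_one]
    obtain ⟨h, y, hh, hh0, hhu, hyh, hhy, sy, hay, hc⟩ := SL (x := x * (1 - E)) hu' (by
      rw [← xx, mul_assoc, hu'.1.2]) hne
    have s1 : star (1 - E) = 1 - E := by rw [star_sub, star_one, hE.1.1]
    have aE' : a * (1 - E) = (1 - E) * a := by rw [mul_sub, sub_mul, aE, mul_one, one_mul]
    have a' : star (x * (1 - E)) * (x * (1 - E)) = a * (1 - E) := by
      rw [star_mul, s1, mul_assoc, ← mul_assoc (star x), ← ha, aE', ← mul_assoc, (pj_compl hE.1).2]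
    rw [a'] at hay hc
    have hcom := hc a (by rw [mul_assoc, ← aE'])
    have hE0 : h * E = 0 := by
      have : (u - E) * E = 0 := by rw [sub_mul, le_symm hE.1 hu.1 Eu, hE.1.2, sub_self]
      rw [← hhu, mul_assoc, this, mul_zero]
    have hE0' := orth_symm hh hE.1 hE0
    have hmem := hmax h ⟨hh, hh0, ?_, hcom.1, y, hyh, hhy, sy, hcom.2, ?_⟩ (fun h' hh' => ?_)
    · have := hE.mul_self hmem
      rw [hE0] at this; exact hh0 this.symm
    · rw [← hhu, mul_assoc, sub_mul, hu.1.2, Eu]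
    · have : (1 - E) * y = y := by rw [← hhy, ← mul_assoc, sub_mul, hE0', one_mul, sub_zero]
      calc a * (y * y) = a * (((1 - E) * y) * y) := by rw [this]
        _ = a * (1 - E) * (y * y) := by simp only [mul_assoc]
        _ = h := hay
    · have k := hE.mul_self hh'
      have k2 := le_symm (h1 h' hh').1 hE.1 k
      exact ⟨by rw [← k2, ← mul_assoc, hE0, zero_mul], by rw [← k, mul_assoc, hE0', mul_zero]⟩
  have xE' : x * E = x := by rw [mul_sub, mul_one, sub_eq_zero] at xE; exact xE.symm
  have eE : e = E := by
    have := he.le (u := E) (by simpa using xE')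
    rw [← this]; exact le_symm hE.1 he.1 Ee
  refine ⟨V, by rw [hVE, eE], hV.le_rng hF.1 ?_, fun y => ?_⟩
  · rintro _ ⟨h, hh, rfl⟩
    simp only; rw [← mul_assoc, hFx]
  · have r := hV.rng (star y)
    rw [Set.forall_mem_image] at r
    have c1 : star V * star y = 0 ↔ y * V = 0 := by
      constructor
      · intro k; simpa using st k
      · intro k; simpa using st k
    rw [← c1, ← r]
    constructor
    · intro k h hh
      have : y * (x * Y h) = 0 := by rw [← mul_assoc, k, zero_mul]
      simpa using st this
    · intro k
      have k2 : E * star (y * x) = 0 := by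
        refine (hE.2 _).1 fun h hh => ?_
        obtain ⟨k1, _, k3, k4, k5⟩ := hY h hh
        have q : y * (x * Y h) = 0 := by simpa using st (k hh)
        have q2 : y * x * h = 0 := by
          have : h = Y h * Y h * a := by
            have := congrArg star k5
            rw [star_mul, star_mul, sa, k3, (h1 h hh).1.1] at this
            exact this.symm
          rw [this]
          calc y * x * (Y h * Y h * a) = y * (x * Y h) * (Y h * a) := by simp only [mul_assoc]
            _ = 0 := by rw [q, zero_mul]
        have := st q2
        rwa [(h1 h hh).1.1, star_zero] at this
      have k3 : y * x * E = 0 := by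
        have := st k2
        rwa [star_star, hE.1.1, star_zero] at this
      rwa [mul_assoc, xE'] at k3
end MM

set_option linter.unusedVariables false
set_option linter.unusedSimpArgs false
namespace MM
variable {B : Type*} [CStarAlgebra B]

structure Sys {κ : Type*} [Fintype κ] (u0 : B) (v : κ → B) : Prop where
  aw : AWC u0
  iso : ∀ j, star (v j) * v j = u0
  orth : ∀ j k, j ≠ k → star (v j) * v k = 0
  sum : ∑ j, v j * star (v j) = 1

namespace Sys
variable {κ : Type*} [Fintype κ] {u0 : B} {v : κ → B}

theorem vu (h : Sys u0 v) (j : κ) : v j * u0 = v j := pi_of_pj h.aw.1 (h.iso j)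
theorem uv (h : Sys u0 v) (j : κ) : u0 * star (v j) = star (v j) := by
  have := st (h.vu j); rwa [h.aw.1.1] at this

theorem left (h : Sys u0 v) (x : B) : x = ∑ j, v j * (star (v j) * x) := by
  simp only [← mul_assoc]; rw [← Finset.sum_mul, h.sum, one_mul]
theorem right (h : Sys u0 v) (x : B) : x = ∑ j, x * v j * star (v j) := by
  simp only [mul_assoc]; rw [← Finset.mul_sum, h.sum, mul_one]

theorem ext0 (h : Sys u0 v) {x : B} (H : ∀ j, star (v j) * x = 0) : x = 0 := by
  rw [h.left x]; simp [H]

theorem ca (h : Sys u0 v) : CA B := by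
  classical
  intro e
  obtain ⟨P, hP⟩ := h.aw.2 (Set.range fun b => e * b * u0) (by
    rintro _ ⟨b, rfl⟩; rw [mul_assoc, h.aw.1.2])
  have Pu : P * u0 = P := hP.le (by rintro _ ⟨b, rfl⟩; rw [mul_assoc, h.aw.1.2])
  have uP := le_symm hP.1 h.aw.1 Pu
  have hb : ∀ x, (∀ b, e * b * u0 * x = 0) ↔ P * x = 0 := fun x => by
    rw [← hP.2 x]; simp
  have k1 : ∀ d, u0 * d = d → P * d * P = P * d * u0 := by
    intro d hd
    have : P * (d * (u0 - P)) = 0 := by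
      refine (hb _).1 fun b => ?_
      have h2 := (hb (u0 - P)).2 (by rw [mul_sub, Pu, hP.1.2, sub_self]) (b * u0 * d)
      rw [mul_sub, sub_eq_zero] at h2
      rw [mul_sub]
      have h3 : ∀ x, e * b * u0 * (d * x) = e * (b * u0 * d) * x := by intro x; simp only [mul_assoc]
      have h4 : ∀ x, e * (b * u0 * d) * (u0 * x) = e * b * u0 * (d * (u0 * x)) := by intro x; simp only [mul_assoc]
      calc e * b * u0 * (d * u0 - d * P) = e * (b * u0 * d) * u0 * u0 - e * (b * u0 * d) * u0 * P := by
            rw [mul_sub, h3, h3, mul_assoc _ u0 P, uP, mul_assoc _ u0 u0, h.aw.1.2]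
        _ = 0 := by rw [h2, sub_self]
    rw [mul_sub, mul_sub, sub_eq_zero, ← mul_assoc, ← mul_assoc] at this
    exact this.symm
  have k2 : ∀ d, u0 * d = d → d * u0 = d → P * d = d * P := by
    intro d h1 h2
    have a := k1 d h1
    have b := st (k1 (star d) (by have := st h2; rwa [h.aw.1.1] at this))
    simp only [star_mul, hP.1.1, h.aw.1.1, star_star] at b
    rw [mul_assoc P d u0, h2] at a
    rw [← mul_assoc u0, h1, ← mul_assoc] at b
    rw [← a, ← b]
  have cc : ∀ x, (∑ j, v j * P * star (v j)) * x = x * ∑ j, v j * P * star (v j) := by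
    intro x
    rw [Finset.sum_mul, Finset.mul_sum]
    calc ∑ j, v j * P * star (v j) * x = ∑ j, ∑ k, v j * P * (star (v j) * x * v k) * star (v k) := by
          refine Finset.sum_congr rfl fun j _ => ?_
          conv_lhs => rw [h.right (v j * P * star (v j) * x)]
          exact Finset.sum_congr rfl fun k _ => by simp only [mul_assoc]
      _ = ∑ j, ∑ k, v j * (star (v j) * (x * v k * P * star (v k))) := by
          refine Finset.sum_congr rfl fun j _ => Finset.sum_congr rfl fun k _ => ?_
          rw [mul_assoc (v j) P, k2 (star (v j) * x * v k) (by simp only [← mul_assoc, h.uv])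
            (by rw [mul_assoc, h.vu])]
          simp only [mul_assoc]
      _ = _ := by
          rw [Finset.sum_comm]
          refine Finset.sum_congr rfl fun k _ => ?_
          rw [← h.left]; simp only [mul_assoc]
  have c1 : ∀ k, star (v k) * (∑ j, v j * P * star (v j)) = P * star (v k) := by
    intro k
    rw [Finset.mul_sum, Finset.sum_eq_single k]
    · rw [← mul_assoc, ← mul_assoc, h.iso, uP]
    · intro j _ hj; rw [← mul_assoc, ← mul_assoc, h.orth k j hj.symm]; simp
    · simp
  refine ⟨∑ j, v j * P * star (v j), ⟨⟨?_, ?_⟩, cc⟩, fun x => ?_⟩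
  · rw [star_sum]; exact Finset.sum_congr rfl fun j _ => by simp [hP.1.1, mul_assoc]
  · rw [Finset.sum_mul]
    exact Finset.sum_congr rfl fun j _ => by
      rw [mul_assoc, c1, ← mul_assoc, mul_assoc (v j) P P, hP.1.2]
  · constructor
    · intro H
      refine h.ext0 fun k => ?_
      rw [← mul_assoc, c1, mul_assoc, ← hb]
      intro b
      have := H (b * u0 * star (v k))
      simpa only [mul_assoc] using this
    · intro H b
      rw [h.left x, Finset.mul_sum]
      refine Finset.sum_eq_zero fun k _ => ?_
      have h1 : P * (star (v k) * x) = 0 := by rw [← mul_assoc, ← c1, mul_assoc, H, mul_zero]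
      have := (hb _).2 h1 (b * v k)
      rw [mul_assoc, mul_assoc, ← mul_assoc u0, h.uv] at this
      simpa only [mul_assoc] using this

/-- gluing of self-adjoint elements of the corner -/
theorem glue_sa (h : Sys u0 v) {ι : Type*} {z c : ι → B} (hz : ∀ i, IsCentralProj (z i))
    (oz : ∀ i j, i ≠ j → z i * z j = 0) (cu : ∀ i, c i * u0 = c i) (sc : ∀ i, star (c i) = c i)
    (nc : ∀ i, ‖c i‖ ≤ 1) : ∃ d, ∀ i, z i * d = z i * c i := by
  choose p hp1 hp2 using fun i => dyadic h.aw (cu i) (sc i) (nc i)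
  have hP : ∀ k, ∃ P, Ann (Set.range fun i => z i * p i k) P := fun k =>
    h.aw.2 _ (by rintro _ ⟨i, rfl⟩; rw [mul_assoc, (hp1 i k).2.1])
  choose P hP using hP
  have zP : ∀ i k, z i * P k = z i * p i k := by
    intro i k
    have h1 : z i * p i k * P k = z i * p i k := (hP k).mul_self ⟨i, rfl⟩
    have h2 : P k * (z i * (1 - p i k)) = 0 := by
      refine ((hP k).2 _).1 ?_
      rintro _ ⟨j, rfl⟩
      by_cases hij : j = i
      · subst hij
        simp only
        rw [cz_m (hz j), mul_sub, mul_one, (hp1 j k).1.2, sub_self, mul_zero]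
      · simp only
        rw [cz_l (hz i), ← mul_assoc, ← mul_assoc, oz i j (Ne.symm hij)]; simp
    rw [cz_l (hz i), mul_sub, mul_one, mul_sub, sub_eq_zero] at h2
    have h3 := st h1
    simp only [star_mul, (hz i).1.1, (hP k).1.1, (hp1 i k).1.1] at h3
    rw [h2, ← mul_assoc, (hz i).2, mul_assoc, (hz i).2, h3]
  have nP : ∀ k, ‖P k‖ ≤ 1 := fun k => by
    have h1 := CStarRing.norm_star_mul_self (x := P k)
    rw [(hP k).1.1, (hP k).1.2] at h1
    nlinarith [norm_nonneg (P k), sq_nonneg (‖P k‖ - 1)]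
  have sm : Summable fun k => ((1/2 : ℝ) ^ k) • P k := by
    refine Summable.of_norm_bounded (g := fun k => (1/2 : ℝ) ^ k) summable_geometric_two fun k => ?_
    rw [norm_smul]
    simp only [norm_pow, Real.norm_eq_abs]
    rw [abs_of_pos (by norm_num : (0:ℝ) < 1/2)]
    exact mul_le_of_le_one_right (by positivity) (nP k)
  refine ⟨(∑' k, ((1/2 : ℝ) ^ k) • P k) - u0, fun i => ?_⟩
  have a1 := (sm.hasSum).mul_left (z i)
  have a2 := (hp2 i).mul_left (z i)
  have : (fun k => z i * ((1/2 : ℝ) ^ k) • P k) = fun k => z i * ((1/2 : ℝ) ^ k) • p i k := by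
    funext k; rw [mul_smul_comm, mul_smul_comm, zP]
  rw [this] at a1
  rw [mul_sub, a1.unique a2, mul_add]; abel

theorem glue_corner (h : Sys u0 v) {ι : Type*} {z c : ι → B} (hz : ∀ i, IsCentralProj (z i))
    (oz : ∀ i j, i ≠ j → z i * z j = 0) (cu : ∀ i, c i * u0 = c i) (uc : ∀ i, u0 * c i = c i)
    (nc : ∀ i, ‖c i‖ ≤ 1) : ∃ d, ∀ i, z i * d = z i * c i := by
  have su : ∀ i, star (c i) * u0 = star (c i) := fun i => by have := st (uc i); rwa [h.aw.1.1] at this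
  have ns : ∀ i, ‖star (c i)‖ ≤ 1 := fun i => by rw [norm_star]; exact nc i
  obtain ⟨d1, h1⟩ := h.glue_sa (c := fun i => (1/2 : ℝ) • (c i + star (c i))) hz oz
    (fun i => by rw [smul_mul_assoc, add_mul, cu, su]) (fun i => by simp [add_comm]) (fun i => by
      rw [norm_smul]
      have := norm_add_le (c i) (star (c i))
      have := nc i; have := ns i
      rw [Real.norm_eq_abs, abs_of_pos (by norm_num : (0:ℝ) < 1/2)]; linarith)
  obtain ⟨d2, h2⟩ := h.glue_sa (c := fun i => (Complex.I / 2) • (star (c i) - c i)) hz oz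
    (fun i => by rw [smul_mul_assoc, sub_mul, cu, su]) (fun i => by
      simp only [star_smul, star_sub, star_star]
      have : star (Complex.I / 2) = - (Complex.I / 2) := by
        simp [Complex.ext_iff]; norm_num
      rw [this, neg_smul, ← smul_neg, neg_sub]) (fun i => by
      rw [norm_smul]
      have := norm_sub_le (star (c i)) (c i)
      have := nc i; have := ns i
      have h5 : ‖(Complex.I / 2)‖ = 1/2 := by simp
      rw [h5]; linarith)
  refine ⟨d1 + Complex.I • d2, fun i => ?_⟩
  rw [mul_add, mul_smul_comm, h1, h2, ← mul_smul_comm, ← mul_add]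
  congr 1
  rw [smul_smul, show Complex.I * (Complex.I / 2) = -(1/2 : ℂ) by
    rw [← mul_div_assoc, Complex.I_mul_I]; norm_num]
  rw [show (1/2 : ℝ) • (c i + star (c i)) = (1/2 : ℂ) • (c i + star (c i)) by
    rw [← Complex.coe_smul]; norm_num]
  rw [neg_smul, ← sub_eq_add_neg, ← smul_sub]
  rw [show c i + star (c i) - (star (c i) - c i) = (2:ℂ) • c i by rw [two_smul]; abel, smul_smul]
  norm_num

theorem norm_v (h : Sys u0 v) (j : κ) : ‖v j‖ ≤ 1 := by
  have h0 := CStarRing.norm_star_mul_self (x := u0)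
  rw [h.aw.1.1, h.aw.1.2] at h0
  have h1 := CStarRing.norm_star_mul_self (x := v j)
  rw [h.iso] at h1
  have h2 : ‖u0‖ ≤ 1 := by nlinarith [norm_nonneg u0]
  nlinarith [norm_nonneg (v j)]

theorem glue (h : Sys u0 v) {ι : Type*} {z c : ι → B} (hz : ∀ i, IsCentralProj (z i))
    (oz : ∀ i j, i ≠ j → z i * z j = 0) 
    (nc : ∀ i, ‖c i‖ ≤ 1) : ∃ d, ∀ i, z i * d = z i * c i := by
  have key : ∀ j k, ∃ d, ∀ i, z i * d = z i * (star (v j) * c i * v k) := by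
    intro j k
    refine h.glue_corner hz oz (fun i => by rw [mul_assoc, h.vu]) (fun i => by
      rw [← mul_assoc, ← mul_assoc, h.uv]) fun i => ?_
    calc ‖star (v j) * c i * v k‖ ≤ ‖star (v j)‖ * ‖c i‖ * ‖v k‖ :=
          (norm_mul_le _ _).trans (mul_le_mul_of_nonneg_right (norm_mul_le _ _) (norm_nonneg _))
      _ ≤ 1 * 1 * 1 := by
          have := h.norm_v j; have := h.norm_v k; have := nc i
          rw [norm_star]
          gcongr
      _ = 1 := by norm_num
  choose d hd using key
  refine ⟨∑ j, ∑ k, v j * d j k * star (v k), fun i => ?_⟩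
  rw [Finset.mul_sum]
  conv_rhs => rw [h.left (c i), Finset.mul_sum]
  refine Finset.sum_congr rfl fun j _ => ?_
  rw [Finset.mul_sum]
  conv_rhs => rw [h.right (star (v j) * c i), Finset.mul_sum, Finset.mul_sum]
  refine Finset.sum_congr rfl fun k _ => ?_
  calc z i * (v j * d j k * star (v k)) = v j * (z i * d j k) * star (v k) := by
        rw [cz_l (hz i)]; simp only [mul_assoc]
    _ = _ := by rw [hd, cz_l (hz i)]; simp only [mul_assoc]

theorem LG (h : Sys u0 v) (S : Set B)
    (H : ∀ z, IsCentralProj z → z ≠ 0 → ∃ z', IsCentralProj z' ∧ z' ≠ 0 ∧ z' * z = z' ∧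
      ∃ E, Ann ((fun s => z' * s) '' S) E) : ∃ E, Ann S E := by
  obtain ⟨Z, -, hZ, oZ, hmax⟩ := exists_max_pw (fun z : B => IsCentralProj z ∧ z ≠ 0 ∧
      ∃ E, Ann ((fun s => z * s) '' S) E) (fun z z' => z * z' = 0 ∧ z' * z = 0) ∅ (by simp) (by simp)
      (fun z z' h => ⟨h.2, h.1⟩)
  have tot : ∀ x, (∀ z ∈ Z, z * x = 0) → x = 0 := by
    obtain ⟨E, hE⟩ := h.aw.2 ((fun z => z * u0) '' Z) (by
      rintro _ ⟨z, hz, rfl⟩; simp only; rw [mul_assoc, h.aw.1.2])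
    have Eu : E * u0 = E := hE.le (by rintro _ ⟨z, hz, rfl⟩; simp only; rw [mul_assoc, h.aw.1.2])
    have hc0 : u0 - E = 0 := by
      by_contra hne
      obtain ⟨c, hc⟩ := h.ca (u0 - E)
      obtain ⟨z', hz', h0, hle, hE'⟩ := H c hc.1 (hc.ne_zero hne)
      have zc : ∀ z ∈ Z, z * c = 0 := by
        intro z hz
        have h1 : z * u0 * (u0 - E) = 0 := (hE.2 _).2 (by rw [mul_sub, Eu, hE.1.2, sub_self]) _ ⟨z, hz, rfl⟩
        have h2 : z * (u0 - E) = 0 := by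
          rw [mul_assoc, mul_sub, h.aw.1.2, le_symm hE.1 h.aw.1 Eu] at h1; exact h1
        have h3 := hc.le (cz_compl (hZ z hz).1) (by rw [mul_sub, mul_one, ← (hZ z hz).1.2, h2, sub_zero])
        rw [mul_sub, mul_one, ← (hZ z hz).1.2] at h3
        simpa using h3
      have hm := hmax z' ⟨hz', h0, hE'⟩ (fun z hz => by
        have : z * z' = 0 := by rw [← hle, hz'.2 c, ← mul_assoc, zc z hz, zero_mul]
        exact ⟨by rw [hz'.2, this], this⟩)
      have := zc z' hm
      rw [hle] at this; exact h0 this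
    intro x hx
    refine h.ext0 fun j => ?_
    have : E * (star (v j) * x) = 0 := by
      refine (hE.2 _).1 ?_
      rintro _ ⟨z, hz, rfl⟩
      simp only
      rw [mul_assoc, ← mul_assoc u0, h.uv, ← cz_l (hZ z hz).1, hx z hz, mul_zero]
    rw [sub_eq_zero] at hc0
    rw [← hc0, ← mul_assoc, h.uv] at this
    exact this
  choose E hE using fun z : Z => (hZ z z.2).2.2
  have zE : ∀ z : Z, z.1 * E z = E z := fun z => by
    have := (hE z).le (u := z.1) (by rintro _ ⟨s, hs, rfl⟩; simp only; rw [← (hZ z z.2).1.2, cz_zz (hZ z z.2).1])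
    rw [(hZ z z.2).1.2, this]
  have oz : ∀ z z' : Z, z ≠ z' → z.1 * z'.1 = 0 := fun z z' hne => (oZ z z.2 z' z'.2 (fun k => hne (Subtype.ext k))).1
  obtain ⟨d, hd⟩ := h.glue (z := fun z : Z => z.1) (c := E) (fun z => (hZ z z.2).1)
    oz (fun z => by
      have h1 := CStarRing.norm_star_mul_self (x := E z)
      rw [(hE z).1.1, (hE z).1.2] at h1
      nlinarith [norm_nonneg (E z), sq_nonneg (‖E z‖ - 1)])
  have hd' : ∀ z : Z, z.1 * d = E z := fun z => by rw [hd, zE]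
  refine ⟨d, ⟨?_, ?_⟩, fun x => ?_⟩
  · rw [← sub_eq_zero]
    refine tot _ fun z hz => ?_
    rw [mul_sub, ← cz_s (hZ z hz).1, hd' ⟨z, hz⟩, (hE _).1.1, sub_self]
  · rw [← sub_eq_zero]
    refine tot _ fun z hz => ?_
    rw [mul_sub, ← cz_m (hZ z hz).1, hd' ⟨z, hz⟩, (hE _).1.2, sub_self]
  · constructor
    · intro hx
      refine tot _ fun z hz => ?_
      rw [← mul_assoc, hd' ⟨z, hz⟩, ← (hE _).2]
      rintro _ ⟨s, hs, rfl⟩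
      simp only; rw [mul_assoc, hx s hs, mul_zero]
    · intro hx s hs
      refine tot _ fun z hz => ?_
      rw [← mul_assoc]
      refine ((hE ⟨z, hz⟩).2 x).2 ?_ _ ⟨s, hs, rfl⟩
      rw [← hd' ⟨z, hz⟩, mul_assoc, hx, mul_zero]

end Sys
end MM

set_option linter.unusedVariables false
set_option linter.unusedSimpArgs false
namespace MM
variable {B : Type*} [CStarAlgebra B]

def IL (T : Set B) (x : B) : Prop := ∀ t ∈ T, t * x = 0
theorem IL.mul {T : Set B} {x : B} (h : IL T x) (b : B) : IL T (x * b) := fun t ht => by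
  rw [← mul_assoc, h t ht, zero_mul]
theorem IL.sub {T : Set B} {x y : B} (h : IL T x) (h' : IL T y) : IL T (x - y) := fun t ht => by
  rw [mul_sub, h t ht, h' t ht, sub_zero]

theorem step_awc {u e : B} (hu : AWC u) (he : IsProjection e) (hue : u * e = 0)
    (H : ∀ T : Set B, (∀ x, IL T x → (u + e) * x = x) → (∀ x, IL T x → e * x = 0 → x = 0) →
      ∃ E, Ann T E) : AWC (u + e) := by
  have heu := orth_symm hu.1 he hue
  have pue := pj_add hu.1 he hue
  refine ⟨pue, fun S hS => ?_⟩
  obtain ⟨E', hE'⟩ := hu.2 ((fun s => s * u) '' S) (by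
    rintro _ ⟨s, hs, rfl⟩; simp only; rw [mul_assoc, hu.1.2])
  have Eu : E' * u = E' := hE'.le (by rintro _ ⟨s, hs, rfl⟩; simp only; rw [mul_assoc, hu.1.2])
  have uE := le_symm hE'.1 hu.1 Eu
  have pp := pj_sub hE'.1 hu.1 Eu
  set p := u - E' with hp
  have pu : p * u = p := by rw [hp, sub_mul, hu.1.2, Eu]
  have up : u * p = p := by rw [hp, mul_sub, hu.1.2, uE]
  have sp : ∀ s ∈ S, s * p = 0 := by
    intro s hs
    have := (hE'.2 p).2 (by rw [hp, mul_sub, hE'.1.2, Eu, sub_self]) _ ⟨s, hs, rfl⟩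
    simp only at this
    rwa [mul_assoc, up] at this
  have px : ∀ x, u * x = x → (∀ s ∈ S, s * x = 0) → p * x = x := by
    intro x hx hs
    have := (hE'.2 x).1 (by rintro _ ⟨s, hs', rfl⟩; simp only; rw [mul_assoc, hx, hs s hs'])
    rw [hp, sub_mul, this, hx, sub_zero]
  have hT : ∀ x, IL (S ∪ {p, 1 - (u + e)}) x ↔ (∀ s ∈ S, s * x = 0) ∧ p * x = 0 ∧ (u + e) * x = x := by
    intro x
    simp only [IL, Set.mem_union, Set.mem_insert_iff, Set.mem_singleton_iff]
    constructor
    · intro h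
      refine ⟨fun s hs => h s (Or.inl hs), h p (Or.inr (Or.inl rfl)), ?_⟩
      have := h _ (Or.inr (Or.inr rfl))
      rw [sub_mul, one_mul, sub_eq_zero] at this; exact this.symm
    · rintro ⟨h1, h2, h3⟩ t (ht | rfl | rfl)
      · exact h1 t ht
      · exact h2
      · rw [sub_mul, one_mul, h3, sub_self]
  obtain ⟨E, hE⟩ := H (S ∪ {p, 1 - (u + e)}) (fun x hx => ((hT x).1 hx).2.2) (fun x hx hex => by
    obtain ⟨h1, h2, h3⟩ := (hT x).1 hx
    rw [add_mul, hex, add_zero] at h3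
    rw [px x h3 h1] at h2; exact h2)
  have hE2 : ∀ x, E * x = 0 ↔ (∀ s ∈ S, s * x = 0) ∧ p * x = 0 ∧ (u + e) * x = x := fun x => by
    rw [← hT, ← hE.2]; rfl
  obtain ⟨q1, q2, q3⟩ := (hE2 (1 - E)).1 (by rw [mul_sub, mul_one, hE.1.2, sub_self])
  have pE := pj_compl hE.1
  set E0 := 1 - E with hE0
  have q4 := orth_symm pp pE q2
  have q5 := le_symm' pE pue q3
  have e1 : (u + e) * p = p := by rw [add_mul, up, ← up, ← mul_assoc, heu, zero_mul, add_zero]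
  have e2 := le_symm' pp pue e1
  have e3 : E0 * ((u + e) - p) = E0 := by rw [mul_sub, q5, q4, sub_zero]
  refine ⟨(u + e) - p - E0, pj_sub pE (pj_sub pp pue e2) e3, fun x => ⟨fun hx => ?_, fun hx s hs => ?_⟩⟩
  · have h1 : E * ((u + e) * x - p * x) = 0 := by
      refine (hE2 _).2 ⟨fun s hs => ?_, ?_, ?_⟩
      · rw [mul_sub, ← mul_assoc, ← mul_assoc, sp s hs, hS s hs, hx s hs]; simp
      · rw [mul_sub, ← mul_assoc, ← mul_assoc, e2, pp.2, sub_self]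
      · rw [mul_sub, ← mul_assoc, ← mul_assoc, e1, pue.2]
    have h2 : E0 * ((u + e) * x - p * x) = (u + e) * x - p * x := by
      rw [hE0, sub_mul 1 E, h1, one_mul, sub_zero]
    rw [mul_sub, ← mul_assoc, ← mul_assoc, q5, q4, zero_mul, sub_zero] at h2
    rw [sub_mul, sub_mul (u+e), h2, sub_self]
  · rw [sub_mul, sub_mul (u+e), sub_eq_zero, sub_eq_iff_eq_add] at hx
    rw [← hS s hs, mul_assoc, hx, mul_add, ← mul_assoc, ← mul_assoc, q1 s hs, sp s hs]; simp

theorem ab_comm {f a b : B} (hf : IsAbelianProj f) (ha : f * a = a) (ha' : a * f = a) (hb : f * b = b)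
    (hb' : b * f = b) : a * b = b * a := by
  have := hf.2 a b
  rwa [ha, ha', hb, hb'] at this

theorem ab_cc {f f1 c : B} (hf : IsAbelianProj f) (h1 : IsProjection f1) (hle : f1 * f = f1) (hc : CC f1 c) :
    c * f = f1 := by
  have hle' := le_symm h1 hf.1 hle
  have h2 := (hc.2 (f - f1)).1 (fun b => by
    have h3 := ab_comm (a := f * b * f) (b := f - f1) hf (by rw [← mul_assoc, ← mul_assoc, hf.1.2])
      (by rw [mul_assoc, hf.1.2]) (by rw [mul_sub, hf.1.2, hle']) (by rw [sub_mul, hf.1.2, hle])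
    have h4 : f1 * (f * b * f * (f - f1)) = f1 * b * (f - f1) := by
      calc _ = (f1 * f) * b * (f * (f - f1)) := by simp only [mul_assoc]
        _ = _ := by rw [hle, mul_sub, hf.1.2, hle']
    rw [← h4, h3, ← mul_assoc, mul_sub, hle, h1.2, sub_self, zero_mul])
  rw [mul_sub, sub_eq_zero, hc.mul'] at h2; exact h2

/-- nonzero element of the ideal gives a partial isometry -/
theorem IL_pi {T : Set B} {x y e f : B} (hf : AWC f) (he : e = y * star y) (yf : y * f = y)
    (hinj : ∀ x, IL T x → e * x = 0 → x = 0) (hx : IL T x) (h0 : x ≠ 0) :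
    ∃ w, w ≠ 0 ∧ w * (star w * w) = w ∧ w * f = w ∧ IL T w ∧ ∃ b, w = x * b := by
  have h1 : x * (star x * y) ≠ 0 := by
    intro h
    apply h0
    refine hinj x hx ?_
    have : star y * x = 0 := by
      apply z2
      rw [star_mul, star_star, mul_assoc, h, mul_zero]
    rw [he, mul_assoc, this, mul_zero]
  obtain ⟨w, w0, w1, w2, -, b, hb⟩ := II1 (e := 1) hf (one_mul _) (by rw [mul_assoc, mul_assoc, yf]) h1
  refine ⟨w, w0, w1, w2, ?_, star x * y * b, by rw [hb]; simp only [mul_assoc]⟩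
  rw [hb]; exact (hx.mul _).mul _

theorem step_b {κ : Type*} [Fintype κ] {u0 : B} {v : κ → B} (h : Sys u0 v) {u y f : B} (hu : AWC u)
    (hf : AWC f) (hab : IsAbelianProj f) (hy : IsProjection (y * star y)) (yf : y * f = y) (hue : u * (y * star y) = 0) :
    AWC (u + y * star y) := by
  have fy := st yf
  rw [hf.1.1] at fy
  refine step_awc hu hy hue fun T hT1 hinj => h.LG T fun z hz z0 => ?_
  have zT : ∀ z : B, IsCentralProj z → ∀ x, (∀ s ∈ (fun s => z * s) '' T, s * x = 0) ↔ IL T (z * x) := by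
    intro z hz x
    constructor
    · intro h t ht
      rw [cz_l hz, ← mul_assoc]; exact h _ ⟨t, ht, rfl⟩
    · rintro h _ ⟨t, ht, rfl⟩
      simp only; rw [mul_assoc, ← cz_l hz]; exact h t ht
  by_cases hzL : ∀ x, IL T x → z * x = 0
  · refine ⟨z, hz, z0, hz.1.2, z, hz.1, fun x => ?_⟩
    rw [zT z hz]
    constructor
    · intro k; have := hzL _ k; rwa [cz_zz hz] at this
    · intro k; rw [k]; intro t _; simp
  push Not at hzL
  obtain ⟨x, hx, hzx⟩ := hzL
  have hzx' : IL T (z * x) := by rw [hz.2]; exact hx.mul z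
  obtain ⟨w, w0, w1, wf, wL, b, hb⟩ := IL_pi hf rfl yf hinj hzx' hzx
  have zw : z * w = w := by rw [hb, mul_assoc, cz_zz hz]
  have pf1 := pi_src w1
  obtain ⟨c, hc⟩ := h.ca (star w * w)
  have cw : c * w = w := by rw [hc.1.2, ← w1, mul_assoc, hc.mul]
  have wc : star w * c = star w := by have := st cw; rwa [hc.1.1.1] at this
  have cf : c * f = star w * w := ab_cc hab pf1 (by rw [mul_assoc, wf]) hc
  have f10 : star w * w ≠ 0 := fun k => w0 (z1 k)
  refine ⟨c, hc.1, hc.ne_zero f10, hc.le hz (by rw [mul_assoc, ← hz.2, zw]), c - w * star w,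
    pj_sub (pi_rng w1) hc.1.1 (by rw [mul_assoc, wc]), fun x => ?_⟩
  rw [zT c hc.1, sub_mul, sub_eq_zero]
  refine ⟨fun hcx => ?_, fun k => by rw [k, mul_assoc]; exact wL.mul _⟩
  by_contra hne
  replace hne := sub_ne_zero.2 hne
  have hx' : IL T (c * x - w * star w * x) := hcx.sub (by rw [mul_assoc]; exact wL.mul _)
  have wx : star w * (c * x - w * star w * x) = 0 := by
    rw [mul_sub, ← mul_assoc, wc, ← mul_assoc, pi_star w1, sub_self]
  have cx : c * (c * x - w * star w * x) = c * x - w * star w * x := by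
    rw [mul_sub, cz_zz hc.1, ← mul_assoc, ← mul_assoc, cw]
  obtain ⟨w2, w20, w21, w2f, w2L, b2, hb2⟩ := IL_pi hf rfl yf hinj hx' hne
  have ww2 : star w * w2 = 0 := by rw [hb2, ← mul_assoc, wx, zero_mul]
  have cw2 : c * w2 = w2 := by rw [hb2, ← mul_assoc, cx]
  have fw : f * star w = star w := by have := st wf; rwa [hf.1.1] at this
  have fw2 : f * star w2 = star w2 := by have := st w2f; rwa [hf.1.1] at this
  -- β = y* w, δ = y* w2
  have c1 : (star y * w * (star w * y)) * (star y * w2) = star y * w2 * (star w * y * (star y * w)) := by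
    have k1 := ab_comm (a := star y * w) (b := star w * y) hab (by rw [← mul_assoc, fy]) (by rw [mul_assoc, wf])
      (by rw [← mul_assoc, fw]) (by rw [mul_assoc, yf])
    rw [← k1]
    exact ab_comm hab (by simp only [← mul_assoc]; rw [fy]) (by simp only [mul_assoc]; rw [yf]) (by rw [← mul_assoc, fy])
      (by rw [mul_assoc, w2f])
  have c2 : w * (star w * y * (star y * w2)) - w2 * (star w * y * (star y * w)) = 0 := by
    refine hinj _ ((wL.mul _).sub (w2L.mul _)) ?_
    rw [mul_assoc y, mul_sub]
    rw [show star y * (w * (star w * y * (star y * w2))) = (star y * w * (star w * y)) * (star y * w2) by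
      simp only [mul_assoc], c1]
    rw [mul_assoc (star y) w2, sub_self, mul_zero]
  have c3 : star w2 * w2 * (star w * y * (star y * w)) = 0 := by
    rw [sub_eq_zero] at c2
    rw [mul_assoc, ← c2, ← mul_assoc]
    have := st ww2; rw [star_star, star_zero] at this
    rw [this, zero_mul]
  have c4 : star y * (w * (star w2 * w2)) = 0 := by
    apply z1
    simp only [star_mul, star_star]
    calc star w2 * w2 * star w * y * (star y * (w * (star w2 * w2)))
        = star w2 * w2 * (star w * y * (star y * w)) * (star w2 * w2) := by simp only [mul_assoc]
      _ = 0 := by rw [c3, zero_mul]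
  have c5 : w * (star w2 * w2) = 0 := by
    refine hinj _ (wL.mul _) ?_
    rw [mul_assoc y, c4, mul_zero]
  apply w20
  have c6 : c * f * (star w2 * w2) = star w2 * w2 := by
    rw [mul_assoc, ← mul_assoc f, fw2, ← mul_assoc, hc.1.2, mul_assoc, cw2]
  rw [cf, mul_assoc, c5, mul_zero] at c6
  exact z1 c6.symm

theorem GS {ι : Type*} {p F : B} {x : ι → B} (hp : AWC p) (hF : AWC F) (hA : AddP F p)
    (xF : ∀ i, x i * F = x i) (px : ∀ i, p * x i = x i) (ox : ∀ i j, i ≠ j → x i * star (x j) = 0) :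
    ∃ q, q * p = q ∧ Ann (Set.range fun i => star (x i)) q ∧ SubE q F := by
  have xp : ∀ i, star (x i) * p = star (x i) := fun i => by have := st (px i); rwa [hp.1.1] at this
  let r : ι → ι → Prop := WellOrderingRel
  have hw : IsWellOrder ι r := WellOrderingRel.isWellOrder
  choose q hq using fun i => hp.2 ((fun j => star (x j)) '' {j | r j i}) (by rintro _ ⟨j, -, rfl⟩; exact xp j)
  have qp : ∀ i, q i * p = q i := fun i => (hq i).le (by rintro _ ⟨j, -, rfl⟩; exact xp j)
  have pq : ∀ i, p * q i = q i := fun i => le_symm (hq i).1 hp.1 (qp i)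
  have qx : ∀ i j, r j i → q i * x j = x j := fun i j hji => by
    have := st ((hq i).mul_self ⟨j, hji, rfl⟩)
    simpa [(hq i).1.1] using this
  have ql : ∀ i y, (∀ j, r j i → y * x j = 0) → y * q i = 0 := fun i y h => by
    refine ((hq i).left y).1 ?_
    rintro _ ⟨j, hj, rfl⟩; simp only [star_star]; exact h j hj
  have pw : ∀ i, p * ((1 - q i) * x i) = (1 - q i) * x i := fun i => by
    rw [sub_mul, one_mul, mul_sub, ← mul_assoc, pq, px]
  choose k hk using fun i => hF.2 {(1 - q i) * x i} (by
    simp only [Set.mem_singleton_iff, forall_eq]; rw [mul_assoc, xF])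
  have kF : ∀ i, k i * F = k i := fun i => (hk i).le (by
    simp only [Set.mem_singleton_iff, forall_eq]; rw [mul_assoc, xF])
  choose w w1 w2 w3 using fun i => PL hF (x := (1 - q i) * x i) (by rw [mul_assoc, xF]) (hk i) hp.1 (pw i)
    (hA.mono (kF i) hp.1.2)
  have wk : ∀ i, w i * k i = w i := fun i => pi_of_pj (hk i).1 (w1 i)
  have kw : ∀ i, k i * star (w i) = star (w i) := fun i => by have := st (wk i); rwa [(hk i).1.1] at this
  have wF : ∀ i, w i * F = w i := fun i => by rw [← wk i, mul_assoc, kF]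
  have kk : ∀ i j, i ≠ j → k i * k j = 0 := by
    intro i j hij
    have h1 : k i * star ((1 - q j) * x j) = 0 := by
      refine ((hk i).2 _).1 ?_
      simp only [Set.mem_singleton_iff, forall_eq]
      rw [star_mul, mul_assoc, ← mul_assoc (x i), ox i j hij]; simp
    have h2 := st h1
    simp only [star_star, (hk i).1.1, star_zero] at h2
    have h3 := ((hk j).2 (k i)).1 (by simpa using h2)
    exact orth_symm (hk j).1 (hk i).1 h3
  have ww1 : ∀ i j, i ≠ j → w i * star (w j) = 0 := fun i j hij => by
    rw [← wk i, ← kw j, mul_assoc, ← mul_assoc (k i), kk i j hij]; simp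
  have ww2 : ∀ i j, r j i → star (w j) * w i = 0 := by
    intro i j hji
    have h1 : q i * w i = 0 := (w3 i _).1 (by
      rw [← mul_assoc, mul_sub, mul_one, (hq i).1.2, sub_self, zero_mul])
    have h2 : (1 - q i) * w j = 0 := (w3 j _).1 (by
      have h3 : (1 - q i) * q j = 0 := ql j _ fun l hl => by
        rw [sub_mul, one_mul, qx i l (trans_of r hl hji), sub_self]
      rw [← mul_assoc, mul_sub, h3, mul_one, sub_zero, sub_mul, one_mul, qx i j hji, sub_self])
    have h3 := st h2
    rw [star_zero, star_sub, star_one, (hq i).1.1, mul_sub, mul_one, sub_eq_zero] at h3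
    rw [h3, mul_assoc, h1, mul_zero]
  have ww3 : ∀ i j, i ≠ j → star (w i) * w j = 0 := by
    intro i j hij
    rcases trichotomous_of r i j with h1 | h1 | h2
    · exact ww2 j i h1
    · exact absurd h1 hij
    · have := st (ww2 i j h2); simpa using this
  obtain ⟨V, hV⟩ := hA.fam w (fun i => by rw [w1, wk]) (fun i j hij => ⟨ww3 i j hij, ww1 i j hij⟩) (fun i => ⟨wF i, w2 i⟩)
  have eqv : ∀ y, (∀ i, y * x i = 0) ↔ ∀ i, y * w i = 0 := by
    intro y
    constructor
    · intro h i
      refine (w3 i y).1 ?_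
      rw [← mul_assoc, mul_sub, mul_one, sub_mul, h i, ql i y fun j _ => h j]; simp
    · intro h i
      induction i using hw.wf.induction with
      | _ i ih =>
        have h1 := ql i y ih
        have h2 := (w3 i y).2 (h i)
        rw [← mul_assoc, mul_sub, mul_one, h1, sub_zero] at h2
        exact h2
  refine ⟨V * star V, ?_, ⟨pi_rng hV.pi, fun t => ?_⟩, star V, by simp, ?_⟩
  · have : p * V = V := hV.le_rng hp.1.1 (by rintro _ ⟨i, rfl⟩; exact w2 i)
    have := st this
    rw [hp.1.1] at this
    rw [mul_assoc, this]
  · have h1 := eqv (star t)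
    have h2 := hV.rng t
    have e1 : (∀ s ∈ Set.range (fun i => star (x i)), s * t = 0) ↔ ∀ i, star t * x i = 0 := by
      simp only [Set.forall_mem_range]
      refine forall_congr' fun i => ⟨fun h => by have := st h; simpa using this, fun h => by
        have := st h; simpa using this⟩
    have e2 : (∀ w' ∈ Set.range w, star w' * t = 0) ↔ ∀ i, star t * w i = 0 := by
      simp only [Set.forall_mem_range]
      refine forall_congr' fun i => ⟨fun h => by have := st h; simpa using this, fun h => by
        have := st h; simpa using this⟩
    rw [e1, h1, ← e2, h2]
    constructor
    · intro h; rw [mul_assoc, h, mul_zero]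
    · intro h
      have := z3 (s := star V) (x := t) (by rw [star_star, ← mul_assoc]; exact h)
      exact this
  · have : V * F = V := hV.le_src (by rintro _ ⟨i, rfl⟩; exact wF i)
    have := st this
    rwa [hF.1.1] at this

end MM

set_option linter.unusedVariables false
set_option linter.unusedSimpArgs false
namespace MM
variable {B : Type*} [CStarAlgebra B]

theorem step_c (hCA : CA B) {u e F F1 F2 a p1 p2 : B} (hu : AWC u) (he : IsProjection e) (hue : u * e = 0)
    (hp1 : IsProjection p1) (hp2 : IsProjection p2) (hp12 : p1 * p2 = 0) (hp : p1 + p2 = u)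
    (hF : IsProjection F) (Fu : F * u = F) (A1 : AddP F p1) (A2 : AddP F p2)
    (hF1 : IsProjection F1) (hF2 : IsProjection F2) (ha : IsProjection a)
    (o12 : F1 * F2 = 0) (o1 : F1 * a = 0) (o2 : F2 * a = 0) (l1 : p1 * F1 = F1) (l2 : p1 * F2 = F2) (l3 : p1 * a = a)
    (s1 : SubE F F1) (s2 : SubE F F2) (s3 : SubE e a) (s4 : SubE e F)
    (fin : ∀ z, IsCentralProj z → SubE (z * F) (z * e) → z * e = 0) : AWC (u + e) := by
  have p1u : p1 * u = p1 := by rw [← hp, mul_add, hp1.2, hp12, add_zero]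
  have p2u : p2 * u = p2 := by rw [← hp, mul_add, hp2.2, orth_symm hp1 hp2 hp12, zero_add]
  have up1 := le_symm hp1 hu.1 p1u
  refine step_awc hu he hue fun T hT1 hinj => ?_
  obtain ⟨W, hW, hW1, hmax⟩ := exists_max_OPI (fun w => IL T w ∧ w * F = w)
  have aF := hu.sub hF Fu
  have GSp : ∀ p, IsProjection p → p * u = p → AddP F p → ∃ q, q * p = q ∧
      Ann (Set.range fun w : W => star (p * w.1)) q ∧ SubE q F := fun p hp hpu hA => by
    refine GS (hu.sub hp hpu) aF hA (fun w => by rw [mul_assoc, (hW1 w w.2).2.2]) (fun w => by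
      rw [← mul_assoc, hp.2]) (fun w w' hne => ?_)
    rw [star_mul, mul_assoc, ← mul_assoc w.1, (hW.2 w w.2 w' w'.2 (fun k => hne (Subtype.ext k))).2]; simp
  obtain ⟨q1, q1p, hq1, sq1⟩ := GSp p1 hp1 p1u A1
  obtain ⟨q2, q2p, hq2, sq2⟩ := GSp p2 hp2 p2u A2
  have q12 : q1 * q2 = 0 := by
    rw [← q1p, ← le_symm hq2.1 hp2 q2p, mul_assoc, ← mul_assoc p1, hp12]; simp
  have qe : ∀ q p, p * u = p → q * p = q → q * e = 0 := fun q p h1 h2 => by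
    rw [← h2, ← h1, mul_assoc, mul_assoc, hue]; simp
  have q12e : (q1 + q2) * e = 0 := by rw [add_mul, qe q1 p1 p1u q1p, qe q2 p2 p2u q2p, add_zero]
  have hG : IsProjection (q1 + q2 + e) := pj_add (pj_add hq1.1 hq2.1 q12) he q12e
  have sG : SubE (q1 + q2 + e) p1 := by
    have h1 : SubE (q1 + q2 + e) (F1 + F2 + a) :=
      ((sq1.trans s1).add (sq2.trans s2) hF1 hF2 o12).add s3 (pj_add hF1 hF2 o12) ha (by rw [add_mul, o1, o2, add_zero])
    refine h1.trans (SubE.of_le (pj_add (pj_add hF1 hF2 o12) ha (by rw [add_mul, o1, o2, add_zero])) ?_)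
    rw [mul_add, mul_add, l1, l2, l3]
  set G := q1 + q2 + e with hGd
  have aG : AWC G := by
    obtain ⟨g, g1, g2⟩ := sG
    exact hu.of_equiv (f := 0) hG g1 (by rw [← g2, ← mul_assoc, up1])
  have Gw : ∀ w ∈ W, G * w = w := by
    intro w hw
    have h1 := st (hq1.mul_self ⟨⟨w, hw⟩, rfl⟩)
    have h2 := st (hq2.mul_self ⟨⟨w, hw⟩, rfl⟩)
    simp only [star_star, hq1.1.1, hq2.1.1] at h1 h2
    rw [← mul_assoc, q1p] at h1
    rw [← mul_assoc, q2p] at h2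
    rw [hGd, add_mul, add_mul, h1, h2, ← add_mul p1, hp, ← add_mul, hT1 w (hW1 w hw).2.1]
  obtain ⟨E0, hE0⟩ := aG.2 (star '' W) (by
    rintro _ ⟨w, hw, rfl⟩; have := st (Gw w hw); rwa [hG.1] at this)
  have E0G : E0 * G = E0 := hE0.le (by
    rintro _ ⟨w, hw, rfl⟩; have := st (Gw w hw); rwa [hG.1] at this)
  have E0w : ∀ w ∈ W, star w * E0 = star w := fun w hw => hE0.mul_self ⟨w, hw, rfl⟩
  have E0L : IL T E0 := fun t ht => (hE0.left t).1 (by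
    rintro _ ⟨w, hw, rfl⟩; rw [star_star]; exact (hW1 w hw).2.1 t ht)
  obtain ⟨k, hk⟩ := aF.2 W (fun w hw => (hW1 w hw).2.2)
  have kF : k * F = k := hk.le (fun w hw => (hW1 w hw).2.2)
  have pa' := pj_sub hk.1 hF kF
  have a'F : (F - k) * F = F - k := by rw [sub_mul, hF.2, kF]
  obtain ⟨c, hc⟩ := hCA (F - k)
  have aE0 := aG.sub hE0.1 E0G
  have wa' : ∀ w ∈ W, w * (F - k) = 0 := fun w hw => by
    rw [mul_sub, (hW1 w hw).2.2, hk.mul_self hw, sub_self]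
  have claim1 : ∀ x, IL T x → E0 * x = 0 → c * x = 0 := by
    intro x hx hEx
    have h1 : c * star x = 0 := by
      refine (hc.2 _).1 fun b => ?_
      by_contra hne
      have hne' : x * star b * (F - k) ≠ 0 := fun h => hne (by
        have := st h; simp only [star_mul, star_star, star_zero, pa'.1] at this
        rw [mul_assoc]; exact this)
      obtain ⟨w, w0, w1, w2, -, y, hy⟩ := II1 (e := 1) (aF.sub pa' a'F) (one_mul _) (by rw [mul_assoc, pa'.2]) hne'
      have hyx : w = x * (star b * (F - k) * y) := by rw [hy]; simp only [mul_assoc]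
      refine w0 (hmax w w1 ⟨by rw [hyx]; exact hx.mul _, ?_⟩ fun w' hw' => ⟨?_, ?_⟩)
      · rw [← w2, mul_assoc, a'F]
      · rw [hyx, ← E0w w' hw', mul_assoc, ← mul_assoc E0, hEx]; simp
      · have := st w2
        rw [pa'.1] at this
        rw [← this, ← mul_assoc, wa' w' hw', zero_mul]
    have := st h1
    rw [star_star, hc.1.1.1, star_zero] at this
    rw [hc.1.2, this]
  have claim2 : (1 - c) * e = 0 := by
    refine fin _ (cz_compl hc.1) ?_
    have AG : AddP F G := by
      obtain ⟨g, g1, g2⟩ := sG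
      exact A1.room hG g1 g2
    obtain ⟨V, hV⟩ := AG W hW (fun w hw => ⟨(hW1 w hw).2.2, Gw w hw⟩)
    have Vk : star V * V = k := by
      refine Ann.unique (S := W) ⟨pi_src hV.pi, fun x => ?_⟩ hk
      rw [hV.src]
      exact ⟨fun h => by rw [mul_assoc, h, mul_zero], fun h => z3 (by rw [← mul_assoc]; exact h)⟩
    have VE : E0 * V = V := hV.le_rng hE0.1.1 (fun w hw => by
      have := st (E0w w hw); simpa [hE0.1.1] using this)
    have sk : SubE k E0 := ⟨V, Vk, VE⟩
    have AE : AddP E0 e := by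
      have h1 : AddP F E0 := AG.mono hF.2 (le_symm hE0.1 hG E0G)
      obtain ⟨g, g1, g2⟩ := s4
      exact (h1.symm hF.1 hE0.1.1).room he g1 g2
    obtain ⟨w, w1, w2, -⟩ := PL aE0 (x := e * E0) (by rw [mul_assoc, hE0.1.2]) (e := E0) (F := e) ⟨hE0.1, fun x => by
      simp only [Set.mem_singleton_iff, forall_eq]
      exact ⟨fun h => hinj _ (E0L.mul x) (by rw [← mul_assoc]; exact h), fun h => by rw [mul_assoc, h, mul_zero]⟩⟩
      he (by rw [← mul_assoc, he.2]) AE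
    have s5 := (sk.trans ⟨w, w1, w2⟩).zmul (cz_compl hc.1)
    have : (1 - c) * k = (1 - c) * F := by
      have h := hc.mul'
      have h' : (1 - c) * (F - k) = 0 := by rw [sub_mul, one_mul, h, sub_self]
      rw [mul_sub, sub_eq_zero] at h'
      exact h'.symm
    rwa [this] at s5
  refine ⟨1 - E0, pj_compl hE0.1, fun x => ⟨fun hx => ?_, fun hx t ht => ?_⟩⟩
  · have h1 : IL T (x - E0 * x) := IL.sub hx (E0L.mul x)
    have h2 := claim1 _ h1 (by rw [mul_sub, ← mul_assoc, hE0.1.2, sub_self])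
    have h3 : (1 - c) * (x - E0 * x) = 0 := by
      refine hinj _ (by rw [(cz_compl hc.1).2]; exact h1.mul _) ?_
      rw [← mul_assoc, ← (cz_compl hc.1).2, claim2, zero_mul]
    rw [sub_mul, one_mul, cz_split hc.1 (x - E0 * x), h2, h3, add_zero]
  · rw [sub_mul, one_mul, sub_eq_zero] at hx
    rw [hx]; exact (E0L.mul x) t ht

theorem halve {u e : B} (hu : AWC u) (hN : ∀ f, IsAbelianProj f → f * u = f → f = 0)
    (he : IsProjection e) (heu : e * u = e) :
    ∃ V, e = star V * V + V * star V ∧ V * (star V * V) = V ∧ V * V = 0 ∧ e * V = V ∧ V * e = V := by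
  obtain ⟨W, -, hW, oW, hmax⟩ := exists_max_pw (fun w : B => w * (star w * w) = w ∧ w * w = 0 ∧ e * w = w ∧ w * e = w)
    (fun w w' => (star w * w' = 0 ∧ w * star w' = 0) ∧ w * w' = 0 ∧ w' * w = 0) ∅ (by simp) (by simp)
    (fun w w' h => ⟨⟨by simpa using st h.1.1, by simpa using st h.1.2⟩, h.2.2, h.2.1⟩)
  have ae := hu.sub he heu
  obtain ⟨E1, h1⟩ := ae.2 W (fun w hw => (hW w hw).2.2.2)
  obtain ⟨E2, h2⟩ := ae.2 (star '' W) (by rintro _ ⟨w, hw, rfl⟩; have := st (hW w hw).2.2.1; rwa [he.1] at this)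
  have E1e : E1 * e = E1 := h1.le (fun w hw => (hW w hw).2.2.2)
  have E2e : E2 * e = E2 := h2.le (by rintro _ ⟨w, hw, rfl⟩; have := st (hW w hw).2.2.1; rwa [he.1] at this)
  have wE2 : ∀ w ∈ W, w * E2 = 0 := fun w hw => (h2.left w).1 (by
    rintro _ ⟨w', hw', rfl⟩
    rw [star_star]
    by_cases h : w = w'
    · subst h; exact (hW w hw).2.1
    · exact (oW w hw w' hw' h).2.1)
  have E12 : E1 * E2 = 0 := (h1.2 _).1 wE2
  have E2w : ∀ w ∈ W, E2 * w = w := fun w hw => by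
    have := st (h2.mul_self ⟨w, hw, rfl⟩); simpa [h2.1.1] using this
  have A := orth_add ae h1.1 h2.1 E1e E2e E12
  obtain ⟨V, hV⟩ := A W ⟨fun w hw => (hW w hw).1, fun w hw w' hw' hne => (oW w hw w' hw' hne).1⟩
    (fun w hw => ⟨h1.mul_self hw, E2w w hw⟩)
  have V1 : star V * V = E1 := by
    refine Ann.unique (S := W) ⟨pi_src hV.pi, fun x => ?_⟩ h1
    rw [hV.src]
    exact ⟨fun h => by rw [mul_assoc, h, mul_zero], fun h => z3 (by rw [← mul_assoc]; exact h)⟩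
  have V2 : V * star V = E2 := by
    refine Ann.unique (S := star '' W) ⟨pi_rng hV.pi, fun x => ?_⟩ h2
    rw [Set.forall_mem_image, hV.rng]
    exact ⟨fun h => by rw [mul_assoc, h, mul_zero], fun h => z3 (by rw [star_star, ← mul_assoc]; exact h)⟩
  have EE : IsProjection (E1 + E2) := pj_add h1.1 h2.1 E12
  have EEe : (E1 + E2) * e = E1 + E2 := by rw [add_mul, E1e, E2e]
  have pr := pj_sub EE he EEe
  have hr : e - (E1 + E2) = 0 := by
    set r := e - (E1 + E2) with hr
    have re : r * e = r := by rw [hr, sub_mul, he.2, EEe]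
    have er := le_symm pr he re
    have ar := ae.sub pr re
    have wr : ∀ w ∈ W, w * r = 0 := fun w hw => by
      rw [hr, mul_sub, mul_add, (hW w hw).2.2.2, h1.mul_self hw, wE2 w hw, add_zero, sub_self]
    have rw' : ∀ w ∈ W, r * w = 0 := fun w hw => by
      have : E1 * w = 0 := by rw [← E2w w hw, ← mul_assoc, E12, zero_mul]
      rw [hr, sub_mul, add_mul, (hW w hw).2.2.1, this, E2w w hw, zero_add, sub_self]
    have key : ∀ h, IsProjection h → h * r = h → ∀ b, (r - h) * b * h = 0 := by
      intro h hh hhr b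
      by_contra hne
      have prh := pj_sub hh pr hhr
      obtain ⟨w, w0, w1, w2, w3, -⟩ := II1 (e := r - h) (ar.sub hh hhr) (by rw [← mul_assoc, ← mul_assoc, prh.2])
        (by rw [mul_assoc, hh.2]) hne
      have hrh : h * (r - h) = 0 := by rw [mul_sub, hhr, hh.2, sub_self]
      have rrh : r * (r - h) = r - h := by rw [mul_sub, pr.2, le_symm hh pr hhr]
      have rw1 : r * w = w := by rw [← w3, ← mul_assoc, rrh]
      have wr1 : w * r = w := by rw [← w2, mul_assoc, hhr]
      have hm := hmax w ⟨w1, by rw [← w2, mul_assoc, ← w3, ← mul_assoc h, ← mul_assoc h, hrh]; simp,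
        by rw [← rw1, ← mul_assoc, er], by rw [← wr1, mul_assoc, re]⟩ (fun w' hw' => by
          refine ⟨⟨?_, ?_⟩, ?_, ?_⟩
          · have := st rw1; rw [pr.1] at this
            rw [← this, mul_assoc, rw' w' hw', mul_zero]
          · have := st (wr w' hw'); rw [pr.1, star_zero] at this
            rw [← wr1, mul_assoc, this, mul_zero]
          · rw [← wr1, mul_assoc, rw' w' hw', mul_zero]
          · rw [← rw1, ← mul_assoc, wr w' hw', zero_mul])
      have := wr w hm
      rw [wr1] at this; exact w0 this
    have key2 : ∀ h, IsProjection h → h * r = h → ∀ x, r * x = x → x * r = x → h * x = x * h := by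
      intro h hh hhr x hx hx'
      have k1 := key h hh hhr x
      have k2 := st (key h hh hhr (star x))
      simp only [star_mul, star_star, star_sub, star_zero, hh.1, pr.1] at k2
      rw [sub_mul, hx, sub_mul, sub_eq_zero] at k1
      rw [mul_sub, hx', mul_sub, sub_eq_zero] at k2
      exact k2.trans (by rw [← mul_assoc]; exact k1.symm)
    refine hN r ⟨pr, fun a b => ?_⟩ (by rw [← re, mul_assoc, heu])
    have c1 : ∀ a, r * (r * a * r) = r * a * r := fun a => by rw [← mul_assoc, ← mul_assoc, pr.2]
    have c2 : ∀ a, (r * a * r) * r = r * a * r := fun a => by rw [mul_assoc, pr.2]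
    refine comm_proj ar (c2 a) (c1 a) (by rw [c1, c2]) fun p hp hpr _ => key2 p hp hpr _ (c1 b) (c2 b)
  rw [sub_eq_zero] at hr
  refine ⟨V, by rw [V1, V2, hr], hV.pi, ?_, hV.le_rng he.1 (fun w hw => (hW w hw).2.2.1), hV.le_src (fun w hw => (hW w hw).2.2.2)⟩
  have a1 : V * E1 = V := by rw [← V1, hV.pi]
  have a2 : E2 * V = V := by rw [← V2, mul_assoc, hV.pi]
  rw [← a1, mul_assoc, ← a2, ← mul_assoc E1, ← mul_assoc E1, E12]; simp

end MM

set_option linter.unusedVariables false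
set_option linter.unusedSimpArgs false
namespace MM
variable {B : Type*} [CStarAlgebra B]

theorem inf_prod (ι : Type*) [Infinite ι] : Nonempty (ι × Fin 8 ≃ ι) := by
  have h : Cardinal.aleph0 ≤ Cardinal.mk ι := Cardinal.aleph0_le_mk ι
  have : Cardinal.mk (ι × Fin 8) = Cardinal.mk ι := by
    rw [Cardinal.mk_prod]
    simp only [Cardinal.lift_uzero, Cardinal.mk_fin, Cardinal.lift_natCast]
    exact Cardinal.mul_eq_left h ((Cardinal.natCast_le_aleph0 (n := 8)).trans h) (by norm_num)
  exact Cardinal.eq.1 this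

theorem ABS {ι : Type*} [Infinite ι] {p f t : B} (hp : AWC p) (hf : IsProjection f) {w : ι → B}
    (h1 : ∀ i, star (w i) * w i = f) (h2 : ∀ i, p * w i = w i) (h3 : ∀ i j, i ≠ j → star (w i) * w j = 0)
    (ht : IsProjection t) (htp : t * p = t) (htw : ∀ i, t * w i = 0)
    (hA : Ann (Set.range fun i => w i * star (w i)) (p - t)) (hs : SubE t f) :
    ∃ P P2, IsProjection P ∧ IsProjection P2 ∧ P * P2 = 0 ∧ p * P = P ∧ p * P2 = P2 ∧ SubE p P ∧ SubE p P2 := by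
  obtain ⟨g⟩ := inf_prod ι
  have pw : ∀ i, IsProjection (w i * star (w i)) := fun i => pi_rng (pi3 hf (h1 i))
  have wp : ∀ i, w i * star (w i) * p = w i * star (w i) := fun i => by
    have := st (h2 i); rw [hp.1.1] at this; rw [mul_assoc, this]
  have ow : ∀ i j, i ≠ j → (w i * star (w i)) * (w j * star (w j)) = 0 := fun i j hij => by
    rw [mul_assoc, ← mul_assoc (star (w i)), h3 i j hij, zero_mul, mul_zero]
  have eqv : ∀ i j, ProjEquiv (w i * star (w i)) (w j * star (w j)) := fun i j => by
    refine ⟨w j * star (w i), ?_, ?_⟩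
    · rw [star_mul, star_star, mul_assoc, ← mul_assoc (star (w j)), h1, ← mul_assoc, pi_of_pj hf (h1 i)]
    · rw [star_mul, star_star, mul_assoc, ← mul_assoc (star (w i)), h1, ← mul_assoc, pi_of_pj hf (h1 j)]
  have ex : ∀ X : Set ι, ∃ c, Ann ((fun i => w i * star (w i)) '' X) c := fun X => hp.2 _ (by
    rintro _ ⟨i, -, rfl⟩; exact wp i)
  choose c hc using ex
  have cp : ∀ X, c X * p = c X := fun X => (hc X).le (by rintro _ ⟨i, -, rfl⟩; exact wp i)
  have pc : ∀ X, p * c X = c X := fun X => le_symm (hc X).1 hp.1 (cp X)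
  have cw : ∀ X, ∀ i ∈ X, c X * (w i * star (w i)) = w i * star (w i) := fun X i hi =>
    le_symm (pw i) (hc X).1 ((hc X).mul_self ⟨i, hi, rfl⟩)
  have oc : ∀ X Y, Disjoint X Y → c X * c Y = 0 := fun X Y hXY => by
    refine ((hc X).2 _).1 ?_
    rintro _ ⟨i, hi, rfl⟩
    refine ((hc Y).left _).1 ?_
    rintro _ ⟨j, hj, rfl⟩
    dsimp only
    rw [(pw j).1, ow i j (fun h => Set.disjoint_left.1 hXY hi (h ▸ hj))]
  let X : Finset (Fin 8) → Set ι := fun K => {i | (g.symm i).2 ∈ K}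
  have dX : ∀ K K' : Finset (Fin 8), Disjoint K K' → Disjoint (X K) (X K') := fun K K' h =>
    Set.disjoint_left.2 fun i hi hi' => Finset.disjoint_left.1 h hi hi'
  have sub1 : ∀ K k, k ∉ K → SubE (c (X K)) (c (X {k})) := fun K k hk => by
    have o := oc _ _ (dX K {k} (by simpa using hk))
    refine add_sub (orth_add hp (hc _).1 (hc _).1 (cp _) (cp _) o) (hc _).1 (fun i : X K => w i * star (w i))
      (fun i : X K => w (g (i, k)) * star (w (g (i, k)))) (fun i => pw i) (fun i j hij => ow _ _ fun h => hij (Subtype.ext h))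
      (fun i j hij => ow _ _ fun h => hij (Subtype.ext (by simpa using h))) (fun i => eqv _ _) ?_ (fun i => cw _ _ (by simp [X]))
    have := hc (X K)
    rwa [Set.image_eq_range] at this
  have sub2 : ∀ k, SubE t (c (X {k})) := fun k => by
    obtain ⟨i⟩ : Nonempty ι := inferInstance
    refine hs.trans ⟨w (g (i, k)), h1 _, ?_⟩
    have := cw (X {k}) (g (i, k)) (by simp [X])
    have h4 := congrArg (· * w (g (i,k))) this
    simp only [mul_assoc, h1, pi_of_pj hf (h1 _)] at h4
    exact h4
  have dec : p = (c (X {0,1,2,3}) + c (X {4,5,6,7})) + t := by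
    have o := oc _ _ (dX {0,1,2,3} {4,5,6,7} (by decide))
    have h5 : Ann (Set.range fun i => w i * star (w i)) (c (X {0,1,2,3}) + c (X {4,5,6,7})) := by
      refine ⟨pj_add (hc _).1 (hc _).1 o, fun x => ?_⟩
      rw [Set.forall_mem_range]
      have e1 : (∀ i, w i * star (w i) * x = 0) ↔ c (X {0,1,2,3}) * x = 0 ∧ c (X {4,5,6,7}) * x = 0 := by
        rw [← (hc _).2, ← (hc _).2, Set.forall_mem_image, Set.forall_mem_image]
        refine ⟨fun h => ⟨fun i _ => h i, fun i _ => h i⟩, fun h i => ?_⟩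
        have : ∀ k : Fin 8, k ∈ ({0,1,2,3} : Finset (Fin 8)) ∨ k ∈ ({4,5,6,7} : Finset (Fin 8)) := by decide
        rcases this (g.symm i).2 with h' | h'
        · exact h.1 h'
        · exact h.2 h'
      rw [e1]
      refine ⟨fun h => by rw [add_mul, h.1, h.2, add_zero], fun h => ?_⟩
      have a1 := congrArg (c (X {0,1,2,3}) * ·) h
      have a2 := congrArg (c (X {4,5,6,7}) * ·) h
      simp only [add_mul, mul_add, ← mul_assoc, (hc _).1.2, o, orth_symm (hc _).1 (hc _).1 o, zero_mul, mul_zero, add_zero, zero_add] at a1 a2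
      exact ⟨a1, a2⟩
    rw [← hA.unique h5]; abel
  have mk : ∀ k1 k2 k3, k1 ∉ ({0,1,2,3} : Finset (Fin 8)) → k2 ∉ ({4,5,6,7} : Finset (Fin 8)) → k1 ≠ k2 → k1 ≠ k3 → k2 ≠ k3 →
      IsProjection (c (X {k1}) + c (X {k2}) + c (X {k3})) ∧ SubE p (c (X {k1}) + c (X {k2}) + c (X {k3})) := by
    intro k1 k2 k3 a1 a2 a3 a4 a5
    have o1 := oc _ _ (dX {k1} {k2} (by simpa using a3))
    have o2 := oc _ _ (dX {k1} {k3} (by simpa using a4))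
    have o3 := oc _ _ (dX {k2} {k3} (by simpa using a5))
    have q := pj_add (hc _).1 (hc _).1 o1
    have o4 : (c (X {k1}) + c (X {k2})) * c (X {k3}) = 0 := by rw [add_mul, o2, o3, add_zero]
    refine ⟨pj_add q (hc _).1 o4, ?_⟩
    have := ((sub1 _ _ a1).add (sub1 _ _ a2) (hc _).1 (hc _).1 o1).add (sub2 k3) q (hc _).1 o4
    rwa [← dec] at this
  obtain ⟨q1, s1⟩ := mk 4 0 1 (by decide) (by decide) (by decide) (by decide) (by decide)
  obtain ⟨q2, s2⟩ := mk 5 2 3 (by decide) (by decide) (by decide) (by decide) (by decide)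
  have o : ∀ k k' : Fin 8, k ≠ k' → c (X {k}) * c (X {k'}) = 0 := fun k k' h => oc _ _ (dX _ _ (by simpa using h))
  refine ⟨_, _, q1, q2, ?_, ?_, ?_, s1, s2⟩
  · simp only [add_mul, mul_add]
    rw [o 4 5 (by decide), o 4 2 (by decide), o 4 3 (by decide), o 0 5 (by decide), o 0 2 (by decide), o 0 3 (by decide), o 1 5 (by decide), o 1 2 (by decide), o 1 3 (by decide)]
    simp
  · simp only [mul_add, pc]
  · simp only [mul_add, pc]

theorem abs_sum {κ : Type*} {p P P2 : B} {v : κ → B} (hp : IsProjection p) (hP : IsProjection P) (hP2 : IsProjection P2)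
    (o : P * P2 = 0) (l1 : p * P = P) (l2 : p * P2 = P2) (s1 : SubE p P) (s2 : SubE p P2)
    (hv : ∀ j, star (v j) * v j = p) (s : Finset κ) : SubE (∑ j ∈ s, v j * star (v j)) p := by
  classical
  induction s using Finset.induction_on with
  | empty => exact ⟨0, by simp, by simp⟩
  | insert j s hj ih =>
    rw [Finset.sum_insert hj]
    have : SubE (v j * star (v j)) p := ⟨star (v j), by rw [star_star], by
      have := st (pi_of_pj hp (hv j)); rwa [hp.1] at this⟩
    refine ((this.trans s1).add (ih.trans s2) hP hP2 o).trans (SubE.of_le (pj_add hP hP2 o) (by rw [mul_add, l1, l2]))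

def InfI (p : B) : Prop := ∃ (c : B) (x : ℕ → B), IsProjection c ∧ c ≠ 0 ∧ (∀ n, star (x n) * x n = c) ∧
  (∀ n m, n ≠ m → star (x n) * x m = 0) ∧ ∀ n, p * x n = x n

theorem Sys.sumz {κ : Type*} [Fintype κ] {u0 : B} {v : κ → B} (h : Sys u0 v) {z : B} (hz : IsCentralProj z) :
    ∑ j, (z * v j) * star (z * v j) = z := by
  simp only [cz_s hz, cz_m hz]
  rw [← Finset.mul_sum, h.sum, mul_one]

/-- cutting down the EX data by a central projection -/
theorem EXz {p f : B} (hCA : CA B) (hp : AWC p) (hf : AWC f) (f0 : f ≠ 0) (W0 : Set B) (n0 : W0.Nonempty) (fp : f * p = f)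
    (h1 : ∀ w ∈ W0, star w * w = f ∧ p * w = w) (hfW : f ∈ W0 ∨ ∃ w ∈ W0, f = w * star w)
    (h2 : ∀ w ∈ W0, ∀ w' ∈ W0, w ≠ w' → star w * w' = 0) :
    ∃ W : Set B, ∃ t z : B, W0 ⊆ W ∧ (∀ w ∈ W, star w * w = f ∧ p * w = w) ∧
      (∀ w ∈ W, ∀ w' ∈ W, w ≠ w' → star w * w' = 0) ∧ IsProjection t ∧ t * p = t ∧ (∀ w ∈ W, t * w = 0) ∧
      Ann (Set.range fun w : W => (z * w) * star (z * w)) (z * p - z * t) ∧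
      IsCentralProj z ∧ z * f ≠ 0 ∧ SubE (z * t) (z * f) := by
  obtain ⟨W, t, a1, a2, a3, a4, a5, a6, a7, a8⟩ := EX hCA hp hf f0 W0 h1 h2
  have tf : t * f = 0 := by
    rcases hfW with h | ⟨w, hw, rfl⟩
    · exact a6 _ (a1 h)
    · rw [← mul_assoc, a6 w (a1 hw), zero_mul]
  obtain ⟨z, z1, z2, z3⟩ := a8 (orth_add hp a4 hf.1 a5 fp tf)
  refine ⟨W, t, z, a1, a2, a3, a4, a5, a6, ?_, z1, z2, z3⟩
  rw [← mul_sub]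
  refine ⟨cz_pj z1 a7.1, fun x => ?_⟩
  rw [mul_assoc, ← cz_l z1, ← a7.2, Set.forall_mem_range, Set.forall_mem_image]
  simp only [cz_s z1, cz_m z1, Subtype.forall]
  simp only [mul_assoc, cz_l z1]
end MM

set_option linter.unusedVariables false
set_option linter.unusedSimpArgs false
set_option linter.style.haveILetI false
namespace MM
variable {B : Type*} [CStarAlgebra B]

structure Fam {ι : Type*} (Y : ι → B) : Prop where
  pi : ∀ i, Y i * (star (Y i) * Y i) = Y i
  orth : ∀ i j, i ≠ j → star (Y i) * Y j = 0

section
variable {ι : Type*} {Y : ι → B}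

theorem Fam.pj (h : Fam Y) (i : ι) : IsProjection (Y i * star (Y i)) := pi_rng (h.pi i)

theorem Fam.oe (h : Fam Y) {i j : ι} (hij : i ≠ j) : (Y i * star (Y i)) * (Y j * star (Y j)) = 0 := by
  rw [mul_assoc, ← mul_assoc (star (Y i)), h.orth i j hij, zero_mul, mul_zero]

theorem Fam.ey (h : Fam Y) {i j : ι} (hij : i ≠ j) : (Y i * star (Y i)) * Y j = 0 := by
  rw [mul_assoc, h.orth i j hij, mul_zero]

theorem Fam.eyy (h : Fam Y) (i : ι) : (Y i * star (Y i)) * Y i = Y i := by rw [mul_assoc, h.pi]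

theorem sum_orth {e : ι → B} (s : Finset ι) {k : ι} (hk : k ∉ s) (o : ∀ i j, i ≠ j → e i * e j = 0) :
    (∑ i ∈ s, e i) * e k = 0 := by
  rw [Finset.sum_mul]
  exact Finset.sum_eq_zero fun i hi => o i k (fun h => hk (h ▸ hi))

theorem sum_pj {e : ι → B} (s : Finset ι) (p : ∀ i, IsProjection (e i)) (o : ∀ i j, i ≠ j → e i * e j = 0) :
    IsProjection (∑ i ∈ s, e i) := by
  classical
  induction s using Finset.induction_on with
  | empty => simpa using pj_zero
  | insert j s hj ih =>
    rw [Finset.sum_insert hj]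
    exact pj_add (p j) ih (orth_symm ih (p j) (sum_orth s hj o))

theorem sum_in {e : ι → B} (s : Finset ι) {k : ι} (hk : k ∈ s) (p : ∀ i, IsProjection (e i)) (o : ∀ i j, i ≠ j → e i * e j = 0) :
    (∑ i ∈ s, e i) * e k = e k := by
  classical
  rw [← Finset.insert_erase hk, Finset.sum_insert (Finset.notMem_erase _ _), add_mul, (p k).2, sum_orth _ (Finset.notMem_erase _ _) o, add_zero]

theorem sum_ann {e : ι → B} [Fintype ι] (p : ∀ i, IsProjection (e i)) (o : ∀ i j, i ≠ j → e i * e j = 0) :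
    Ann (Set.range e) (∑ i, e i) := by
  refine ⟨sum_pj _ p o, fun x => ?_⟩
  rw [Set.forall_mem_range]
  refine ⟨fun h => by rw [Finset.sum_mul]; exact Finset.sum_eq_zero fun i _ => h i, fun h i => ?_⟩
  have := le_symm' (p i) (sum_pj _ p o) (sum_in Finset.univ (Finset.mem_univ i) p o)
  rw [← this, mul_assoc, h, mul_zero]

end

/-- stacking -/
theorem Sys.stack {κ ι : Type*} [Fintype κ] [Fintype ι] {u0 : B} {v : κ → B} (h : Sys u0 v) {r : ι → B} (hr : Fam r)
    (ur : ∀ i, u0 * r i = r i) {z : B} (hz : IsCentralProj z) (hs : ∑ i, r i * star (r i) = z * u0) :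
    Fam (fun k : κ × ι => v k.1 * r k.2) ∧ (∀ k : κ × ι, star (v k.1 * r k.2) * (v k.1 * r k.2) = star (r k.2) * r k.2) ∧
    ∑ k : κ × ι, (v k.1 * r k.2) * star (v k.1 * r k.2) = z ∧
    ∀ j, ∑ i, (v j * r i) * star (v j * r i) = z * (v j * star (v j)) := by
  have key : ∀ j i i', star (v j * r i) * (v j * r i') = star (r i) * r i' := fun j i i' => by
    rw [star_mul, mul_assoc, ← mul_assoc (star (v j)), h.iso, ur]
  have s1 : ∀ j, ∑ i, (v j * r i) * star (v j * r i) = z * (v j * star (v j)) := fun j => by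
    have : ∀ i, (v j * r i) * star (v j * r i) = v j * (r i * star (r i)) * star (v j) := fun i => by
      rw [star_mul]; simp only [mul_assoc]
    simp only [this]
    rw [← Finset.sum_mul, ← Finset.mul_sum, hs, cz_l hz, h.vu, mul_assoc]
  refine ⟨⟨fun k => ?_, fun k k' hk => ?_⟩, fun k => key _ _ _, ?_, s1⟩
  · rw [key, mul_assoc, hr.pi]
  · by_cases h1 : k.1 = k'.1
    · rw [h1, key, hr.orth _ _ (fun h2 => hk (Prod.ext h1 h2))]
    · rw [star_mul, mul_assoc, ← mul_assoc (star (v k.1)), h.orth _ _ h1, zero_mul, mul_zero]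
  · rw [Fintype.sum_prod_type]
    simp only [s1]
    rw [← Finset.mul_sum, h.sum, mul_one]

theorem caseA {κ : Type*} [Fintype κ] {u0 : B} {v : κ → B} (h : Sys u0 v) {z : B} (hz : IsCentralProj z)
    (hI : InfI (z * u0)) : ∃ z', IsCentralProj z' ∧ z' ≠ 0 ∧ z' * z = z' ∧ AWC z' := by
  obtain ⟨c, x, hc, c0, x1, x2, x3⟩ := hI
  have hp : AWC (z * u0) := h.aw.sub (cz_pj hz h.aw.1) (by rw [mul_assoc, h.aw.1.2])
  set p := z * u0 with hpd
  have hf : IsProjection (x 0 * star (x 0)) := pi_rng (pi3 hc (x1 0))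
  have fp : x 0 * star (x 0) * p = x 0 * star (x 0) := le_symm' hf hp.1 (by rw [← mul_assoc, x3])
  have f0 : x 0 * star (x 0) ≠ 0 := fun h0 => c0 (by rw [← x1 0, z2 h0, mul_zero])
  have W1 : ∀ n m, star (x n * star (x 0)) * (x m * star (x 0)) = x 0 * ((star (x n) * x m) * star (x 0)) := fun n m => by
    rw [star_mul, star_star]; simp only [mul_assoc]
  have W2 : ∀ n, star (x n * star (x 0)) * (x n * star (x 0)) = x 0 * star (x 0) := fun n => by
    rw [W1, x1, ← mul_assoc, pi_of_pj hc (x1 0)]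
  have inj : Function.Injective (fun n => x n * star (x 0)) := fun n m hnm => by
    by_contra hne
    dsimp only at hnm
    have := W2 n
    nth_rw 2 [hnm] at this
    rw [W1, x2 n m hne, zero_mul, mul_zero] at this
    exact f0 this.symm
  obtain ⟨W, t, z1, a1, a2, a3, a4, a5, a6, a7, z1c, z1f, s⟩ := EXz h.ca hp (hp.sub hf fp) f0 (Set.range fun n => x n * star (x 0))
    (Set.range_nonempty _) fp (by rintro _ ⟨n, rfl⟩; exact ⟨W2 n, by dsimp only; rw [← mul_assoc, x3]⟩) (Or.inl ⟨0, rfl⟩)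
    (by
      rintro _ ⟨n, rfl⟩ _ ⟨m, rfl⟩ hne
      dsimp only
      rw [W1, x2 n m (fun h => hne (h ▸ rfl)), zero_mul, mul_zero])
  haveI : Infinite W := ((Set.infinite_range_of_injective inj).mono a1).to_subtype
  have hp' : AWC (z1 * p) := hp.sub (cz_pj z1c hp.1) (by rw [mul_assoc, hp.1.2])
  obtain ⟨P, P2, q1, q2, q3, q4, q5, q6, q7⟩ := ABS (ι := W) (p := z1 * p) (f := z1 * (x 0 * star (x 0))) (t := z1 * t) hp' (cz_pj z1c hf) (w := fun w => z1 * w)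
    (fun i => by rw [cz_s z1c, cz_m z1c, (a2 i i.2).1]) (fun i => by rw [cz_m z1c, (a2 i i.2).2])
    (fun i j hij => by rw [cz_s z1c, cz_m z1c, a3 i i.2 j j.2 (fun h => hij (Subtype.ext h)), mul_zero])
    (cz_pj z1c a4) (by rw [cz_m z1c, a5]) (fun i => by rw [cz_m z1c, a6 i i.2, mul_zero]) a7 s
  have zc := cz_mul z1c hz
  have hs := abs_sum (v := fun j => z1 * z * v j) hp'.1 q1 q2 q3 q4 q5 q6 q7 (fun j => by
    rw [cz_s zc, cz_m zc, h.iso, hpd, mul_assoc]) Finset.univ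
  rw [h.sumz zc] at hs
  obtain ⟨w, w1, w2⟩ := hs
  refine ⟨z1 * z, zc, fun h0 => z1f ?_, by rw [mul_assoc, hz.1.2], hp'.of_equiv (f := 0) zc.1 w1 w2⟩
  have : z1 * (x 0 * star (x 0)) = z1 * p * (x 0 * star (x 0)) := by
    rw [mul_assoc, le_symm hf hp.1 fp]
  rw [this, hpd, ← mul_assoc z1 z, h0]; simp

theorem caseB {κ : Type*} [Fintype κ] {u0 : B} {v : κ → B} (h : Sys u0 v) {z : B} (hz : IsCentralProj z)
    (hI : ¬ InfI (z * u0)) {f : B} (hf : IsAbelianProj f) (f0 : f ≠ 0) (fp : f * (z * u0) = f) :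
    ∃ z', IsCentralProj z' ∧ z' ≠ 0 ∧ z' * z = z' ∧ AWC z' := by
  classical
  have hp : AWC (z * u0) := h.aw.sub (cz_pj hz h.aw.1) (by rw [mul_assoc, h.aw.1.2])
  set p := z * u0 with hpd
  have u0p : u0 * p = p := by rw [hpd, cz_l hz, h.aw.1.2]
  have af := hp.sub hf.1 fp
  obtain ⟨W, t, z1, a1, a2, a3, a4, a5, a6, a7, z1c, z1f, yt, y1, y2⟩ := EXz h.ca hp af f0 {f} ⟨f, rfl⟩ fp
    (by rintro _ rfl; exact ⟨by rw [hf.1.1, hf.1.2], le_symm hf.1 hp.1 fp⟩) (Or.inl rfl)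
    (by rintro _ rfl _ rfl hne; exact absurd rfl hne)
  have fin : W.Finite := by
    by_contra hi
    have g := Set.Infinite.natEmbedding W hi
    exact hI ⟨f, fun n => g n, hf.1, f0, fun n => (a2 _ (g n).2).1, fun n m hnm => a3 _ (g n).2 _ (g m).2
      (fun h => hnm (g.injective (Subtype.ext h))), fun n => (a2 _ (g n).2).2⟩
  haveI : Fintype W := fin.fintype
  have ft := cz_pj z1c a4
  have yt1 := pi3 ft y1
  have yt2 := pi_of_pj ft y1
  let r : Option W → B := fun o => o.elim (star yt) (fun w => z1 * w)
  have pyt : p * star yt = star yt := by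
    have : yt * p = yt := by rw [← yt2, mul_assoc, mul_assoc, a5]
    have := st this; rwa [hp.1.1] at this
  have ytw : ∀ w ∈ W, yt * (z1 * w) = 0 := fun w hw => by
    rw [← yt2, mul_assoc, cz_m z1c, a6 w hw, mul_zero, mul_zero]
  have pf := cz_pj z1c hf.1
  have rF : Fam r := by
    refine ⟨?_, ?_⟩
    · rintro (_ | w)
      · simpa [r] using pi_star yt1
      · refine pi3 pf ?_
        simp only [r, Option.elim_some, cz_s z1c, cz_m z1c, (a2 w w.2).1]
    · rintro (_ | w) (_ | w') hne
      · exact absurd rfl hne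
      · simp only [r, Option.elim_some, Option.elim_none, star_star]; exact ytw _ w'.2
      · simp only [r, Option.elim_some, Option.elim_none]
        have := congrArg star (ytw w w.2)
        simpa using this
      · simp only [r, Option.elim_some, cz_s z1c, cz_m z1c]
        rw [a3 w w.2 w' w'.2 (fun h => hne (by rw [Subtype.ext h])), mul_zero]
  have pr : ∀ o, p * r o = r o := by
    rintro (_ | w)
    · exact pyt
    · simp only [r, Option.elim_some, cz_l z1c, (a2 w w.2).2]
  have rf : ∀ o, r o * f = r o := by
    rintro (_ | w)
    · have := st y2
      rw [cz_s z1c, hf.1.1, cz_l z1c] at this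
      simp only [r, Option.elim_none]
      rw [← this, mul_assoc, mul_assoc, hf.1.2]
    · simp only [r, Option.elim_some]
      rw [mul_assoc, pi_of_pj hf.1 (a2 w w.2).1]
  have rs : ∑ o, r o * star (r o) = (z1 * z) * u0 := by
    rw [Fintype.sum_option]
    simp only [r, Option.elim_some, Option.elim_none, star_star]
    have e := (sum_ann (e := fun w : W => (z1 * (w : B)) * star (z1 * (w : B))) (fun w => rF.pj (some w))
      (fun w w' hne => rF.oe (i := some w) (j := some w') (by simpa using hne))).unique a7
    rw [e, y1, mul_assoc z1 z u0, ← hpd]; abel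
  have zc := cz_mul z1c hz
  obtain ⟨s1, s2, s3, -⟩ := h.stack rF (fun o => by rw [← pr o, ← mul_assoc, u0p]) zc rs
  refine ⟨z1 * z, zc, fun h0 => z1f ?_, by rw [mul_assoc, hz.1.2], ?_⟩
  · have : z1 * f = z1 * p * f := by
      rw [mul_assoc, le_symm hf.1 hp.1 fp]
    rw [this, hpd, ← mul_assoc z1 z, h0]; simp
  · rw [← s3]
    generalize (Finset.univ : Finset (κ × Option W)) = s
    induction s using Finset.induction_on with
    | empty => simpa using hp.sub pj_zero (by simp)
    | insert k s hk ih =>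
      rw [Finset.sum_insert hk, add_comm]
      exact step_b h ih af hf (s1.pj k) (by rw [mul_assoc, rf]) (sum_orth (e := fun k : κ × Option W => v k.1 * r k.2 * star (v k.1 * r k.2)) s hk (fun i j hij => s1.oe hij))

/-- iterated halving -/
theorem halve_step {κ : Type*} [Fintype κ] {p : B} (hp : AWC p) (hN : ∀ f, IsAbelianProj f → f * p = f → f = 0)
    (H : ∀ e, IsProjection e → e * p = e → ∃ (c : B) (y : κ → B), IsProjection c ∧ (∀ i, star (y i) * y i = c) ∧
      (∀ i j, i ≠ j → star (y i) * y j = 0) ∧ ∑ i, y i * star (y i) = e) :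
    ∀ e, IsProjection e → e * p = e → ∃ (c : B) (y : Bool × κ → B), IsProjection c ∧ (∀ i, star (y i) * y i = c) ∧
      (∀ i j, i ≠ j → star (y i) * y j = 0) ∧ ∑ i, y i * star (y i) = e := by
  intro e he hep
  obtain ⟨V, e1, e2, e3, e4, e5⟩ := halve hp hN he hep
  have pV := pi_src e2
  obtain ⟨c, y, c1, c2, c3, c4⟩ := H (star V * V) pV (by
    rw [mul_assoc, show V * p = V by rw [← e5, mul_assoc, hep]])
  have F : Fam y := ⟨fun i => pi3 c1 (c2 i), c3⟩
  have vy : ∀ j, star V * V * y j = y j := fun j => by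
    have := sum_in Finset.univ (Finset.mem_univ j) F.pj (fun i j hij => F.oe hij)
    rw [c4] at this
    rw [← F.eyy j, ← mul_assoc, this]
  have yv : ∀ j, star (y j) * (star V * V) = star (y j) := fun j => by
    have := st (vy j); rwa [pV.1] at this
  have key : ∀ i j, star (V * y i) * (V * y j) = star (y i) * y j := fun i j => by
    rw [star_mul, mul_assoc, ← mul_assoc (star V), vy]
  have c5 : ∀ i j, star (y i) * (V * y j) = 0 := fun i j => by
    rw [← yv, mul_assoc, ← mul_assoc _ V, mul_assoc _ V V, e3]; simp
  refine ⟨c, fun k => bif k.1 then y k.2 else V * y k.2, c1, ?_, ?_, ?_⟩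
  · rintro ⟨_ | _, i⟩
    · simp only [cond_false, key, c2]
    · simp only [cond_true, c2]
  · rintro ⟨_ | _, i⟩ ⟨_ | _, j⟩ hij
    · simp only [cond_false, key]; exact c3 _ _ (by simpa using hij)
    · simp only [cond_true, cond_false]
      have := congrArg star (c5 j i)
      simpa [mul_assoc] using this
    · simp only [cond_true, cond_false]; exact c5 i j
    · simp only [cond_true]; exact c3 _ _ (by simpa using hij)
  · rw [Fintype.sum_prod_type]
    simp only [Fintype.sum_bool, cond_true, cond_false]
    rw [c4]
    have : ∀ i, (V * y i) * star (V * y i) = V * (y i * star (y i)) * star V := fun i => by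
      rw [star_mul]; simp only [mul_assoc]
    simp only [this]
    rw [← Finset.sum_mul, ← Finset.mul_sum, c4, e2]
    exact e1.symm
end MM

set_option linter.unusedVariables false
set_option linter.unusedSimpArgs false
set_option linter.style.haveILetI false
namespace MM
variable {B : Type*} [CStarAlgebra B]

theorem shift_fam {a0 a1 w : B} (h0 : IsProjection a0) (h1 : IsProjection a1) (o : a0 * a1 = 0)
    (hw : star w * w = a0 + a1) (w0 : a0 * w = w) :
    (∀ n : ℕ, star (w ^ n * a1) * (w ^ n * a1) = a1) ∧
    (∀ n m : ℕ, n ≠ m → star (w ^ n * a1) * (w ^ m * a1) = 0) ∧ (∀ n, w ^ (n + 1) * a1 = a0 * (w ^ (n + 1) * a1)) := by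
  have o' := orth_symm h0 h1 o
  have k0 : ∀ n, w ^ (n + 1) * a1 = a0 * (w ^ (n + 1) * a1) := fun n => by
    rw [pow_succ', mul_assoc, ← mul_assoc a0, w0]
  have k1 : ∀ n, (a0 + a1) * (w ^ n * a1) = w ^ n * a1 := by
    rintro (_ | n)
    · rw [pow_zero, one_mul, add_mul, o, h1.2, zero_add]
    · rw [k0 n, ← mul_assoc, add_mul, o', h0.2, add_zero]
  have k2 : ∀ n m, star (w ^ (n + 1) * a1) * (w ^ (m + 1) * a1) = star (w ^ n * a1) * (w ^ m * a1) := fun n m => by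
    have e1 : ∀ n, w ^ (n+1) * a1 = w * (w ^ n * a1) := fun n => by rw [pow_succ', mul_assoc]
    rw [e1, e1, star_mul, mul_assoc, ← mul_assoc (star w), hw, k1]
  have k3 : ∀ m, star (w ^ 0 * a1) * (w ^ (m + 1) * a1) = 0 := fun m => by
    rw [pow_zero, one_mul, h1.1, k0, ← mul_assoc, o', zero_mul]
  have k4 : ∀ n m, n < m → star (w ^ n * a1) * (w ^ m * a1) = 0 := by
    intro n
    induction n with
    | zero => rintro (_ | m) h
              · omega
              · exact k3 m
    | succ n ih => rintro (_ | m) h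
                   · omega
                   · rw [k2]; exact ih m (by omega)
  refine ⟨fun n => ?_, fun n m hnm => ?_, k0⟩
  · induction n with
    | zero => simp [h1.1, h1.2]
    | succ n ih => rw [k2, ih]
  · rcases lt_or_gt_of_ne hnm with h | h
    · exact k4 _ _ h
    · have := congrArg star (k4 _ _ h)
      simpa [mul_assoc] using this

theorem caseC {κ : Type*} [Fintype κ] {u0 : B} {v : κ → B} (h : Sys u0 v) {z : B} (hz : IsCentralProj z) (z0 : z ≠ 0)
    (hI : ¬ InfI (z * u0)) (hN : ∀ f, IsAbelianProj f → f * (z * u0) = f → f = 0) : AWC z := by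
  classical
  have hp : AWC (z * u0) := h.aw.sub (cz_pj hz h.aw.1) (by rw [mul_assoc, h.aw.1.2])
  have H0 : ∀ e, IsProjection e → e * (z * u0) = e → ∃ (c : B) (y : Unit → B), IsProjection c ∧ (∀ i, star (y i) * y i = c) ∧
      (∀ i j, i ≠ j → star (y i) * y j = 0) ∧ ∑ i, y i * star (y i) = e := fun e he _ =>
    ⟨e, fun _ => e, he, fun _ => by rw [he.1, he.2], fun i j hij => absurd rfl hij, by simp [he.1, he.2]⟩
  obtain ⟨c, y, c1, c2, c3, c4⟩ := halve_step hp hN (halve_step hp hN (halve_step hp hN H0)) (z * u0) hp.1 hp.1.2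
  have Fy : Fam y := ⟨fun i => pi3 c1 (c2 i), c3⟩
  have py : ∀ i, (z * u0) * y i = y i := fun j => by
    have := sum_in Finset.univ (Finset.mem_univ j) Fy.pj (fun i j hij => Fy.oe hij)
    rw [c4] at this
    rw [← Fy.eyy j, ← mul_assoc, this]
  have uy : ∀ i, u0 * y i = y i := fun i => by
    rw [← py i, ← mul_assoc, cz_l hz, h.aw.1.2]
  have zy : ∀ i, z * y i = y i := fun i => by
    rw [← py i, ← mul_assoc, ← mul_assoc, hz.1.2]
  obtain ⟨FY, Yc, Ys, Yj⟩ := h.stack Fy uy hz c4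
  set Y : κ × (Bool × Bool × Bool × Unit) → B := fun k => v k.1 * y k.2 with hY
  replace Yc : ∀ k, star (Y k) * Y k = c := fun k => (Yc k).trans (c2 _)
  obtain ⟨j0⟩ : Nonempty κ := by
    by_contra hne
    rw [not_nonempty_iff] at hne
    apply z0
    have := h.sum
    simp at this
    rw [← mul_one z, ← this, mul_zero]
  set E : κ × (Bool × Bool × Bool × Unit) → B := fun k => Y k * star (Y k) with hE
  have pE : ∀ k, IsProjection (E k) := FY.pj
  have oE : ∀ i j, i ≠ j → E i * E j = 0 := fun i j hij => FY.oe hij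
  have eqE : ∀ i j, SubE (E i) (E j) := fun i j => by
    refine ⟨Y j * star (Y i), ?_, ?_⟩
    · rw [star_mul, star_star, mul_assoc, ← mul_assoc (star (Y j)), Yc, ← mul_assoc, pi_of_pj c1 (Yc i)]
    · rw [← mul_assoc, FY.eyy]
  let S0 : Finset (κ × (Bool × Bool × Bool × Unit)) := {j0} ×ˢ Finset.univ
  have memS : ∀ i, (j0, i) ∈ S0 := fun i => by simp [S0]
  have base : AWC (∑ k ∈ S0, E k) := by
    have e : ∑ k ∈ S0, E k = z * (v j0 * star (v j0)) := by
      rw [← Yj j0]; simp only [S0, Finset.sum_product, Finset.sum_singleton]; rfl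
    have q : IsProjection (z * (v j0 * star (v j0))) := cz_pj hz (pi_rng (pi3 h.aw.1 (h.iso j0)))
    rw [e]
    refine hp.of_equiv (f := 0) (v := z * star (v j0)) q ?_ ?_
    · rw [cz_s hz, star_star, cz_m hz]
    · rw [cz_m hz, h.uv]
  have vv : ∀ i, v j0 * star (v j0) * E (j0, i) = E (j0, i) := fun i => by
    have : v j0 * (star (v j0) * (v j0 * y i)) = v j0 * y i := by
      rw [← mul_assoc (star (v j0)), h.iso, uy]
    simp only [hE, hY]
    rw [mul_assoc, ← mul_assoc (star _), ← mul_assoc, this]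
  have zE : ∀ k, z * E k = E k := fun k => by
    simp only [hE, hY]
    rw [← mul_assoc, ← cz_l hz, zy]
  have main : ∀ s : Finset (κ × (Bool × Bool × Bool × Unit)), AWC (∑ k ∈ S0 ∪ s, E k) := by
    intro s
    induction s using Finset.induction_on with
    | empty => simpa using base
    | insert k s hk ih =>
      by_cases hkT : k ∈ S0 ∪ s
      · rwa [Finset.union_insert, Finset.insert_eq_of_mem hkT]
      · rw [Finset.union_insert, Finset.sum_insert hkT, add_comm]
        set T := S0 ∪ s with hT
        have uin : ∀ i, (∑ k ∈ T, E k) * E (j0, i) = E (j0, i) := fun i =>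
          sum_in T (Finset.mem_union_left _ (memS i)) pE oE
        set u := ∑ k ∈ T, E k with hu
        let a : Bool → Bool → Bool → B := fun x1 x2 x3 => E (j0, (x1, x2, x3, ()))
        have pa : ∀ x1 x2 x3, IsProjection (a x1 x2 x3) := fun x1 x2 x3 => pE _
        have ua : ∀ x1 x2 x3, u * a x1 x2 x3 = a x1 x2 x3 := fun x1 x2 x3 => uin _
        have au : ∀ x1 x2 x3, a x1 x2 x3 * u = a x1 x2 x3 := fun x1 x2 x3 => le_symm' (pa _ _ _) ih.1 (ua _ _ _)
        have oa : ∀ x1 x2 x3 y1 y2 y3, (x1, x2, x3) ≠ (y1, y2, y3) → a x1 x2 x3 * a y1 y2 y3 = 0 := by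
          intro x1 x2 x3 y1 y2 y3 hne
          apply oE
          intro h'
          simp only [Prod.mk.injEq, true_and, and_true] at h'
          exact hne (by simp [h'])
        have g0 : ∀ x1 x2, IsProjection (a x1 x2 true + a x1 x2 false) := fun x1 x2 =>
          pj_add (pa _ _ _) (pa _ _ _) (oa _ _ _ _ _ _ (by simp))
        have g1 : ∀ x1 x2 y1 y2, (x1, x2) ≠ (y1, y2) → (a x1 x2 true + a x1 x2 false) * (a y1 y2 true + a y1 y2 false) = 0 := by
          intro x1 x2 y1 y2 hne
          have : ∀ x3 y3, a x1 x2 x3 * a y1 y2 y3 = 0 := fun x3 y3 => oa _ _ _ _ _ _ (by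
            intro h'; simp only [Prod.mk.injEq] at h'; exact hne (by simp [h']))
          simp only [add_mul, mul_add, this, add_zero]
        have g2 : ∀ x1 x2 y1 y2, SubE (a x1 x2 true + a x1 x2 false) (a y1 y2 true + a y1 y2 false) := fun x1 x2 y1 y2 =>
          (eqE _ _).add (eqE _ _) (pE _) (pE _) (oa _ _ _ _ _ _ (by simp))
        have g3 : ∀ x1 x2, (a x1 x2 true + a x1 x2 false) * u = a x1 x2 true + a x1 x2 false := fun x1 x2 => by
          rw [add_mul, au, au]
        have p2 := g0 false false
        have q1 := pj_sub p2 ih.1 (g3 false false)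
        have q12 : (u - (a false false true + a false false false)) * (a false false true + a false false false) = 0 := by
          rw [sub_mul, p2.2, mul_add, ua, ua, sub_self]
        have l : ∀ x1 x2, (x1, x2) ≠ (false, false) → (u - (a false false true + a false false false)) * (a x1 x2 true + a x1 x2 false) = a x1 x2 true + a x1 x2 false := by
          intro x1 x2 hne
          rw [sub_mul, g1 _ _ _ _ hne.symm, mul_add, ua, ua, sub_zero]
        have A12 := orth_add ih q1 p2 (by rw [sub_mul, ih.1.2, g3]) (g3 _ _) q12
        obtain ⟨y', y1, y2⟩ := g2 true true false false
        have A1 := (A12.room (g0 true true) y1 y2).symm q1.1 (g0 _ _).1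
        have A2 := orth_add ih (g0 true true) p2 (g3 _ _) (g3 _ _) (g1 _ _ _ _ (by simp))
        have la : ∀ x1 x2 x3, (a x1 x2 true + a x1 x2 false) * a x1 x2 x3 = a x1 x2 x3 := by
          rintro x1 x2 (_ | _)
          · rw [add_mul, (pa _ _ _).2, oa _ _ _ _ _ _ (by simp), zero_add]
          · rw [add_mul, (pa _ _ _).2, oa _ _ _ _ _ _ (by simp), add_zero]
        have al : ∀ x1 x2 y1 y2 x3, (x1, x2) ≠ (y1, y2) → (a x1 x2 true + a x1 x2 false) * a y1 y2 x3 = 0 := by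
          intro x1 x2 y1 y2 x3 hne
          rw [← la y1 y2 x3, ← mul_assoc, g1 _ _ _ _ hne, zero_mul]
        refine step_c h.ca ih (pE k) (sum_orth T hkT oE) q1 p2 q12 (by abel) (g0 true true) (g3 _ _) A1 A2 (g0 true true) (g0 true false)
          (pa false true true) (g1 _ _ _ _ (by simp)) (al _ _ _ _ _ (by simp)) (al _ _ _ _ _ (by simp)) (l _ _ (by simp)) (l _ _ (by simp))
          ?_ (SubE.of_le (g0 _ _) (g0 _ _).2) (g2 _ _ _ _) (eqE _ _)
          ((eqE k (j0, (true, true, true, ()))).trans (SubE.of_le (pE _) (la _ _ _))) ?_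
        · have e1 := l false true (by simp)
          have e2 := congrArg (· * a false true true) e1
          simpa only [mul_assoc, la] using e2
        · intro z' hz' hs
          by_contra hne
          obtain ⟨w, w1, w2⟩ := hs.trans ((eqE k (j0, (true, true, true, ()))).zmul hz')
          rw [mul_add] at w1
          have o' : (z' * a true true true) * (z' * a true true false) = 0 := by
            rw [cz_m hz', oa _ _ _ _ _ _ (by simp), mul_zero]
          have pa' := cz_pj hz' (pa true true false)
          obtain ⟨b1, b2, b3⟩ := shift_fam (cz_pj hz' (pa true true true)) pa' o' w1 w2
          have v1 : ∀ x3, v j0 * star (v j0) * (z' * a true true x3) = z' * a true true x3 := fun x3 => by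
            rw [cz_l hz', vv]
          have zz : ∀ x3, z * (z' * a true true x3) = z' * a true true x3 := fun x3 => by
            rw [cz_l hz', zE]
          have b4 : ∀ n, v j0 * star (v j0) * (w ^ n * (z' * a true true false)) = w ^ n * (z' * a true true false) ∧
              z * (w ^ n * (z' * a true true false)) = w ^ n * (z' * a true true false) := by
            rintro (_ | n)
            · simp only [pow_zero, one_mul]; exact ⟨v1 _, zz _⟩
            · rw [b3 n]
              exact ⟨by rw [← mul_assoc, v1], by rw [← mul_assoc, zz]⟩
          refine hI ⟨z' * a true true false, fun n => star (v j0) * (w ^ n * (z' * a true true false)), pa', ?_, ?_, ?_, ?_⟩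
          · intro h0
            obtain ⟨g, g1, g2⟩ := (eqE k (j0, (true, true, false, ()))).zmul hz'
            rw [show z' * E (j0, (true, true, false, ())) = 0 from h0, zero_mul] at g2
            rw [← g2] at g1
            exact hne (by rw [← g1]; simp)
          · intro n
            rw [star_mul, star_star, mul_assoc, ← mul_assoc (v j0), (b4 n).1, b1]
          · intro n m hnm
            rw [star_mul, star_star, mul_assoc, ← mul_assoc (v j0), (b4 m).1, b2 n m hnm]
          · intro n
            rw [← mul_assoc, mul_assoc z, h.uv, mul_assoc, ← cz_l hz, (b4 n).2]
  have := main Finset.univ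
  rw [show S0 ∪ Finset.univ = Finset.univ from by ext; simp] at this
  rwa [← Ys]

theorem Sys.awc_one {κ : Type*} [Fintype κ] {u0 : B} {v : κ → B} (h : Sys u0 v) : AWC (1 : B) := by
  refine ⟨pj_one, fun S _ => h.LG S fun z hz z0 => ?_⟩
  obtain ⟨z', a1, a2, a3, a4⟩ : ∃ z', IsCentralProj z' ∧ z' ≠ 0 ∧ z' * z = z' ∧ AWC z' := by
    by_cases hI : InfI (z * u0)
    · exact caseA h hz hI
    · by_cases hN : ∃ f, IsAbelianProj f ∧ f ≠ 0 ∧ f * (z * u0) = f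
      · obtain ⟨f, f1, f2, f3⟩ := hN
        exact caseB h hz hI f1 f2 f3
      · refine ⟨z, hz, z0, hz.1.2, caseC h hz z0 hI fun f f1 f2 => ?_⟩
        by_contra f0
        exact hN ⟨f, f1, f0, f2⟩
  refine ⟨z', a1, a2, a3, a4.2 _ ?_⟩
  rintro _ ⟨s, -, rfl⟩
  dsimp only
  rw [← a1.2, ← mul_assoc, a1.1.2]
end MM

set_option linter.unusedVariables false
set_option linter.unusedSimpArgs false
set_option linter.style.haveILetI false
namespace MM
variable {B : Type*} [CStarAlgebra B]

theorem corner_awc {A D : Type*} [CStarAlgebra A] [CStarAlgebra D] (φ : A → D) (hm : ∀ a b, φ (a * b) = φ a * φ b)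
    (hs : ∀ a, φ (star a) = star (φ a)) (h0 : ∀ a, φ a = 0 ↔ a = 0) (hr : ∀ d, ∃ a, φ a = φ 1 * d * φ 1)
    (hA : AWC (1 : A)) : AWC (φ 1) := by
  have pj : ∀ a, IsProjection a → IsProjection (φ a) := fun a h => ⟨by rw [← hs, h.1], by rw [← hm, h.2]⟩
  refine ⟨pj _ pj_one, fun S hS => ?_⟩
  obtain ⟨E, hE, hE'⟩ := hA.2 {a | ∃ s ∈ S, ∃ d, φ a = φ 1 * d * s} (by simp)
  have Eu : φ E * φ 1 = φ E := by rw [← hm, mul_one]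
  refine ⟨φ E, pj _ hE, fun x => ⟨fun hx => ?_, fun hx s hs' => ?_⟩⟩
  · have key : ∀ d, φ E * x * d * φ 1 = 0 := fun d => by
      obtain ⟨b, hb⟩ := hr (x * d)
      have : E * b = 0 := (hE' b).1 (by
        rintro a ⟨s, hs', d', ha⟩
        rw [← h0, hm, ha, hb]
        have : φ 1 * d' * s * (φ 1 * (x * d) * φ 1) = φ 1 * d' * ((s * φ 1) * x) * d * φ 1 := by simp only [mul_assoc]
        rw [this, hS s hs', hx s hs']; simp)
      rw [← h0, hm, hb] at this
      rw [← this]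
      have : φ E * (φ 1 * (x * d) * φ 1) = (φ E * φ 1) * x * d * φ 1 := by simp only [mul_assoc]
      rw [this, Eu]
    refine z2 ?_
    rw [← key (star (φ E * x)), star_mul]
    simp only [mul_assoc]
    rw [(pj _ hE).1, Eu]
  · have key : ∀ d, star s * s * x * d * φ 1 = 0 := fun d => by
      obtain ⟨b, hb⟩ := hr (x * d)
      obtain ⟨a, ha⟩ := hr (star s * s)
      have ss : φ 1 * star s = star s := by
        have := st (hS s hs'); rwa [(pj _ pj_one).1] at this
      have e1 : E * b = 0 := by
        rw [← h0, hm, hb]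
        have : φ E * (φ 1 * (x * d) * φ 1) = (φ E * φ 1) * x * d * φ 1 := by simp only [mul_assoc]
        rw [this, Eu, hx]; simp
      have := (hE' b).2 e1 a ⟨s, hs', star s, by rw [ha]; simp only [mul_assoc, hS s hs']⟩
      rw [← h0, hm, ha, hb] at this
      rw [← this]
      have : φ 1 * (star s * s) * φ 1 * (φ 1 * (x * d) * φ 1) = (φ 1 * star s) * ((s * φ 1) * φ 1) * (x * d) * φ 1 := by simp only [mul_assoc]
      rw [this, ss, hS s hs', hS s hs']; simp only [mul_assoc]
    refine z3 ?_
    rw [← mul_assoc]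
    refine z2 ?_
    rw [← key (star (star s * s * x))]
    simp only [star_mul, star_star, mul_assoc, hS s hs']

open Matrix in
theorem mat_awc {A D κ : Type*} [Fintype κ] [DecidableEq κ] [CStarAlgebra A] [CStarAlgebra D] (g : Matrix κ κ A ≃⋆ₐ[ℂ] D) (i0 : κ)
    (hA : AWC (1 : A)) : AWC (1 : D) := by
  have h1 : AWC (g (single i0 i0 (1 : A))) := by
    refine corner_awc (fun a => g (single i0 i0 a)) ?_ ?_ ?_ ?_ hA
    · intro a b; rw [← map_mul, single_mul_single_same]
    · intro a; rw [← map_star, star_eq_conjTranspose, conjTranspose_single]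
    · intro a
      rw [map_eq_zero_iff g (EquivLike.injective g)]
      refine ⟨fun h => ?_, fun h => by rw [h, single_zero]⟩
      have := congrFun (congrFun h i0) i0
      simpa using this
    · intro d
      obtain ⟨M, rfl⟩ := (EquivLike.surjective g) d
      refine ⟨M i0 i0, ?_⟩
      rw [← map_mul, ← map_mul]
      congr 1
      ext i j
      simp [single_apply, mul_apply, ite_and]
      split_ifs <;> rfl
  refine Sys.awc_one (κ := κ) (u0 := g (single i0 i0 (1 : A))) (v := fun i => g (single i i0 1)) ⟨h1, ?_, ?_, ?_⟩
  · intro i; rw [← map_star, ← map_mul, star_eq_conjTranspose, conjTranspose_single, single_mul_single_same]; simp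
  · intro i j hij; rw [← map_star, ← map_mul, star_eq_conjTranspose, conjTranspose_single, single_mul_single_of_ne _ _ _ _ hij, map_zero]
  · simp only [← map_star, ← map_mul, star_eq_conjTranspose, conjTranspose_single, single_mul_single_same]
    rw [← map_sum, ← map_one g]
    congr 1
    ext i j
    simp only [Matrix.sum_apply, single_apply, star_one, mul_one, one_apply, ite_and]
    by_cases hij : i = j
    · subst hij; simp
    · simp [hij]
open Matrix in
theorem addP_of_mat {D : Type*} [CStarAlgebra D] (g : Matrix (Fin 2) (Fin 2) B ≃⋆ₐ[ℂ] D)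
    (hD : AWC (1 : D)) (e f : B) : AddP e f := by
  have ss : ∀ i j (b : B), star (single i j b : Matrix (Fin 2) (Fin 2) B) = single j i (star b) := fun i j b => by
    rw [star_eq_conjTranspose, conjTranspose_single]
  have inj : ∀ i j (b b' : B), (single i j b : Matrix (Fin 2) (Fin 2) B) = single i j b' ↔ b = b' := fun i j b b' =>
    ⟨fun h => by simpa using congrFun (congrFun h i) j, fun h => by rw [h]⟩
  have inj0 : ∀ i j (b : B), (single i j b : Matrix (Fin 2) (Fin 2) B) = 0 ↔ b = 0 := fun i j b => by
    rw [← inj i j b 0, single_zero]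
  have pj : ∀ i, IsProjection (g (single i i (1 : B))) := fun i => by
    refine ⟨?_, ?_⟩
    · rw [← map_star, ss, star_one]
    · rw [← map_mul, single_mul_single_same, one_mul]
  have A := orth_add hD (pj 0) (pj 1) (mul_one _) (mul_one _) (by rw [← map_mul, single_mul_single_of_ne _ _ _ _ (by decide), map_zero])
  intro W hW _
  obtain ⟨V, hV⟩ := A ((fun w => g (single 1 0 w)) '' W) (by
    refine ⟨?_, ?_⟩
    · rintro _ ⟨w, hw, rfl⟩
      simp only [← map_star, ← map_mul, ss, single_mul_single_same, hW.1 w hw]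
    · rintro _ ⟨w, hw, rfl⟩ _ ⟨w', hw', rfl⟩ hne
      obtain ⟨a, b⟩ := hW.2 w hw w' hw' (fun h => hne (by rw [h]))
      simp only [← map_star, ← map_mul, ss, single_mul_single_same, a, b, single_zero, map_zero, and_self]) (by
    rintro _ ⟨w, hw, rfl⟩
    simp only [← map_mul, single_mul_single_same, one_mul, mul_one, and_self])
  have V1 : V * g (single 0 0 1) = V := hV.le_src (by
    rintro _ ⟨w, hw, rfl⟩; simp only [← map_mul, single_mul_single_same, mul_one])
  have V2 : g (single 1 1 1) * V = V := hV.le_rng (pj 1).1 (by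
    rintro _ ⟨w, hw, rfl⟩; simp only [← map_mul, single_mul_single_same, one_mul])
  obtain ⟨v, rfl⟩ : ∃ v, V = g (single 1 0 v) := by
    obtain ⟨M, rfl⟩ := (EquivLike.surjective g) V
    refine ⟨M 1 0, ?_⟩
    have e3 : single 1 1 1 * M * single 0 0 1 = M := (EquivLike.injective g) (by rw [map_mul, map_mul, V2, V1])
    congr 1
    nth_rw 1 [← e3]
    ext i j
    simp [single_apply, mul_apply, ite_and]
    split_ifs <;> rfl
  obtain ⟨p1, p2, p3, p4⟩ := hV
  refine ⟨v, ?_, ?_, ?_, ?_⟩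
  · simp only [← map_star, ← map_mul, ss, single_mul_single_same, (EquivLike.injective g).eq_iff, inj] at p1; exact p1
  · intro w hw
    have := p2 _ ⟨w, hw, rfl⟩
    simp only [← map_star, ← map_mul, ss, single_mul_single_same, (EquivLike.injective g).eq_iff, inj] at this; exact this
  · intro x
    have := p3 (g (single 0 0 x))
    simp only [Set.forall_mem_image, ← map_star, ← map_mul, ss, single_mul_single_same, map_eq_zero_iff g (EquivLike.injective g), inj0] at this; exact this
  · intro x
    have := p4 (g (single 1 1 x))
    simp only [Set.forall_mem_image, ← map_star, ← map_mul, ss, single_mul_single_same, map_eq_zero_iff g (EquivLike.injective g), inj0] at this; exact this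

theorem addP_all (h : AWC (1 : B)) (e f : B) : AddP e f := by
  letI : PartialOrder B := CStarAlgebra.spectralOrder B
  haveI : StarOrderedRing B := CStarAlgebra.spectralOrderedRing B
  exact addP_of_mat CStarMatrix.ofMatrixStarAlgEquiv (mat_awc CStarMatrix.ofMatrixStarAlgEquiv (0 : Fin 2) h) e f
end MM

set_option linter.unusedVariables false
set_option linter.unusedSimpArgs false
set_option linter.style.haveILetI false
namespace MM
variable {B : Type*} [CStarAlgebra B]

theorem awp (h1 : AWC (1 : B)) {e : B} (he : IsProjection e) : AWC e := h1.sub he (mul_one e)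

theorem exAnn (h1 : AWC (1 : B)) (S : Set B) : ∃ E, Ann S E := h1.2 S (fun s _ => mul_one s)

theorem gc (h1 : AWC (1 : B)) {e f : B} (he : IsProjection e) (hf : IsProjection f) :
    ∃ z, IsCentralProj z ∧ SubE (z * e) (z * f) ∧ SubE ((1 - z) * f) ((1 - z) * e) :=
  GC (CA_one h1) he (awp h1 hf) (addP_all h1 e f)

theorem shift (h1 : AWC (1 : B)) {q : B} (hq : IsProjection q) (a : ℕ → B) (pa : ∀ n, IsProjection (a n))
    (oa : ∀ n m, n ≠ m → a n * a m = 0) (ea : ∀ n, ProjEquiv (a n) (a (n + 1))) (qa : ∀ n, q * a n = a n) :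
    ProjEquiv q (q - a 0) := by
  obtain ⟨S, hS⟩ := exAnn h1 (Set.range a)
  obtain ⟨S', hS'⟩ := exAnn h1 (Set.range fun n => a (n + 1))
  have o : a 0 * S' = 0 := (hS'.left (a 0)).1 (by
    rintro _ ⟨n, rfl⟩; dsimp only; rw [(pa _).1, oa _ _ (by omega)])
  have e : S = a 0 + S' := hS.unique ⟨pj_add (pa 0) hS'.1 o, fun x => by
    rw [Set.forall_mem_range]
    constructor
    · intro h
      rw [add_mul, h 0, (hS'.2 x).1 (by rintro _ ⟨n, rfl⟩; exact h _), add_zero]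
    · intro h
      have b1 := congrArg (a 0 * ·) h
      have b2 := congrArg (S' * ·) h
      simp only [add_mul, mul_add, ← mul_assoc, (pa 0).2, o, orth_symm (pa 0) hS'.1 o, hS'.1.2, zero_mul, mul_zero, add_zero, zero_add] at b1 b2
      rintro (_ | n)
      · exact b1
      · exact (hS'.2 x).2 b2 _ ⟨n, rfl⟩⟩
  have Sq : S * q = S := hS.le (by rintro _ ⟨n, rfl⟩; exact le_symm' (pa n) hq (qa n))
  have E := add_equiv (addP_all h1 S S') a (fun n => a (n + 1)) pa oa (fun n m h => oa _ _ (by omega)) ea hS hS'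
  have pr := pj_sub hS.1 hq Sq
  have o1 : S * (q - S) = 0 := by rw [mul_sub, Sq, hS.1.2, sub_self]
  have o2 : S' * (q - S) = 0 := by
    have : S' * S = S' := by rw [e, mul_add, orth_symm (pa 0) hS'.1 o, hS'.1.2, zero_add]
    rw [← this, mul_assoc, o1, mul_zero]
  have := pe_add hS.1 pr o1 E (pe_refl pr) o2
  rw [show S + (q - S) = q by abel, show S' + (q - S) = q - a 0 by rw [e]; abel] at this
  exact this

theorem SB0 (h1 : AWC (1 : B)) {e e1 w : B} (he : IsProjection e) (he1 : IsProjection e1) (hle : e1 * e = e1)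
    (hw : star w * w = e) (w1 : e1 * w = w) : ProjEquiv e e1 := by
  have pd := pj_sub he1 he hle
  have o : e1 * (e - e1) = 0 := by rw [mul_sub, hle, he1.2, sub_self]
  obtain ⟨a1, a2, a3⟩ := shift_fam he1 pd o (by rw [hw]; abel) w1
  have F : Fam (fun n : ℕ => w ^ n * (e - e1)) := ⟨fun n => pi3 pd (a1 n), a2⟩
  have := shift h1 he (fun n => (w ^ n * (e - e1)) * star (w ^ n * (e - e1))) F.pj (fun n m h => F.oe h) ?_ ?_
  · simpa [pd.1, pd.2] using this
  · intro n
    exact pe_trans (F.pj n) (pe_symm ⟨_, a1 n, rfl⟩) ⟨_, a1 (n+1), rfl⟩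
  · rintro (_ | n)
    · simp only [pow_zero, one_mul, pd.1, pd.2, mul_sub, he.2, le_symm he1 he hle]
    · rw [a3 n, mul_assoc, ← mul_assoc, le_symm he1 he hle]

theorem SB (h1 : AWC (1 : B)) {e f : B} (he : IsProjection e) (hf : IsProjection f) (h : SubE e f) (h' : SubE f e) :
    ProjEquiv e f := by
  obtain ⟨w, w1, w2⟩ := h
  obtain ⟨y, y1, y2⟩ := h'
  have py := pi_rng (pi3 hf y1)
  have := SB0 h1 (w := y * w) he py (le_symm' py he (by rw [← mul_assoc, y2])) (by
    rw [star_mul, mul_assoc, ← mul_assoc (star y), y1, w2, w1]) (by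
    rw [mul_assoc, ← mul_assoc (star y), y1, w2])
  exact pe_trans he this (pe_symm ⟨y, y1, rfl⟩)

/-- an infinite sequence of copies of `c` in `p` absorbs a copy of `c` orthogonal to `p` -/
theorem absorb (h1 : AWC (1 : B)) {p f c : B} (hp : IsProjection p) (hf : IsProjection f) (o : p * f = 0) (hc : IsProjection c)
    (hfc : ProjEquiv f c) {x : ℕ → B} (x1 : ∀ n, star (x n) * x n = c) (x2 : ∀ n m, n ≠ m → star (x n) * x m = 0)
    (x3 : ∀ n, p * x n = x n) : ProjEquiv (p + f) p := by
  have F : Fam x := ⟨fun n => pi3 hc (x1 n), x2⟩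
  have o' := orth_symm hp hf o
  have fx : ∀ n, f * (x n * star (x n)) = 0 := fun n => by rw [← x3, ← mul_assoc, ← mul_assoc, o']; simp
  have := shift h1 (pj_add hp hf o) (fun n => Nat.casesOn n f (fun n => x n * star (x n))) ?_ ?_ ?_ ?_
  · simpa using this
  · rintro (_ | n)
    · exact hf
    · exact F.pj n
  · rintro (_ | n) (_ | m) h
    · exact absurd rfl h
    · exact fx m
    · exact orth_symm hf (F.pj n) (fx n)
    · exact F.oe (by omega)
  · rintro (_ | n)
    · exact pe_trans hf hfc ⟨_, x1 0, rfl⟩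
    · exact pe_trans (F.pj n) (pe_symm ⟨_, x1 n, rfl⟩) ⟨_, x1 (n+1), rfl⟩
  · rintro (_ | n)
    · show (p + f) * f = f
      rw [add_mul, o, hf.2, zero_add]
    · show (p + f) * (x n * star (x n)) = _
      rw [add_mul, fx, ← mul_assoc, x3, add_zero]

structure Masa (M : Set B) : Prop where
  star : ∀ x ∈ M, star x ∈ M
  comm : ∀ x ∈ M, ∀ y ∈ M, x * y = y * x
  max : ∀ x, (∀ y ∈ M, x * y = y * x) → x ∈ M

namespace Masa
variable {M : Set B}

theorem mul (h : Masa M) {x y : B} (hx : x ∈ M) (hy : y ∈ M) : x * y ∈ M := h.max _ fun t ht => by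
  rw [mul_assoc, h.comm y hy t ht, ← mul_assoc, h.comm x hx t ht, mul_assoc]
theorem add (h : Masa M) {x y : B} (hx : x ∈ M) (hy : y ∈ M) : x + y ∈ M := h.max _ fun t ht => by
  rw [add_mul, mul_add, h.comm y hy t ht, h.comm x hx t ht]
theorem sub (h : Masa M) {x y : B} (hx : x ∈ M) (hy : y ∈ M) : x - y ∈ M := h.max _ fun t ht => by
  rw [sub_mul, mul_sub, h.comm y hy t ht, h.comm x hx t ht]
theorem cen (h : Masa M) {z : B} (hz : IsCentralProj z) : z ∈ M := h.max _ fun t _ => hz.2 t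
theorem sum (h : Masa M) {ι : Type*} {x : ι → B} (s : Finset ι) (hx : ∀ i, x i ∈ M) : ∑ i ∈ s, x i ∈ M :=
  h.max _ fun t ht => by
    rw [Finset.sum_mul, Finset.mul_sum]
    exact Finset.sum_congr rfl fun i _ => h.comm _ (hx i) _ ht
theorem ann (h : Masa M) {S : Set B} {E : B} (hE : Ann S E) (hS : ∀ s ∈ S, s ∈ M) : E ∈ M := h.max _ fun t ht =>
  (hE.commute (fun s hs => h.comm _ (hS s hs) _ ht) (fun s hs => h.comm _ (hS s hs) _ (h.star _ ht))).symm
theorem of_proj (h : Masa M) (h1 : AWC (1 : B)) {x : B} (hx : ∀ p ∈ M, IsProjection p → x * p = p * x) : x ∈ M := by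
  refine h.max _ fun c hc => (comm_proj h1 (mul_one c) (one_mul c) (by simp) fun p hp _ H => ?_).symm
  exact (hx p (h.max _ fun y hy => H y (h.comm _ hc _ hy) (h.comm _ (h.star _ hc) _ hy) (by simp)) hp).symm

theorem corner (h : Masa M) (h1 : AWC (1 : B)) {e : B} (he : IsProjection e) (eM : e ∈ M)
    (H : ∀ p ∈ M, IsProjection p → p * e = p → ∀ b, (e - p) * b * p = 0) (b : B) : e * b * e ∈ M := by
  refine h.of_proj h1 fun q qM hq => ?_
  have c := h.comm _ eM _ qM
  have pp : IsProjection (e * q) := pj_mul he hq c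
  have ep : e * (e * q) = e * q := by rw [← mul_assoc, he.2]
  have pe : (e * q) * e = e * q := le_symm' pp he ep
  have key : ∀ b, e * b * (e * q) = (e * q) * b * (e * q) := fun b => by
    have := H _ (h.mul eM qM) pp pe b
    rwa [sub_mul, sub_mul, sub_eq_zero] at this
  have k1 := key b
  have k2 := congrArg Star.star (key (Star.star b))
  simp only [star_mul, star_star, he.1, hq.1] at k2
  rw [mul_assoc, k1]
  have : q * (e * b * e) = (q * e) * (b * e) := by simp only [mul_assoc]
  rw [this]
  simp only [← mul_assoc] at k2 ⊢
  rw [k2, c]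
  simp only [mul_assoc]
  rw [c]

theorem abl (h : Masa M) {f : B} (hf : IsAbelianProj f) (fM : f ∈ M) (b : B) : f * b * f ∈ M := h.max _ fun q qM => by
  have c := h.comm _ fM _ qM
  have := hf.2 b q
  have e1 : f * q * f = f * q := by rw [mul_assoc, ← c, ← mul_assoc, hf.1.2]
  have e2 : f * b * f * (f * q) = f * b * f * q := by rw [← mul_assoc, mul_assoc (f*b), hf.1.2]
  have e3 : f * q * (f * b * f) = q * (f * b * f) := by rw [c, mul_assoc, ← mul_assoc f, ← mul_assoc f, hf.1.2]
  rw [e1, e2, e3] at this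
  exact this

end Masa

theorem cc_zero {e c z : B} (hc : CC e c) (hz : IsCentralProj z) : z * e = 0 ↔ z * c = 0 := by
  rw [hz.2 c, ← hc.2]
  constructor
  · intro h b; rw [mul_assoc, ← hz.2, ← mul_assoc, ← hz.2, h, zero_mul]
  · intro h; have := h 1; rwa [mul_one, ← hz.2] at this

theorem ab_le {f g : B} (hf : IsAbelianProj f) (hg : IsProjection g) (h : g * f = g) : IsAbelianProj g := by
  refine ⟨hg, fun a b => ab_comm hf ?_ ?_ ?_ ?_⟩
  · rw [← mul_assoc, ← mul_assoc, le_symm hg hf.1 h]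
  · rw [mul_assoc, h]
  · rw [← mul_assoc, ← mul_assoc, le_symm hg hf.1 h]
  · rw [mul_assoc, h]

theorem ab_half {f g c z : B} (hg : IsAbelianProj g) (hf : IsProjection f) (cf : CC f c) (cg : CC g c) (hz : IsCentralProj z)
    (h : SubE (z * f) (z * g)) : ProjEquiv (z * f) (z * g) := by
  obtain ⟨w, w1, w2⟩ := h
  have pw := pi_rng (pi3 (cz_pj hz hf) w1)
  have C : CC (w * star w) (z * c) := (cf.zmul hz).equiv ⟨w, w1, rfl⟩
  have gw : g * (w * star w) = w * star w := by
    rw [← w2, ← mul_assoc, ← mul_assoc, cz_l hz, hg.1.2]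
  have := ab_cc hg pw (le_symm' pw hg.1 gw) C
  rw [mul_assoc, cg.mul'] at this
  exact ⟨w, w1, this.symm⟩

theorem ab_equiv (h1 : AWC (1 : B)) {f g c : B} (hf : IsAbelianProj f) (hg : IsAbelianProj g) (cf : CC f c) (cg : CC g c) :
    ProjEquiv f g := by
  obtain ⟨z, hz, s1, s2⟩ := gc h1 hf.1 hg.1
  have e1 := ab_half hg hf.1 cf cg hz s1
  have e2 := pe_symm (ab_half hf hg.1 cg cf (cz_compl hz) s2)
  have oz : ∀ a b : B, (z * a) * ((1 - z) * b) = 0 := fun a b => by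
    rw [(cz_compl hz).2, ← mul_assoc, mul_assoc z a b, mul_sub, mul_one, ← hz.2, cz_zz hz, sub_self]
  have := pe_add (cz_pj hz hf.1) (cz_pj (cz_compl hz) hf.1) (oz _ _) e1 e2 (oz _ _)
  rwa [← cz_split hz, ← cz_split hz] at this
end MM

set_option linter.unusedVariables false
set_option linter.unusedSimpArgs false
set_option linter.style.haveILetI false
namespace MM
variable {B : Type*} [CStarAlgebra B] {M : Set B}

def NoAb (M : Set B) (e : B) : Prop := ∀ f ∈ M, IsAbelianProj f → f * e = f → f = 0

theorem lt3 {a b c : B} (h : a * b = a) (h' : b * c = b) : a * c = a := by rw [← h, mul_assoc, h']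

theorem zle {z a e : B} (h : a * e = a) : (z * a) * e = z * a := by rw [mul_assoc, h]

theorem ex_cross (hM : Masa M) (h1 : AWC (1 : B)) {e : B} (he : IsProjection e) (eM : e ∈ M) (e0 : e ≠ 0) (na : NoAb M e) :
    ∃ p q c : B, (p ∈ M ∧ q ∈ M) ∧ IsProjection p ∧ IsProjection q ∧ p * e = p ∧ q * e = q ∧ p * q = 0 ∧ CC p c ∧ CC q c ∧ c ≠ 0 := by
  have : ∃ p ∈ M, IsProjection p ∧ p * e = p ∧ ∃ b, (e - p) * b * p ≠ 0 := by
    by_contra H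
    push Not at H
    have k := hM.corner h1 he eM H
    exact e0 (na e eM ⟨he, fun a b => hM.comm _ (k a) _ (k b)⟩ he.2)
  obtain ⟨p, pM, hp, pe, b, hb⟩ := this
  have hq := pj_sub hp he pe
  obtain ⟨c1, k1⟩ := CA_one h1 p
  obtain ⟨c2, k2⟩ := CA_one h1 (e - p)
  have qe : (e - p) * e = e - p := by rw [sub_mul, he.2, pe]
  refine ⟨c2 * p, c1 * (e - p), c2 * c1, ⟨hM.mul (hM.cen k2.1) pM, hM.mul (hM.cen k1.1) (hM.sub eM pM)⟩,
    cz_pj k2.1 hp, cz_pj k1.1 hq, zle pe, zle qe, ?_, k1.zmul k2.1, ?_, fun h => hb ?_⟩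
  · rw [cz_l k1.1, mul_assoc c2, mul_sub, pe, hp.2, sub_self]; simp
  · rw [k2.1.2]; exact k2.zmul k1.1
  · have := (cc_zero k1 k2.1).2 h
    rw [← k2.mul, mul_assoc (e - p), k2.1.2, mul_assoc, mul_assoc, this]; simp

structure SplitF (M : Set B) (e c : B) {ι : Type*} (g : ι → B) : Prop where
  mem : ∀ i, g i ∈ M
  pj : ∀ i, IsProjection (g i)
  le : ∀ i, g i * e = g i
  cc : ∀ i, CC (g i) c
  orth : ∀ i j, i ≠ j → g i * g j = 0

theorem split0 (hM : Masa M) (h1 : AWC (1 : B)) (m : ℕ) : ∀ {e : B}, IsProjection e → e ∈ M → e ≠ 0 → NoAb M e →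
    ∃ (g : Fin (m + 1) → B) (c : B), c ≠ 0 ∧ SplitF M e c g := by
  induction m with
  | zero =>
    intro e he eM e0 na
    obtain ⟨c, k⟩ := CA_one h1 e
    exact ⟨fun _ => e, c, k.ne_zero e0, fun _ => eM, fun _ => he, fun _ => he.2, fun _ => k, fun i j h => absurd (by omega) h⟩
  | succ m ih =>
    intro e he eM e0 na
    obtain ⟨p, q, c, ⟨pM, qM⟩, hp, hq, pe, qe, pq, cp, cq, c0⟩ := ex_cross hM h1 he eM e0 na
    have q0 : q ≠ 0 := by
      rintro rfl
      exact c0 (by simpa [cq.1.1.2] using (cc_zero cq cq.1).1 (by simp))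
    obtain ⟨g, d, d0, G⟩ := ih hq qM q0 fun f fM ha hf => na f fM ha (lt3 hf qe)
    have dc := cq.of_le (G.cc 0) (G.le 0)
    have og : ∀ i, d * p * g i = 0 := fun i => by
      rw [← le_symm (G.pj i) hq (G.le i), ← mul_assoc, mul_assoc d, pq]; simp
    have pd := cz_pj (G.cc 0).1 hp
    refine ⟨Fin.cons (d * p) g, d, d0, ?_, ?_, ?_, ?_, ?_⟩
    · exact Fin.cases (hM.mul (hM.cen (G.cc 0).1) pM) G.mem
    · exact Fin.cases pd G.pj
    · exact Fin.cases (zle pe) fun i => lt3 (G.le i) qe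
    · exact Fin.cases (dc ▸ cp.zmul (G.cc 0).1 :) G.cc
    · intro i j
      refine Fin.cases (Fin.cases ?_ ?_ j) (fun i => Fin.cases ?_ ?_ j) i
      · exact fun h => absurd rfl h
      · exact fun j _ => og j
      · exact fun _ => orth_symm pd (G.pj i) (og i)
      · exact fun j h => G.orth i j fun h' => h (by rw [h'])

theorem split1 (hM : Masa M) (h1 : AWC (1 : B)) (ι : Type*) [Finite ι] {e : B} (he : IsProjection e) (eM : e ∈ M) (e0 : e ≠ 0)
    (na : NoAb M e) : ∃ (g : ι → B) (c : B), c ≠ 0 ∧ SplitF M e c g := by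
  obtain ⟨m, ⟨σ⟩⟩ := Finite.exists_equiv_fin ι
  obtain ⟨g, c, c0, G⟩ := split0 hM h1 m he eM e0 na
  exact ⟨fun i => g (σ i).castSucc, c, c0, fun _ => G.mem _, fun _ => G.pj _, fun _ => G.le _, fun _ => G.cc _,
    fun i j h => G.orth _ _ fun h' => h (σ.injective (Fin.castSucc_injective _ h'))⟩

structure Tup (M : Set B) (e : B) {ι : Type*} (g : ι → B) : Prop where
  mem : ∀ i, g i ∈ M
  pj : ∀ i, IsProjection (g i)
  le : ∀ i, g i * e = g i
  eqv : ∀ i j, ProjEquiv (g i) (g j)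
  orth : ∀ i j, i ≠ j → g i * g j = 0
  ne : ∀ i, g i ≠ 0

def HitS (M : Set B) (e : B) : Prop := ∀ e' ∈ M, IsProjection e' → e' * e = e' → ∀ g, IsProjection g → (∃ b, g * b * e' ≠ 0) →
  ∃ h ∈ M, IsProjection h ∧ h ≠ 0 ∧ h * e' = h ∧ SubE h g

theorem com_sub (h1 : AWC (1 : B)) {ι : Type*} {c : B} (c0 : c ≠ 0) (hc : IsCentralProj c) {g : ι → B} (cc : ∀ i, CC (g i) c)
    (pg : ∀ i, IsProjection (g i)) (s : Finset ι) : ∃ f, f ≠ 0 ∧ IsProjection f ∧ f * c = f ∧ ∀ i ∈ s, SubE f (g i) := by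
  classical
  induction s using Finset.induction_on with
  | empty => exact ⟨c, c0, hc.1, hc.1.2, by simp⟩
  | insert i s hi ih =>
    obtain ⟨f, f0, hf, fc, H⟩ := ih
    have : ∃ b, g i * b * f ≠ 0 := by
      by_contra h
      push Not at h
      exact f0 (by rw [← fc, ← hc.2]; exact ((cc i).2 f).1 h)
    obtain ⟨b, hb⟩ := this
    obtain ⟨w, w0, w1, w2, w3, -⟩ := II1 (e := g i) (awp h1 hf) (by rw [← mul_assoc, ← mul_assoc, (pg i).2]) (by rw [mul_assoc _ f, hf.2]) hb
    have pw := pi_src w1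
    have wf : star w * w * f = star w * w := by rw [mul_assoc, w2]
    refine ⟨star w * w, fun h => w0 (z1 h), pw, lt3 wf fc, fun j hj => ?_⟩
    rcases Finset.mem_insert.1 hj with rfl | hj
    · exact ⟨w, rfl, w3⟩
    · exact (SubE.of_le pw (le_symm pw hf wf)).trans (H j hj)

theorem hit (hM : Masa M) (h1 : AWC (1 : B)) {e g f : B} (S : HitS M e) (hg : IsProjection g) (gM : g ∈ M) (ge : g * e = g)
    (hf : IsProjection f) (s : SubE f g) : ∃ h ∈ M, IsProjection h ∧ h * g = h ∧ ProjEquiv h f := by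
  obtain ⟨W, hW, hW2, hmax⟩ := exists_max_OPI (fun w : B => w * star w ∈ M ∧ g * w = w ∧ w * f = w)
  obtain ⟨V, hV⟩ := addP_all h1 f g W hW (fun w hw => (hW2 w hw).2.2.symm)
  have Vf : V * f = V := hV.le_src fun w hw => (hW2 w hw).2.2.2
  have gV : g * V = V := hV.le_rng hg.1 fun w hw => (hW2 w hw).2.2.1
  have hM' : V * star V ∈ M := hM.ann hV.ann_rng (by rintro _ ⟨w, hw, rfl⟩; exact (hW2 w hw).2.1)
  have ph := pi_rng hV.pi
  have pk := pi_src hV.pi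
  set h := V * star V with hh
  set k := star V * V with hk
  have hkE : ProjEquiv k h := ⟨V, rfl, rfl⟩
  have kf : k * f = k := by rw [hk, mul_assoc, Vf]
  have hg' : h * g = h := le_symm' ph hg (by rw [hh, ← mul_assoc, gV])
  have pfk := pj_sub pk hf kf
  have pgh := pj_sub ph hg hg'
  obtain ⟨z, hz⟩ := CA_one h1 (f - k)
  have zM := hM.cen hz.1
  have a1 : z * (g - h) = 0 := by
    by_contra hne
    obtain ⟨h0, m0, p0, n0, l0, w, w1, w2⟩ := S (z * (g - h)) (hM.mul zM (hM.sub gM hM')) (cz_pj hz.1 pgh)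
      (zle (by rw [sub_mul, ge, lt3 hg' ge])) (f - k) pfk (by
        by_contra H
        push Not at H
        exact hne (by rw [← cz_zz hz.1]; exact (hz.2 _).1 H))
    have gh0 : (g - h) * h0 = h0 := le_symm p0 pgh (lt3 (b := z * (g - h)) l0 (zle pgh.2))
    have w3 : w * h0 = w := pi_of_pj p0 w1
    have w4 : h0 * star w = star w := by simpa [p0.1] using st w3
    have w5 : star w * (f - k) = star w := by simpa [pfk.1] using st w2
    have hgh : h * (g - h) = 0 := by rw [mul_sub, hg', ph.2, sub_self]
    have kfk : (f - k) * k = 0 := by rw [sub_mul, le_symm pk hf kf, pk.2, sub_self]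
    have gs : (g - h) * star w = star w := by rw [← w4, ← mul_assoc, gh0]
    have sw := hmax (star w) (by rw [star_star]; exact pi_star (pi3 p0 w1)) ⟨by rw [star_star, w1]; exact m0, by
        rw [← gs, ← mul_assoc, mul_sub, hg.2, le_symm ph hg hg'], by
        rw [← w5, mul_assoc, sub_mul, hf.2, kf]⟩ (fun w' hw' => ⟨by
          have e1 : h * w' = w' := by
            have := hV.ann_rng.mul_self ⟨w', hw', rfl⟩
            have := le_symm (pi_rng (hW.1 w' hw')) ph this
            rw [← hW.1 w' hw', ← mul_assoc w', ← mul_assoc h, this]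
          have e2 : star w' * h = star w' := by simpa [ph.1] using st e1
          rw [← e2, ← gs, mul_assoc, ← mul_assoc h, hgh]; simp, by
          have e1 : w' * k = w' := by
            have := hV.ann_src.mul_self ⟨w', hw', rfl⟩
            rw [← hW.1 w' hw', mul_assoc w', this]
          rw [star_star, ← e1, ← w2, mul_assoc, ← mul_assoc k, orth_symm pfk pk kfk]; simp⟩)
    exact n0 (by rw [← w1, sw, zero_mul])
  have a2 : (1 - z) * f = (1 - z) * k := by
    have := hz.mul'
    rw [← sub_eq_zero, ← mul_sub, sub_mul, one_mul, this, sub_self]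
  have a3 : z * g = z * h := by rwa [mul_sub, sub_eq_zero] at a1
  have zh := hz.1
  have zc := cz_compl zh
  have b1 : ProjEquiv (z * g) (z * f) := SB h1 (cz_pj zh hg) (cz_pj zh hf)
    (a3 ▸ (SubE.of_equiv (cz_pj zh ph) (pe_zmul zh (pe_symm hkE))).trans
      (SubE.of_le (cz_pj zh pk) (by rw [cz_m zh, le_symm pk hf kf]))) (s.zmul zh)
  have b2 : ProjEquiv ((1 - z) * h) ((1 - z) * f) := a2 ▸ pe_zmul zc (pe_symm hkE)
  have oz : ∀ a b : B, (z * a) * ((1 - z) * b) = 0 := fun a b => by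
    rw [zc.2, ← mul_assoc, mul_assoc z a b, mul_sub, mul_one, ← zh.2, cz_zz zh, sub_self]
  have := pe_add (cz_pj zh hg) (cz_pj zc ph) (oz _ _) b1 b2 (oz _ _)
  rw [← cz_split zh] at this
  exact ⟨_, hM.add (hM.mul zM gM) (hM.mul (hM.cen zc) hM'), pj_add (cz_pj zh hg) (cz_pj zc ph) (oz _ _), by
    rw [add_mul, zle hg.2, zle hg'], this⟩

theorem neS (hM : Masa M) (h1 : AWC (1 : B)) {e : B} (S : HitS M e) (ι : Type*) [Finite ι] (he : IsProjection e) (eM : e ∈ M) (e0 : e ≠ 0)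
    (na : NoAb M e) : ∃ g : ι → B, Tup M e g := by
  cases nonempty_fintype ι
  obtain ⟨g, c, c0, G⟩ := split1 hM h1 ι he eM e0 na
  by_cases hι : IsEmpty ι
  · exact ⟨g, G.mem, G.pj, G.le, fun i => hι.elim i, G.orth, fun i => hι.elim i⟩
  rw [not_isEmpty_iff] at hι
  obtain ⟨f, f0, hf, -, H⟩ := com_sub h1 c0 (G.cc hι.some).1 G.cc G.pj Finset.univ
  choose h m p l q using fun i => hit hM h1 S (G.pj i) (G.mem i) (G.le i) hf (H i (Finset.mem_univ i))
  refine ⟨h, m, p, fun i => lt3 (l i) (G.le i), fun i j => pe_trans (p i) (q i) (pe_symm (q j)), fun i j hij => ?_, fun i hi => ?_⟩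
  · rw [← l i, ← le_symm (p j) (G.pj j) (l j), mul_assoc, ← mul_assoc (g i), G.orth i j hij]; simp
  · obtain ⟨v, v1, v2⟩ := q i
    rw [hi] at v1
    exact f0 (by rw [← v2, z1 v1, zero_mul])
end MM

set_option linter.unusedVariables false
set_option linter.unusedSimpArgs false
set_option linter.style.haveILetI false
namespace MM
variable {B : Type*} [CStarAlgebra B] {M : Set B}

structure Good (M : Set B) (e g h : B) (W : Set B) (w : W → B) (c t : B) : Prop where
  mem : h ∈ M
  pj : IsProjection h
  ne : h ≠ 0
  le : h * e = h
  cc : CC h c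
  src : ∀ i, star (w i) * w i = c * g
  rng : ∀ i, h * w i = w i
  orth : ∀ i j, i ≠ j → star (w i) * w j = 0
  pt : IsProjection t
  th : t * h = t
  ann : Ann (Set.range fun i => w i * star (w i)) (h - t)
  sub : SubE t (c * g)

theorem zann {ι : Type*} {w : ι → B} {E z : B} (hz : IsCentralProj z) (h : Ann (Set.range fun i => w i * star (w i)) E) :
    Ann (Set.range fun i => (z * w i) * star (z * w i)) (z * E) := by
  refine ⟨cz_pj hz h.1, fun x => ?_⟩
  rw [mul_assoc, ← cz_l hz, ← h.2, Set.forall_mem_range, Set.forall_mem_range]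
  simp only [cz_s hz, cz_m hz]
  simp only [mul_assoc, cz_l hz]

theorem ne_nS (hM : Masa M) (h1 : AWC (1 : B)) {e : B} (S : ¬ HitS M e) (ι : Type) [Finite ι] (na : NoAb M e) :
    ∃ g : ι → B, Tup M e g := by
  unfold HitS at S
  push Not at S
  obtain ⟨e1, e1M, he1, e1e, g, hg, ⟨b, hb⟩, S⟩ := S
  obtain ⟨d, cd⟩ := CA_one h1 g
  set e' := d * e1 with he'
  have pe' : IsProjection e' := cz_pj cd.1 he1
  have e'1 : e' * e1 = e' := zle he1.2
  have e'e : e' * e = e' := zle e1e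
  have e'M : e' ∈ M := hM.mul (hM.cen cd.1) e1M
  have e'0 : e' ≠ 0 := fun h => hb ((cd.2 e1).2 h b)
  have key : ∀ h ∈ M, IsProjection h → h ≠ 0 → h * e' = h → ∀ c, CC h c → SubE (c * g) h ∧ c * g ≠ 0 := by
    intro h m p n l c hc
    obtain ⟨z, hz, s1, s2⟩ := gc h1 p hg
    have zh : z * h = 0 := by
      by_contra hne
      exact S _ (hM.mul (hM.cen hz) m) (cz_pj hz p) hne (zle (lt3 l e'1)) (s1.trans (SubE.of_le (cz_pj hz hg) (by rw [cz_l hz, hg.2])))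
    have zc := (cc_zero hc hz).1 zh
    have e1 : (1 - z) * h = h := by rw [sub_mul, zh]; simp
    have e2 : c * ((1 - z) * g) = c * g := by rw [← mul_assoc, mul_sub, ← hz.2, zc]; simp
    have := s2.zmul hc.1
    rw [e1, e2, hc.mul'] at this
    refine ⟨this, fun h0 => hc.ne_zero n ?_⟩
    have := (cc_zero cd hc.1).1 h0
    rwa [hc.le cd.1 (lt3 l (by rw [he', cd.1.2, mul_assoc, cd.1.1.2]))] at this
  have exG : ∀ h ∈ M, IsProjection h → h ≠ 0 → h * e' = h → ∀ c, CC h c → ∃ W : Set B, (∀ w ∈ W, star w * w = c * g ∧ h * w = w) ∧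
      (∀ w ∈ W, ∀ w' ∈ W, w ≠ w' → star w * w' = 0) ∧ ∃ h' w c' t, Good M e' g h' W w c' t := by
    intro h m p n l c hc
    obtain ⟨k1, k2⟩ := key h m p n l c hc
    obtain ⟨W, t, -, a2, a3, a4, a5, a6, a7, a8⟩ := EX (CA_one h1) (awp h1 p) (awp h1 (cz_pj hc.1 hg)) k2 ∅ (by simp) (by simp)
    obtain ⟨z, hz, z0, zs⟩ := a8 (addP_all h1 _ _)
    refine ⟨W, a2, a3, z * h, fun w => z * w, z * c, z * t, hM.mul (hM.cen hz) m, cz_pj hz p, fun h0 => z0 ?_, zle l, hc.zmul hz,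
      fun i => ?_, fun i => ?_, fun i j hij => ?_, cz_pj hz a4, ?_, ?_, ?_⟩
    · rw [← mul_assoc, (cc_zero hc hz).1 h0, zero_mul]
    · rw [cz_s hz, cz_m hz, (a2 i i.2).1, mul_assoc]
    · rw [cz_m hz, (a2 i i.2).2]
    · rw [cz_s hz, cz_m hz, a3 i i.2 j j.2 (fun h => hij (Subtype.ext h)), mul_zero]
    · rw [cz_m hz, a5]
    · rw [← mul_sub]
      refine zann (w := fun i : W => (i : B)) hz ?_
      rwa [Set.image_eq_range] at a7
    · rwa [mul_assoc]
  let P : Set Cardinal := {κ | ∃ (W : Set B) (h : B) (w : W → B) (c t : B), Good M e' g h W w c t ∧ Cardinal.mk W = κ}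
  have P0 : P.Nonempty := by
    obtain ⟨c, hc⟩ := CA_one h1 e'
    obtain ⟨W, -, -, h', w, c', t, G⟩ := exG e' e'M pe' e'0 pe'.2 c hc
    exact ⟨_, W, h', w, c', t, G, rfl⟩
  obtain ⟨W, h, w, c, t, G, hκ⟩ := csInf_mem P0
  have many : ∀ h' ∈ M, IsProjection h' → h' ≠ 0 → h' * e' = h' → ∀ c', CC h' c' →
      ∃ x : W → B, (∀ i, star (x i) * x i = c' * g) ∧ (∀ i, h' * x i = x i) ∧ ∀ i j, i ≠ j → star (x i) * x j = 0 := by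
    intro h' m p n l c' hc
    obtain ⟨W', a1, a2, h'', w'', c'', t'', G''⟩ := exG h' m p n l c' hc
    have : Cardinal.mk W ≤ Cardinal.mk W' := hκ ▸ csInf_le' ⟨W', h'', w'', c'', t'', G'', rfl⟩
    obtain ⟨σ⟩ := (Cardinal.le_def _ _).1 this
    exact ⟨fun i => σ i, fun i => (a1 _ (σ i).2).1, fun i => (a1 _ (σ i).2).2, fun i j hij => a2 _ (σ i).2 _ (σ j).2
      fun h => hij (σ.injective (Subtype.ext h))⟩
  obtain ⟨q, a, a0, Q⟩ := split1 hM h1 (ι × Bool) G.pj G.mem G.ne fun f fM fa fh => na f fM fa (lt3 fh (lt3 G.le e'e))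
  by_cases hι : IsEmpty ι
  · exact ⟨fun _ => 0, fun i => hι.elim i, fun i => hι.elim i, fun i => hι.elim i, fun i => hι.elim i, fun i => hι.elim i, fun i => hι.elim i⟩
  rw [not_isEmpty_iff] at hι
  obtain ⟨i0⟩ := hι
  have ha := (Q.cc (i0, true)).1
  have ac : a * c = a := G.cc.of_le (Q.cc (i0, true)) (Q.le _)
  have q0 : ∀ i, q i ≠ 0 := fun i h => a0 (by
    have := (cc_zero (Q.cc i) ha).1 (by rw [h, mul_zero])
    rwa [ha.1.2] at this)
  have qe : ∀ i, q i * e' = q i := fun i => lt3 (Q.le i) G.le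
  have main : ∀ i, ProjEquiv (q (i, true) + q (i, false)) (a * h) := by
    intro i
    have oq := Q.orth (i, true) (i, false) (by simp)
    have pq := pj_add (Q.pj _) (Q.pj _) oq
    have ph := cz_pj ha G.pj
    have haq : ∀ j, (a * h) * q j = q j := fun j => by
      rw [mul_assoc, le_symm (Q.pj j) G.pj (Q.le j), (Q.cc j).mul']
    refine SB h1 pq ph (SubE.of_le pq (by rw [mul_add, haq, haq])) ?_
    have s1 : SubE (a * t) (q (i, true)) := by
      have := G.sub.zmul ha
      rw [← mul_assoc, ac] at this
      exact this.trans (key _ (Q.mem _) (Q.pj _) (q0 _) (qe _) a (Q.cc _)).1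
    have s2 : SubE (a * (h - t)) (q (i, false)) := by
      obtain ⟨x, x1, x2, x3⟩ := many _ (Q.mem (i, false)) (Q.pj _) (q0 _) (qe _) a (Q.cc _)
      have pag := cz_pj ha hg
      have y1 : ∀ i, star (a * w i) * (a * w i) = a * g := fun i => by rw [cz_s ha, cz_m ha, G.src, ← mul_assoc, ac]
      have F : Fam (fun i => a * w i) := ⟨fun i => pi3 pag (y1 i), fun i j hij => by
        rw [cz_s ha, cz_m ha, G.orth i j hij, mul_zero]⟩
      have F' : Fam x := ⟨fun i => pi3 pag (x1 i), x3⟩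
      exact add_sub (addP_all h1 _ _) (Q.pj _) (fun i => a * w i * star (a * w i)) (fun i => x i * star (x i)) F.pj
        (fun i j hij => F.oe hij) (fun i j hij => F'.oe hij)
        (fun i => pe_trans (F.pj i) (pe_symm ⟨_, y1 i, rfl⟩) ⟨_, x1 i, rfl⟩) (zann ha G.ann) (fun i => by rw [← mul_assoc, x2])
    have := s1.add s2 (Q.pj _) (Q.pj _) oq
    rwa [← mul_add, show t + (h - t) = h by abel] at this
  have pp : ∀ i, IsProjection (q (i, true) + q (i, false)) := fun i => pj_add (Q.pj _) (Q.pj _) (Q.orth _ _ (by simp))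
  refine ⟨fun i => q (i, true) + q (i, false), fun i => hM.add (Q.mem _) (Q.mem _), pp, fun i => ?_,
    fun i j => pe_trans (pp i) (main i) (pe_symm (main j)), fun i j hij => ?_, fun i hi => q0 (i, true) ?_⟩
  · rw [add_mul, lt3 (qe _) e'e, lt3 (qe _) e'e]
  · have : ∀ b b', q (i, b) * q (j, b') = 0 := fun b b' => Q.orth _ _ (by simp [hij])
    simp [add_mul, mul_add, this]
  · have := congrArg (q (i, true) * ·) hi
    simpa [mul_add, (Q.pj _).2, Q.orth (i, true) (i, false) (by simp)] using this

theorem NE (hM : Masa M) (h1 : AWC (1 : B)) {e : B} (ι : Type) [Finite ι] (he : IsProjection e) (eM : e ∈ M) (e0 : e ≠ 0)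
    (na : NoAb M e) : ∃ g : ι → B, Tup M e g := by
  by_cases S : HitS M e
  · exact neS hM h1 S ι he eM e0 na
  · exact ne_nS hM h1 S ι na
end MM

set_option linter.unusedVariables false
set_option linter.unusedSimpArgs false
set_option linter.style.haveILetI false
namespace MM
universe v
variable {B : Type v} [CStarAlgebra B] {M : Set B}

theorem exChar (hM : Masa M) {f : B} (hf : IsProjection f) (fM : f ∈ M) (f0 : f ≠ 0) :
    ∃ (K : Type v) (_ : Field K) (_ : CharZero K) (X : B → K), (∀ x ∈ M, ∀ y ∈ M, X (x + y) = X x + X y) ∧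
      (∀ x ∈ M, ∀ y ∈ M, X (x * y) = X x * X y) ∧ X f = 1 := by
  classical
  have scal : ∀ c : ℂ, algebraMap ℂ B c ∈ M := fun c => hM.max _ fun y _ => Algebra.commutes c y
  have one : (1 : B) ∈ M := hM.cen cz_one
  have zero : (0 : B) ∈ M := hM.cen cz_zero
  let R : Subring B := { carrier := M, mul_mem' := hM.mul, one_mem' := one, add_mem' := hM.add, zero_mem' := zero,
                         neg_mem' := fun {x} hx => by simpa using hM.sub zero hx }
  letI : CommRing R := { (inferInstance : Ring R) with mul_comm := fun a b => Subtype.ext (hM.comm a a.2 b b.2) }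
  let f' : R := ⟨1 - f, hM.sub one fM⟩
  have nu : f' ∈ nonunits R := by
    rintro ⟨⟨a, b, h, h'⟩, rfl : a = f'⟩
    have := congrArg Subtype.val h
    change (1 - f) * (b : B) = 1 at this
    have := congrArg (f * ·) this
    simp only [← mul_assoc, mul_sub, mul_one, hf.2, sub_self, zero_mul] at this
    exact f0 this.symm
  obtain ⟨I, hI, fI⟩ := exists_max_ideal_of_mem_nonunits nu
  letI := Ideal.Quotient.field I
  let φ : ℂ →+* R := (algebraMap ℂ B).codRestrict R scal
  haveI : CharZero (R ⧸ I) := charZero_of_injective_ringHom (f := (Ideal.Quotient.mk I).comp φ) (RingHom.injective _)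
  refine ⟨R ⧸ I, inferInstance, inferInstance, fun x => if h : x ∈ M then Ideal.Quotient.mk I ⟨x, h⟩ else 0, ?_, ?_, ?_⟩
  · intro x hx y hy
    simp only [hx, hy, hM.add hx hy, dite_true]
    rw [← map_add]; rfl
  · intro x hx y hy
    simp only [hx, hy, hM.mul hx hy, dite_true]
    rw [← map_mul]; rfl
  · simp only [fM, dite_true]
    have := Ideal.Quotient.eq_zero_iff_mem.2 fI
    have e : (⟨f, fM⟩ : R) = 1 - f' := Subtype.ext (by change f = 1 - (1 - f); abel)
    rw [e, map_sub, this, map_one, sub_zero]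

theorem idem_trace {K ι : Type*} [Field K] [Fintype ι] [DecidableEq ι] (P : Matrix ι ι K) (h : P * P = P) : ∃ m : ℕ, P.trace = m := by
  have : IsIdempotentElem (Matrix.toLin' P) := by
    show Matrix.toLin' P * Matrix.toLin' P = _
    rw [Module.End.mul_eq_comp, ← Matrix.toLin'_mul, h]
  have := (LinearMap.IsIdempotentElem.isProj_range _ this).trace
  rw [Matrix.trace_toLin'_eq] at this
  exact ⟨_, this⟩

theorem exTrace (hM : Masa M) {f z : B} (hf : IsAbelianProj f) (fM : f ∈ M) (f0 : f ≠ 0) (hz : IsCentralProj z) (zf : z * f = f)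
    {ι : Type*} [Fintype ι] (y : ι → B) (yf : ∀ a, y a * f = y a) (zy : ∀ a, z * y a = y a) (hs : ∑ a, y a * star (y a) = z) :
    ∃ (K : Type v) (_ : Field K) (_ : CharZero K) (τ : B → K), (∀ x y, τ (x + y) = τ x + τ y) ∧ (∀ x y, τ (x * y) = τ (y * x)) ∧
      (∀ p, IsProjection p → ∃ m : ℕ, τ p = m) ∧ τ f = 1 ∧ ∀ x, τ (z * x) = τ x := by
  classical
  obtain ⟨K, i1, i2, X, Xa, Xm, Xf⟩ := exChar hM hf.1 fM f0
  have fy : ∀ a, f * star (y a) = star (y a) := fun a => by simpa [hf.1.1] using st (yf a)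
  have mem : ∀ a b x, star (y a) * x * y b ∈ M := fun a b x => by
    have := hM.abl hf fM (star (y a) * x * y b)
    rwa [mul_assoc f, mul_assoc _ (y b), yf, ← mul_assoc, ← mul_assoc, fy] at this
  have X0 : X 0 = 0 := by
    have := Xa 0 (hM.cen cz_zero) 0 (hM.cen cz_zero)
    simpa using this
  have Xs : ∀ (s : Finset ι) (g : ι → B), (∀ i, g i ∈ M) → X (∑ i ∈ s, g i) = ∑ i ∈ s, X (g i) := fun s g hg => by
    induction s using Finset.induction_on with
    | empty => simpa using X0
    | insert i s hi ih => rw [Finset.sum_insert hi, Finset.sum_insert hi, Xa _ (hg i) _ (hM.sum s hg), ih]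
  let Φ : B → Matrix ι ι K := fun x => Matrix.of fun a b => X (star (y a) * x * y b)
  have Φm : ∀ x x', Φ (x * x') = Φ x * Φ x' := fun x x' => by
    ext a b
    simp only [Matrix.mul_apply, Φ, Matrix.of_apply]
    have : ∀ c, X (star (y a) * x * y c) * X (star (y c) * x' * y b) = X (star (y a) * x * y c * (star (y c) * x' * y b)) :=
      fun c => (Xm _ (mem _ _ _) _ (mem _ _ _)).symm
    rw [Finset.sum_congr rfl (fun c _ => this c), ← Xs _ _ (fun c => hM.mul (mem _ _ _) (mem _ _ _))]
    congr 1
    have : ∀ c, star (y a) * x * y c * (star (y c) * x' * y b) = star (y a) * x * (y c * star (y c)) * (x' * y b) := fun c => by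
      simp only [mul_assoc]
    rw [Finset.sum_congr rfl (fun c _ => this c), ← Finset.sum_mul, ← Finset.mul_sum, hs, ← hz.2]
    simp only [mul_assoc]
    rw [hz.2]
    simp only [mul_assoc]
    rw [← hz.2, zy]
  refine ⟨K, i1, i2, fun x => (Φ x).trace, fun x x' => ?_, fun x x' => ?_, fun p hp => ?_, ?_, fun x => ?_⟩
  · have : Φ (x + x') = Φ x + Φ x' := by
      ext a b
      simp only [Φ, Matrix.of_apply, Matrix.add_apply, mul_add, add_mul]
      exact Xa _ (mem _ _ _) _ (mem _ _ _)
    show (Φ _).trace = _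
    rw [this, Matrix.trace_add]
  · show (Φ _).trace = (Φ _).trace
    rw [Φm, Φm, Matrix.trace_mul_comm]
  · exact idem_trace _ (by rw [← Φm, hp.2])
  · show ∑ a, X (star (y a) * f * y a) = 1
    have m2 : ∀ a, f * y a ∈ M := fun a => by
      have := hM.abl hf fM (y a)
      rwa [mul_assoc, yf] at this
    have m3 : ∀ a, star (y a) * f ∈ M := fun a => by simpa [hf.1.1] using hM.star _ (m2 a)
    have : ∀ a, star (y a) * f * y a = f * (y a * star (y a)) * f := fun a => by
      have := hM.comm _ (m3 a) _ (m2 a)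
      rw [← mul_assoc, mul_assoc (star (y a)) f f, hf.1.2] at this
      rw [this]; simp only [mul_assoc]
    rw [← Xs _ _ (fun a => mem _ _ _), Finset.sum_congr rfl (fun a _ => this a), ← Finset.sum_mul, ← Finset.mul_sum, hs,
      mul_assoc, zf, hf.1.2, Xf]
  · have : Φ (z * x) = Φ x := by
      ext a b
      simp only [Φ, Matrix.of_apply]
      rw [hz.2, ← mul_assoc, mul_assoc _ z, zy]
    show (Φ _).trace = _
    rw [this]
end MM

set_option linter.unusedVariables false
set_option linter.unusedSimpArgs false
set_option linter.style.haveILetI false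
namespace MM
universe v
variable {B : Type v} [CStarAlgebra B] {M : Set B}

theorem tr_sum {K : Type*} [Field K] {τ : B → K} (ta : ∀ x y, τ (x + y) = τ x + τ y) {ι : Type*} [Fintype ι] (g : ι → B) (a : K)
    (h : ∀ i, τ (g i) = a) : τ (∑ i, g i) = Fintype.card ι * a := by
  have : τ (∑ i, g i) = ∑ i, τ (g i) := map_sum (AddMonoidHom.mk' τ ta) g Finset.univ
  rw [this, Finset.sum_congr rfl (fun i _ => h i)]
  simp

theorem fin_case (hM : Masa M) {n k : ℕ} {ε : Fin n → B} (pε : ∀ i, IsProjection (ε i)) (eε : ∀ i j, ProjEquiv (ε i) (ε j))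
    (sε : ∑ i, ε i = 1) {f z : B} (hf : IsAbelianProj f) (fM : f ∈ M) (f0 : f ≠ 0) (hz : IsCentralProj z) (zf : z * f = f)
    {p : Fin n → B} (pp : ∀ i, IsProjection (p i)) (ep : ∀ i j, ProjEquiv (p i) (p j)) (zp : ∀ i, z * p i = p i)
    {q : Fin k → B} (eq : ∀ j, ProjEquiv f (q j)) (hs : ∑ i, p i + ∑ j, q j = z) (i0 : Fin n)
    {ι : Type*} [Fintype ι] (y : ι → B) (yf : ∀ a, y a * f = y a) (py : ∀ a, p i0 * y a = y a) (sy : ∑ a, y a * star (y a) = p i0) :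
    n ∣ k := by
  choose v v1 v2 using fun i => ep i0 i
  choose w w1 w2 using eq
  have pv : ∀ i, p i * v i = v i := fun i => by rw [← v2, mul_assoc]; exact pi3 (pp i0) (v1 i)
  obtain ⟨K, i1, i2, τ, ta, tm, tp, tf, tz⟩ := exTrace hM hf fM f0 hz zf
    (y := fun a : (Fin n × ι) ⊕ Fin k => Sum.elim (fun a => v a.1 * y a.2) w a) (by
      rintro (a | j)
      · simp only [Sum.elim_inl, mul_assoc, yf]
      · simp only [Sum.elim_inr]; exact pi_of_pj hf.1 (w1 j)) (by
      rintro (a | j)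
      · simp only [Sum.elim_inl]; rw [← pv, ← mul_assoc, ← mul_assoc, zp]
      · simp only [Sum.elim_inr]; rw [← pi_of_pj hf.1 (w1 j), ← mul_assoc, hz.2, mul_assoc, zf]) (by
      rw [Fintype.sum_sum_type, ← hs, Fintype.sum_prod_type]
      simp only [Sum.elim_inl, Sum.elim_inr, w2]
      congr 1
      refine Finset.sum_congr rfl fun i _ => ?_
      have : ∀ a, v i * y a * star (v i * y a) = v i * (y a * star (y a)) * star (v i) := fun a => by simp only [star_mul, mul_assoc]
      rw [Finset.sum_congr rfl (fun a _ => this a), ← Finset.sum_mul, ← Finset.mul_sum, sy, pi_of_pj (pp i0) (v1 i), v2])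
  have te : ∀ {e e' : B}, ProjEquiv e e' → τ e' = τ e := by
    rintro e e' ⟨u, rfl, rfl⟩
    exact tm _ _
  obtain ⟨a, ha⟩ := tp _ (pε i0)
  obtain ⟨b, hb⟩ := tp _ (pp i0)
  have e1 := tr_sum ta ε a (fun i => (te (eε i0 i)).trans ha)
  have e2 := tr_sum ta p b (fun i => (te (ep i0 i)).trans hb)
  have e3 := tr_sum ta q 1 (fun j => (te ⟨w j, w1 j, w2 j⟩).trans tf)
  have e4 := tz 1
  rw [mul_one, ← hs, ta, e2, e3, ← sε, e1] at e4
  simp only [Fintype.card_fin, mul_one] at e4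
  norm_cast at e4
  exact (Nat.dvd_add_right ⟨b, rfl⟩).1 ⟨a, e4⟩

theorem absorbN (h1 : AWC (1 : B)) {ι : Type*} {p f : B} {q : ι → B} (hp : IsProjection p) (hf : IsProjection f)
    (pq : ∀ i, IsProjection (q i)) (oq : ∀ i j, i ≠ j → q i * q j = 0) (o : ∀ i, p * q i = 0) (e : ∀ i, ProjEquiv (q i) f)
    {x : ℕ → B} (x1 : ∀ n, star (x n) * x n = f) (x2 : ∀ n m, n ≠ m → star (x n) * x m = 0)
    (x3 : ∀ n, p * x n = x n) (s : Finset ι) : ProjEquiv (p + ∑ i ∈ s, q i) p := by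
  classical
  have ps : ∀ s : Finset ι, p * ∑ i ∈ s, q i = 0 := fun s => by rw [Finset.mul_sum]; exact Finset.sum_eq_zero fun i _ => o i
  induction s using Finset.induction_on with
  | empty => simpa using pe_refl hp
  | insert i s hi ih =>
    have pp := pj_add hp (sum_pj s pq oq) (ps s)
    have o1 : (p + ∑ i ∈ s, q i) * q i = 0 := by rw [add_mul, o, sum_orth s hi oq, add_zero]
    have := absorb h1 pp (pq i) o1 hf (e i) x1 x2 (fun n => by
      rw [add_mul, ← x3 n, ← mul_assoc, ← mul_assoc, orth_symm hp (sum_pj s pq oq) (ps s), hp.2]; simp)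
    rw [Finset.sum_insert hi, add_comm (q i), ← add_assoc]
    exact pe_trans (pj_add pp (pq i) o1) this ih
end MM

set_option linter.unusedVariables false
set_option linter.unusedSimpArgs false
set_option linter.style.haveILetI false
namespace MM
universe v
variable {B : Type v} [CStarAlgebra B] {M : Set B}

structure Tq (M : Set B) {ι : Type*} (g : ι → B) : Prop where
  mem : ∀ i, g i ∈ M
  pj : ∀ i, IsProjection (g i)
  eqv : ∀ i j, ProjEquiv (g i) (g j)
  orth : ∀ i j, i ≠ j → g i * g j = 0

def RR {ι : Type*} (g g' : ι → B) : Prop := ∀ i j, g i * g' j = 0 ∧ g' j * g i = 0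

theorem glueT (hM : Masa M) (h1 : AWC (1 : B)) {ι : Type*} (W : Set (ι → B)) (hW : ∀ g ∈ W, Tq M g)
    (hR : ∀ g ∈ W, ∀ g' ∈ W, g ≠ g' → RR g g') : ∃ p : ι → B, Tq M p ∧ ∀ i, Ann (Set.range fun g : W => g.1 i) (p i) := by
  choose p hp using fun i => exAnn h1 (Set.range fun g : W => g.1 i)
  refine ⟨p, ⟨fun i => hM.ann (hp i) ?_, fun i => (hp i).1, fun i j => ?_, fun i j hij => ?_⟩, hp⟩
  · rintro _ ⟨g, rfl⟩; exact (hW g g.2).mem i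
  · exact add_equiv (addP_all h1 _ _) (fun g : W => g.1 i) (fun g : W => g.1 j) (fun g => (hW g g.2).pj i)
      (fun g g' h => (hR g g.2 g' g'.2 (fun h' => h (Subtype.ext h')) i i).1)
      (fun g g' h => (hR g g.2 g' g'.2 (fun h' => h (Subtype.ext h')) j j).1) (fun g => (hW g g.2).eqv i j) (hp i) (hp j)
  · refine ((hp i).2 _).1 ?_
    rintro _ ⟨g, rfl⟩
    refine ((hp j).left _).1 ?_
    rintro _ ⟨g', rfl⟩
    dsimp only
    rw [((hW g' g'.2).pj j).1]
    by_cases h : g.1 = g'.1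
    · rw [h]; exact (hW g' g'.2).orth i j hij
    · exact (hR g g.2 g' g'.2 h i j).1

theorem sum_le {ι : Type*} [Fintype ι] {p : ι → B} {z : B} (h : ∀ i, p i * z = p i) : (∑ i, p i) * z = ∑ i, p i := by
  rw [Finset.sum_mul]; exact Finset.sum_congr rfl fun i _ => h i

/-- abelian part of the remainder -/
theorem rem_ab (hM : Masa M) (h1 : AWC (1 : B)) {n : ℕ} (hn : 0 < n) {r : B} (hr : IsProjection r) (rM : r ∈ M) (r0 : r ≠ 0)
    (ab : ∀ e ∈ M, IsProjection e → e ≠ 0 → e * r = e → ∃ f ∈ M, IsAbelianProj f ∧ f ≠ 0 ∧ f * e = f)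
    (nt : ∀ g : Fin n → B, ¬ Tup M r g) :
    ∃ (m : ℕ) (f : Fin (m + 1) → B) (c : B), c ≠ 0 ∧ m + 1 < n ∧ SplitF M r c f ∧ (∀ j, IsAbelianProj (f j)) ∧ ∑ j, f j = c * r := by
  let Q : ℕ → Prop := fun m => ∃ (f : Fin (m + 1) → B) (c : B), c ≠ 0 ∧ SplitF M r c f ∧ ∀ j, IsAbelianProj (f j)
  have Qn : ∀ m, n ≤ m + 1 → ¬ Q m := by
    rintro m hm ⟨f, c, c0, F, A⟩
    refine nt (fun i => f (Fin.castLE hm i)) ⟨fun i => F.mem _, fun i => F.pj _, fun i => F.le _, fun i j => ab_equiv h1 (A _) (A _) (F.cc _) (F.cc _),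
      fun i j hij => F.orth _ _ (fun h => hij (Fin.castLE_injective hm h)), fun i hi => c0 ?_⟩
    have := (cc_zero (F.cc (Fin.castLE hm i)) (F.cc 0).1).1 (by rw [hi, mul_zero])
    rwa [(F.cc 0).1.1.2] at this
  have Q0 : Q 0 := by
    obtain ⟨f, fM, fa, f0, fr⟩ := ab r rM hr r0 hr.2
    obtain ⟨c, hc⟩ := CA_one h1 f
    exact ⟨fun _ => f, c, hc.ne_zero f0, ⟨fun _ => fM, fun _ => fa.1, fun _ => fr, fun _ => hc, fun i j h => absurd (by omega) h⟩, fun _ => fa⟩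
  obtain ⟨m, hm, hm'⟩ : ∃ m, Q m ∧ ¬ Q (m + 1) := by
    by_contra H
    push Not at H
    have : ∀ m, Q m := fun m => by
      induction m with
      | zero => exact Q0
      | succ m ih => exact H m ih
    exact Qn n (by omega) (this n)
  have mn : m + 1 < n := by
    by_contra h
    exact Qn m (by omega) hm
  obtain ⟨f, c, c0, F, A⟩ := hm
  refine ⟨m, f, c, c0, mn, F, A, ?_⟩
  have hc := (F.cc 0).1
  have ps := sum_pj Finset.univ F.pj F.orth
  have cr := cz_pj hc hr
  have fcr : ∀ j, f j * (c * r) = f j := fun j => by rw [← mul_assoc, (F.cc j).mul, F.le]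
  have sl := sum_le fcr
  have pd := pj_sub ps cr sl
  by_contra hne
  obtain ⟨g, gM, ga, g0, gd⟩ := ab (c * r - ∑ j, f j) (hM.sub (hM.mul (hM.cen hc) rM) (hM.sum _ F.mem)) pd
    (sub_ne_zero.2 (Ne.symm hne)) (by rw [sub_mul, zle hr.2, sum_le F.le])
  have gcr : g * (c * r) = g := lt3 gd (by rw [sub_mul, cr.2, sl])
  have gf : ∀ j, g * f j = 0 := fun j => by
    rw [← gd, mul_assoc, sub_mul, le_symm (F.pj j) cr (fcr j), sum_in _ (Finset.mem_univ j) F.pj F.orth, sub_self, mul_zero]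
  obtain ⟨d, hd⟩ := CA_one h1 g
  have dc : d * c = d := hd.le hc (by
    rw [← gcr, mul_assoc, mul_assoc, ← hc.2 r, cz_zz hc])
  have pdf : ∀ j, IsProjection (d * f j) := fun j => cz_pj hd.1 (F.pj j)
  have og : ∀ j, g * (d * f j) = 0 := fun j => by rw [cz_l hd.1, gf, mul_zero]
  refine hm' ⟨Fin.cons g fun j => d * f j, d, hd.ne_zero g0, ⟨?_, ?_, ?_, ?_, ?_⟩, ?_⟩
  · exact Fin.cases gM fun j => hM.mul (hM.cen hd.1) (F.mem j)
  · exact Fin.cases ga.1 pdf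
  · exact Fin.cases (lt3 gcr (zle hr.2)) fun j => zle (F.le j)
  · exact Fin.cases hd fun j => (dc ▸ (F.cc j).zmul hd.1 :)
  · intro i j
    refine Fin.cases (Fin.cases ?_ ?_ j) (fun i => Fin.cases ?_ ?_ j) i
    · exact fun h => absurd rfl h
    · exact fun j _ => og j
    · exact fun _ => orth_symm ga.1 (pdf i) (og i)
    · exact fun j h => by
        simp only [Fin.cons_succ]
        rw [cz_m hd.1, F.orth i j fun h' => h (by rw [h']), mul_zero]
  · exact Fin.cases ga fun j => ab_le (A j) (pdf j) (zle (F.pj j).2)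

theorem loc (hM : Masa M) (h1 : AWC (1 : B)) {n : ℕ} (hn : 0 < n) {ε : Fin n → B} (pε : ∀ i, IsProjection (ε i))
    (eε : ∀ i j, ProjEquiv (ε i) (ε j)) (sε : ∑ i, ε i = 1) {z : B} (hz : IsCentralProj z) (z0 : z ≠ 0) :
    ∃ (c : B) (q : Fin n → B), IsCentralProj c ∧ c ≠ 0 ∧ c * z = c ∧ Tq M q ∧ ∑ i, q i = c := by
  classical
  obtain ⟨W, -, W1, W2, W3⟩ := exists_max_pw (fun g : Fin n → B => Tup M z g) RR ∅ (by simp) (by simp) (fun g g' h i j => (h j i).symm)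
  obtain ⟨p, P, hp⟩ := glueT hM h1 W (fun g hg => ⟨(W1 g hg).mem, (W1 g hg).pj, (W1 g hg).eqv, (W1 g hg).orth⟩) W2
  have pz : ∀ i, p i * z = p i := fun i => (hp i).le (by rintro _ ⟨g, rfl⟩; exact (W1 g g.2).le i)
  have ps := sum_pj Finset.univ P.pj P.orth
  have pr := pj_sub ps hz.1 (sum_le pz)
  set r := z - ∑ i, p i with hr
  have rM : r ∈ M := hM.sub (hM.cen hz) (hM.sum _ P.mem)
  have rz : r * z = r := by rw [hr, sub_mul, hz.1.2, sum_le pz]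
  have rp : ∀ i, r * p i = 0 := fun i => by
    rw [hr, sub_mul, hz.2, pz, sum_in _ (Finset.mem_univ i) P.pj P.orth, sub_self]
  have nt : ∀ g : Fin n → B, ¬ Tup M r g := by
    intro g G
    have o : ∀ i j, g i * p j = 0 := fun i j => by rw [← G.le i, mul_assoc, rp, mul_zero]
    have gW : g ∈ W := W3 g ⟨G.mem, G.pj, fun i => lt3 (G.le i) rz, G.eqv, G.orth, G.ne⟩ (fun g' hg' i j => by
      have : p j * g' j = g' j := le_symm ((W1 g' hg').pj j) (P.pj j) ((hp j).mul_self ⟨⟨g', hg'⟩, rfl⟩)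
      have k : g i * g' j = 0 := by rw [← this, ← mul_assoc, o, zero_mul]
      exact ⟨k, orth_symm (G.pj i) ((W1 g' hg').pj j) k⟩)
    refine G.ne ⟨0, hn⟩ ?_
    have := (hp ⟨0, hn⟩).mul_self ⟨⟨g, gW⟩, rfl⟩
    exact this.symm.trans (o _ _)
  have ab : ∀ e ∈ M, IsProjection e → e ≠ 0 → e * r = e → ∃ f ∈ M, IsAbelianProj f ∧ f ≠ 0 ∧ f * e = f := by
    intro e eM he e0 er
    by_contra H
    push Not at H
    obtain ⟨g, G⟩ := NE hM h1 (Fin n) he eM e0 fun f fM fa fe => by_contra fun f0 => H f fM fa f0 fe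
    exact nt g ⟨G.mem, G.pj, fun i => lt3 (G.le i) er, G.eqv, G.orth, G.ne⟩
  by_cases r0 : r = 0
  · exact ⟨z, p, hz, z0, hz.1.2, P, (sub_eq_zero.1 r0).symm⟩
  obtain ⟨m, f, c, c0, mn, F, A, sf⟩ := rem_ab hM h1 hn pr rM r0 ab nt
  have hc := (F.cc 0).1
  have cz : c * z = c := (F.cc 0).le hz (lt3 (F.le 0) rz)
  have sc : ∑ i, c * p i + ∑ j, f j = c := by
    rw [sf, ← Finset.mul_sum, ← mul_add, hr]
    rw [show ∑ i, p i + (z - ∑ i, p i) = z by abel, cz]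
  set i0 : Fin n := ⟨0, hn⟩
  have pc : ∀ i, IsProjection (c * p i) := fun i => cz_pj hc (P.pj i)
  have f0 : f 0 ≠ 0 := fun h => c0 (by
    have := (cc_zero (F.cc 0) hc).1 (by rw [h, mul_zero])
    rwa [hc.1.2] at this)
  have ef : ∀ j, ProjEquiv (f 0) (f j) := fun j => ab_equiv h1 (A _) (A _) (F.cc _) (F.cc _)
  have pf : ∀ i j, p i * f j = 0 := fun i j => by
    rw [← le_symm (F.pj j) pr (F.le j), ← mul_assoc, orth_symm pr (P.pj i) (rp i), zero_mul]
  obtain ⟨X, t, -, a2, a3, a4, a5, a6, a7, a8⟩ := EX (CA_one h1) (awp h1 (pc i0)) (awp h1 (F.pj 0)) f0 ∅ (by simp) (by simp)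
  by_cases fin : X.Infinite
  · have σ := fin.natEmbedding
    have key : ProjEquiv (c * p i0 + ∑ j, f j) (c * p i0) := absorbN h1 (pc i0) (F.pj 0) F.pj F.orth
      (fun j => by rw [mul_assoc, pf, mul_zero]) (fun j => pe_symm (ef j)) (x := fun k => σ k) (fun k => (a2 _ (σ k).2).1)
      (fun k l h => a3 _ (σ k).2 _ (σ l).2 fun h' => h (σ.injective (Subtype.ext h'))) (fun k => (a2 _ (σ k).2).2) Finset.univ
    have pS := sum_pj Finset.univ F.pj F.orth
    have oS : ∀ i, c * p i * ∑ j, f j = 0 := fun i => by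
      rw [Finset.mul_sum]; exact Finset.sum_eq_zero fun j _ => by rw [mul_assoc, pf, mul_zero]
    have oc : ∀ i j, i ≠ j → c * p i * (c * p j) = 0 := fun i j h => by rw [cz_m hc, P.orth i j h, mul_zero]
    let q : Fin n → B := fun i => c * p i + if i = i0 then ∑ j, f j else 0
    have qp : ∀ i, IsProjection (q i) := fun i => by
      by_cases h : i = i0
      · simp only [q, h, if_true]; exact pj_add (pc i0) pS (oS i0)
      · simpa [q, h] using pc i
    have qE : ∀ i, ProjEquiv (q i) (c * p i0) := fun i => by
      by_cases h : i = i0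
      · simpa only [q, h, if_true] using key
      · simpa [q, h] using pe_zmul hc (P.eqv i i0)
    refine ⟨c, q, hc, c0, cz, ⟨fun i => hM.add (hM.mul (hM.cen hc) (P.mem i)) ?_, qp,
      fun i j => pe_trans (qp i) (qE i) (pe_symm (qE j)), fun i j hij => ?_⟩, ?_⟩
    · split_ifs
      · exact hM.sum _ F.mem
      · exact hM.cen cz_zero
    · simp only [q]
      by_cases h : i = i0
      · have h' : j ≠ i0 := fun h' => hij (h.trans h'.symm)
        rw [if_pos h, if_neg h', add_zero, add_mul, oc i j hij, orth_symm (pc j) pS (oS j), add_zero]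
      · rw [if_neg h, add_zero, mul_add, oc i j hij, zero_add]
        split_ifs
        · exact oS i
        · exact mul_zero _
    · rw [Finset.sum_add_distrib, Finset.sum_ite_eq' Finset.univ i0, if_pos (Finset.mem_univ _), sc]
  · exfalso
    rw [Set.not_infinite] at fin
    haveI := fin.fintype
    obtain ⟨s, hs, s0, u, u1, u2⟩ := a8 (addP_all h1 _ _)
    have u3 : star u * (s * f 0) = star u := by simpa [(cz_pj hs (F.pj 0)).1] using st u2
    have u4 : (s * t) * star u = star u := by
      have := st (pi_of_pj (cz_pj hs a4) u1)
      rwa [(cz_pj hs a4).1] at this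
    have hsf := cz_pj hs (F.pj 0)
    have ct := le_symm a4 (pc i0) a5
    have FX : Fam (fun w : X => (w : B)) := ⟨fun w => pi3 (F.pj 0) (a2 w w.2).1, fun w w' h => a3 w w.2 w' w'.2 fun h' => h (Subtype.ext h')⟩
    have := fin_case hM pε eε sε (f := s * f 0) (z := s * c) (ab_le (A 0) hsf (zle (F.pj 0).2)) (hM.mul (hM.cen hs) (F.mem 0)) s0
      (cz_mul hs hc) (by rw [mul_assoc, cz_l hs, cz_zz hs, (F.cc 0).mul']) (p := fun i => s * (c * p i)) (fun i => cz_pj hs (pc i))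
      (fun i j => pe_zmul hs (pe_zmul hc (P.eqv i j))) (fun i => by rw [mul_assoc, cz_l hs, cz_zz hs, cz_zz hc])
      (q := fun j => s * f j) (fun j => pe_zmul hs (ef j)) (by rw [← Finset.mul_sum, ← Finset.mul_sum _ _ s, ← mul_add, sc]) i0
      (y := fun a : X ⊕ Unit => Sum.elim (fun w : X => s * (w : B)) (fun _ => star u) a) (by
        rintro (w | _)
        · simp only [Sum.elim_inl]; rw [cz_m hs, pi_of_pj (F.pj 0) (a2 w w.2).1]
        · exact u3) (by
        rintro (w | _)
        · simp only [Sum.elim_inl]; rw [cz_m hs, (a2 w w.2).2]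
        · simp only [Sum.elim_inr]; rw [← u4, ← mul_assoc, cz_m hs, ct]) (by
        rw [Fintype.sum_sum_type]
        have e1 : ∑ w : X, (w : B) * star (w : B) = c * p i0 - t :=
          (sum_ann FX.pj fun i j h => FX.oe h).unique (by rwa [Set.image_eq_range] at a7)
        simp only [Sum.elim_inl, Sum.elim_inr, cz_s hs, cz_m hs, Finset.univ_unique, Finset.sum_singleton, star_star, u1]
        rw [← Finset.mul_sum, e1, ← mul_add, sub_add_cancel])
    have := Nat.le_of_dvd (by omega) this
    omega

theorem glob (hM : Masa M) (h1 : AWC (1 : B)) {n : ℕ} (hn : 0 < n) {ε : Fin n → B} (pε : ∀ i, IsProjection (ε i))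
    (eε : ∀ i j, ProjEquiv (ε i) (ε j)) (sε : ∑ i, ε i = 1) : ∃ q : Fin n → B, Tq M q ∧ ∑ i, q i = 1 := by
  obtain ⟨W, -, W1, W2, W3⟩ := exists_max_pw (fun g : Fin n → B => Tq M g ∧ IsCentralProj (∑ i, g i) ∧ ∑ i, g i ≠ 0) RR ∅
    (by simp) (by simp) (fun g g' h i j => (h j i).symm)
  obtain ⟨p, P, hp⟩ := glueT hM h1 W (fun g hg => (W1 g hg).1) W2
  refine ⟨p, P, ?_⟩
  obtain ⟨S, hS⟩ := exAnn h1 (Set.range fun g : W => ∑ i, g.1 i)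
  have cS : IsCentralProj S := ⟨hS.1, fun a => (hS.commute (c := a) (by rintro _ ⟨g, rfl⟩; exact (W1 g g.2).2.1.2 a)
    (by rintro _ ⟨g, rfl⟩; exact (W1 g g.2).2.1.2 _)).symm⟩
  have gs : ∀ g ∈ W, ∀ i, (∑ i, g i) * g i = g i := fun g hg i => sum_in _ (Finset.mem_univ i) (W1 g hg).1.pj (W1 g hg).1.orth
  have S1 : S = 1 := by
    by_contra hne
    obtain ⟨c, q, hc, c0, cz, T, sq⟩ := loc hM h1 hn pε eε sε (cz_compl cS) (sub_ne_zero.2 (Ne.symm hne))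
    have qc : ∀ i, q i * c = q i := fun i => le_symm' (T.pj i) hc.1 (by rw [← sq]; exact sum_in _ (Finset.mem_univ i) T.pj T.orth)
    have cSz : c * S = 0 := by rw [← cz, mul_assoc, sub_mul, cS.1.2, one_mul, sub_self, mul_zero]
    have cg : ∀ g ∈ W, c * ∑ i, g i = 0 := fun g hg => by
      rw [← le_symm (W1 g hg).2.1.1 hS.1 (hS.mul_self ⟨⟨g, hg⟩, rfl⟩), ← mul_assoc, cSz, zero_mul]
    have o : ∀ g ∈ W, ∀ i j, q i * g j = 0 := fun g hg i j => by
      rw [← qc i, ← gs g hg j, mul_assoc, ← mul_assoc c, cg g hg]; simp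
    have qW := W3 q ⟨T, sq.symm ▸ hc, sq.symm ▸ c0⟩ fun g hg i j => ⟨o g hg i j, orth_symm (T.pj i) ((W1 g hg).1.pj j) (o g hg i j)⟩
    have := cg q qW
    rw [sq, hc.1.2] at this
    exact c0 this
  have : S * (1 - ∑ i, p i) = 0 := (hS.2 _).1 (by
    rintro _ ⟨g, rfl⟩
    have : ∀ i, g.1 i * ∑ j, p j = g.1 i := fun i => by
      have gp := (hp i).mul_self ⟨g, rfl⟩
      have pi := le_symm' (P.pj i) (sum_pj Finset.univ P.pj P.orth) (sum_in _ (Finset.mem_univ i) P.pj P.orth)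
      exact lt3 gp pi
    dsimp only
    rw [mul_sub, mul_one, sum_le this, sub_self])
  rw [S1, one_mul, sub_eq_zero] at this
  exact this.symm
end MM

set_option linter.unusedVariables false
set_option linter.unusedSimpArgs false
set_option linter.style.haveILetI false
namespace MM

theorem masa_max {R : Type*} [Ring R] [StarRing R] [Algebra ℂ R] [StarModule ℂ R] {M : StarSubalgebra ℂ R} (hM : IsMaximalAbelian M)
    (x : R) (hx : ∀ y ∈ M, x * y = y * x) : x ∈ M := by
  have sa : ∀ a : R, star a = a → (∀ y ∈ M, a * y = y * a) → a ∈ M := by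
    intro a ha hc
    have h1 : ∀ s ∈ (M : Set R) ∪ {a}, ∀ t ∈ (M : Set R) ∪ {a}, s * t = t * s := by
      rintro s (hs | rfl) t (ht | rfl)
      · exact hM.1 s hs t ht
      · exact (hc s hs).symm
      · exact hc t ht
      · rfl
    have h2 : ∀ s ∈ (M : Set R) ∪ {a}, star s ∈ (M : Set R) ∪ {a} := by
      rintro s (hs | rfl)
      · exact Or.inl (star_mem hs)
      · exact Or.inr ha
    have := hM.2 (StarAlgebra.adjoin ℂ ((M : Set R) ∪ {a})) (fun s hs t ht => by
      letI := StarAlgebra.adjoinCommRingOfComm ℂ h1 (fun s hs t ht => h1 s hs _ (h2 t ht))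
      exact congrArg Subtype.val (mul_comm (⟨s, hs⟩ : StarAlgebra.adjoin ℂ ((M : Set R) ∪ {a})) ⟨t, ht⟩))
      (fun y hy => StarAlgebra.subset_adjoin ℂ _ (Or.inl hy))
    rw [this]
    exact StarAlgebra.subset_adjoin ℂ _ (Or.inr rfl)
  have hs : ∀ y ∈ M, star x * y = y * star x := fun y hy => by
    have := congrArg star (hx (star y) (star_mem hy))
    simp only [star_mul, star_star] at this
    exact this.symm
  have a1 := sa (x + star x) (by simp [add_comm]) (fun y hy => by rw [add_mul, mul_add, hx y hy, hs y hy])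
  have a2 := sa (Complex.I • (x - star x)) (by simp [star_smul, smul_sub]; abel) (fun y hy => by
    rw [smul_mul_assoc, mul_smul_comm, sub_mul, mul_sub, hx y hy, hs y hy])
  have e : x = (1 / 2 : ℂ) • ((x + star x) - Complex.I • (Complex.I • (x - star x))) := by
    rw [smul_smul, Complex.I_mul_I, neg_one_smul, sub_neg_eq_add, show x + star x + (x - star x) = (2 : ℂ) • x by rw [two_smul]; abel, smul_smul]
    norm_num
  rw [e]
  exact M.smul_mem (sub_mem a1 (M.smul_mem a2 _)) _

theorem eps {A : Type*} [CStarAlgebra A] (n : ℕ) : ∃ ε : Fin n → Matrix (Fin n) (Fin n) A, (∀ i, IsProjection (ε i)) ∧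
    (∀ i j, ProjEquiv (ε i) (ε j)) ∧ ∑ i, ε i = 1 := by
  refine ⟨fun i => Matrix.single i i 1, fun i => ⟨?_, ?_⟩, fun i j => ⟨Matrix.single j i 1, ?_, ?_⟩, ?_⟩
  · simp [Matrix.star_eq_conjTranspose]
  · simp
  · simp [Matrix.star_eq_conjTranspose]
  · simp [Matrix.star_eq_conjTranspose]
  · ext i j
    simp only [Matrix.sum_apply, Matrix.single_apply, Matrix.one_apply, ite_and, Finset.sum_ite_eq', Finset.mem_univ, if_true]

theorem core {A : Type*} [CStarAlgebra A]
    (hAW : IsAWStarRing A) (n : ℕ) (hn : 0 < n)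
    (M : StarSubalgebra ℂ (Matrix (Fin n) (Fin n) A)) (hM : IsMaximalAbelian M) :
    ∃ p : Fin n → Matrix (Fin n) (Fin n) A,
      (∀ i, p i ∈ M) ∧ (∀ i, IsProjection (p i)) ∧ PairwiseOrthogonal p ∧
      (∀ i j, ProjEquiv (p i) (p j)) ∧ ∑ i, p i = 1 := by
  letI : PartialOrder A := CStarAlgebra.spectralOrder A
  haveI : StarOrderedRing A := CStarAlgebra.spectralOrderedRing A
  let g : Matrix (Fin n) (Fin n) A ≃⋆ₐ[ℂ] CStarMatrix (Fin n) (Fin n) A := CStarMatrix.ofMatrixStarAlgEquiv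
  have h1 := mat_awc g ⟨0, hn⟩ (AWC_one hAW)
  have N : Masa {x : CStarMatrix (Fin n) (Fin n) A | g.symm x ∈ M} := by
    refine ⟨fun x hx => ?_, fun x hx y hy => ?_, fun x hx => ?_⟩
    · show g.symm (star x) ∈ M
      rw [map_star]; exact star_mem hx
    · apply EquivLike.injective g.symm
      rw [map_mul, map_mul]
      exact hM.1 _ hx _ hy
    · refine masa_max hM (g.symm x) fun y hy => ?_
      have := hx (g y) (show g.symm (g y) ∈ M by rwa [StarAlgEquiv.symm_apply_apply])
      apply EquivLike.injective g
      rw [map_mul, map_mul, StarAlgEquiv.apply_symm_apply]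
      exact this
  obtain ⟨ε, a1, a2, a3⟩ := eps (A := A) n
  obtain ⟨q, T, sq⟩ := glob N h1 hn (ε := fun i => g (ε i)) (fun i => ⟨by rw [← map_star, (a1 i).1], by rw [← map_mul, (a1 i).2]⟩)
    (fun i j => by
      obtain ⟨v, v1, v2⟩ := a2 i j
      exact ⟨g v, by rw [← map_star, ← map_mul, v1], by rw [← map_star, ← map_mul, v2]⟩) (by rw [← map_sum, a3, map_one])
  refine ⟨fun i => g.symm (q i), T.mem, fun i => ⟨?_, ?_⟩, fun i j h => ?_, fun i j => ?_, ?_⟩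
  · rw [← map_star, (T.pj i).1]
  · rw [← map_mul, (T.pj i).2]
  · rw [← map_mul, T.orth i j h, map_zero]
  · obtain ⟨v, v1, v2⟩ := T.eqv i j
    exact ⟨g.symm v, by rw [← map_star, ← map_mul, v1], by rw [← map_star, ← map_mul, v2]⟩
  · rw [← map_sum, sq, map_one]
end MM


/-- Any maximal abelian subalgebra of `Mₙ(A)`, for `A` an AW*-algebra, contains
`n` pairwise orthogonal, pairwise equivalent projections with sum `1`. -/
theorem masa_matrix_algebra_projections {A : Type u} [NormedRing A] [StarRing A]
    [CStarRing A] [NormedAlgebra ℂ A] [StarModule ℂ A] [CompleteSpace A]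
    (hAW : IsAWStarRing A) (n : ℕ) (hn : 0 < n)
    (M : StarSubalgebra ℂ (Matrix (Fin n) (Fin n) A)) (hM : IsMaximalAbelian M) :
    ∃ p : Fin n → Matrix (Fin n) (Fin n) A,
      (∀ i, p i ∈ M) ∧ (∀ i, IsProjection (p i)) ∧ PairwiseOrthogonal p ∧
      (∀ i j, ProjEquiv (p i) (p j)) ∧ ∑ i, p i = 1 := by
  letI : CStarAlgebra A := {}
  exact MM.core hAW n hn M hM
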